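/- For each finite P > 0 and each λ ∈ (0,1] there exist a continuous P-periodic function φ : ℝ → ℝ and a wave speed μ ∈ (0,1] such that: φ solves the steady Whitham equation with wave speed μ; φ is even and strictly increasing on (−P/2, 0); φ is infinitely differentiable on ℝ ∖ Pℤ, and infinitely differentiable on all of ℝ if λ ∈ (0,1); φ satisfies the Hölder-1/2 estimate sup_{x≠y} |φ(x) − φ(y)|/|x − y|^{1/2} < ∞; and the bounds μ − 1 ≤ φ(x) ≤ φ(0) = λμ/2 hold for all x ∈ ℝ. -/

import Mathlib

open Real Filter MeasureTheory

/-- The Whitham symbol `m(ξ) = √(tanh ξ / ξ)`, with `m 0 = 1`. -/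
noncomputable def whithamSymbol (ξ : ℝ) : ℝ :=
  if ξ = 0 then 1 else Real.sqrt (Real.tanh ξ / ξ)

/-- The Whitham kernel, defined for `x ≠ 0` as the improper integral
`K(x) = (1/π)·lim_{R→∞} ∫₀^R m(ξ) cos(xξ) dξ`, and `K 0 = 0`. -/
noncomputable def whithamKernel (x : ℝ) : ℝ :=
  if x = 0 then 0 else
    limUnder atTop
      (fun R : ℝ => (1 / Real.pi) * ∫ ξ in (0:ℝ)..R, whithamSymbol ξ * Real.cos (x * ξ))

/-- The convolution operator `Lf(x) = ∫_ℝ K(x−y) f(y) dy`. -/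
noncomputable def Lop (K f : ℝ → ℝ) (x : ℝ) : ℝ := ∫ y : ℝ, K (x - y) * f y

section Brouwer

variable {E : Type*} [NormedAddCommGroup E] [InnerProductSpace ℝ E] [FiniteDimensional ℝ E]

theorem exists_polynomial_det_one_add_smul (A : E →L[ℝ] E) :
    ∃ p : Polynomial ℝ, p.natDegree ≤ Module.finrank ℝ E ∧
      ∀ t : ℝ, (1 + t • A : E →L[ℝ] E).det = p.eval t := by
  classical
  let b := Module.finBasis ℝ E
  let M : Matrix (Fin (Module.finrank ℝ E)) (Fin (Module.finrank ℝ E)) ℝ :=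
    LinearMap.toMatrix b b A.toLinearMap
  refine ⟨((Polynomial.X : Polynomial ℝ) • M.map Polynomial.C + (1 : Matrix (Fin (Module.finrank ℝ E)) (Fin (Module.finrank ℝ E)) ℝ).map Polynomial.C).det, ?_, ?_⟩
  · simpa using Polynomial.natDegree_det_X_add_C_le M 1
  · intro t
    rw [ContinuousLinearMap.det, ← LinearMap.det_toMatrix b, ← Polynomial.coe_evalRingHom,
      RingHom.map_det]
    congr 1
    ext i j
    by_cases h : i = j
    · simp [M, h, LinearMap.toMatrix_apply, add_comm, mul_comm t]
    · simp [M, h, LinearMap.toMatrix_apply, mul_comm t]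

theorem sum_lagrange_det {n : ℕ} {s : Finset ℝ} (hs : n < s.card) (p : Polynomial ℝ)
    (hp : p.natDegree ≤ n) (x : ℝ) :
    p.eval x = ∑ i ∈ s, p.eval i * (Lagrange.basis s id i).eval x := by
  have h := Lagrange.eq_interpolate (f := p) (s := s) (v := id) (fun _ _ _ _ h => h)
    (lt_of_le_of_lt Polynomial.degree_le_natDegree (by exact_mod_cast lt_of_le_of_lt hp hs))
  conv_lhs => rw [h]
  simp [Lagrange.interpolate_apply, Polynomial.eval_finsetSum]

theorem bijective_add_smul_of_lipschitz {v : E → E} {C : NNReal} (hv : LipschitzWith C v) {t : ℝ}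
    (ht0 : 0 ≤ t) (ht : t * C < 1) : Function.Bijective (fun x => x + t • v x) := by
  constructor
  · intro x y hxy
    have h1 : x - y = t • (v y - v x) := by
      have : x + t • v x = y + t • v y := hxy
      rw [smul_sub, sub_eq_sub_iff_add_eq_add, this, add_comm]
    have h2 : ‖x - y‖ ≤ t * (C * ‖x - y‖) := by
      conv_lhs => rw [h1]
      rw [norm_smul, Real.norm_of_nonneg ht0, norm_sub_rev x y]
      exact mul_le_mul_of_nonneg_left (hv.norm_sub_le y x) ht0
    by_contra hne
    have : 0 < ‖x - y‖ := norm_pos_iff.2 (sub_ne_zero.2 hne)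
    nlinarith
  · intro y
    have hc : ContractingWith (⟨t, ht0⟩ * C) (fun x => y - t • v x) := by
      refine ⟨by rw [← NNReal.coe_lt_coe]; exact ht, ?_⟩
      refine LipschitzWith.of_dist_le_mul fun a b => ?_
      rw [dist_eq_norm, dist_eq_norm]
      have : y - t • v a - (y - t • v b) = t • (v b - v a) := by rw [smul_sub]; abel
      rw [this, norm_smul, Real.norm_of_nonneg ht0, norm_sub_rev a b]
      have := mul_le_mul_of_nonneg_left (hv.norm_sub_le b a) ht0
      exact this.trans_eq (mul_assoc _ _ _).symm
    obtain ⟨x, hx⟩ : ∃ x, Function.IsFixedPt (fun x => y - t • v x) x :=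
      ⟨_, hc.fixedPoint_isFixedPt⟩
    exact ⟨x, by have : y - t • v x = x := hx
                 show x + t • v x = y
                 nth_rewrite 1 [← this]; abel⟩

variable [MeasurableSpace E] [BorelSpace E]

theorem no_smooth_retraction {v : E → E} {U : Set E} (hU : IsOpen U)
    (hBU : Metric.closedBall (0 : E) 1 ⊆ U)
    (hv : ContDiffOn ℝ 1 v U) (hv0 : ∀ x : E, ‖x‖ = 1 → v x = 0)
    (h1 : ∀ x : E, ‖x‖ ≤ 1 → ‖x + v x‖ = 1) : False := by
  classical
  have hdiff : ∀ x ∈ Metric.ball (0 : E) 1, DifferentiableAt ℝ v x := fun x hx =>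
    (hv.differentiableOn (by norm_num)).differentiableAt
      (hU.mem_nhds (hBU (Metric.ball_subset_closedBall hx)))
  -- Lipschitz on the closed ball
  obtain ⟨C, hC⟩ : ∃ C : NNReal, LipschitzOnWith C v (Metric.closedBall (0 : E) 1) := by
    exact (hv.mono hBU).exists_lipschitzOnWith one_ne_zero (convex_closedBall _ _)
      (isCompact_closedBall (0 : E) 1)
  let w : E → E := fun x => if ‖x‖ ≤ 1 then v x else 0
  have hwC : LipschitzWith C w := by
    have key : ∀ x y : E, ‖x‖ ≤ 1 → 1 < ‖y‖ → ‖v x‖ ≤ C * ‖x - y‖ := by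
      intro x y hx hy
      obtain ⟨s, hs, hs1⟩ : ∃ s ∈ Set.Icc (0:ℝ) 1, ‖x + s • (y - x)‖ = 1 := by
        have := intermediate_value_Icc (f := fun s : ℝ => ‖x + s • (y - x)‖) zero_le_one
          (by fun_prop)
        exact this ⟨by simpa using hx, by simpa using hy.le⟩
      have := hC.norm_sub_le (x := x) (y := x + s • (y - x)) (by simpa using hx)
        (by simp [hs1])
      rw [hv0 _ hs1, sub_zero] at this
      refine this.trans (mul_le_mul_of_nonneg_left ?_ C.2)
      rw [sub_add_cancel_left, norm_neg, norm_smul, Real.norm_of_nonneg hs.1, norm_sub_rev]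
      exact mul_le_of_le_one_left (norm_nonneg _) hs.2
    refine LipschitzWith.of_dist_le_mul fun x y => ?_
    rw [dist_eq_norm, dist_eq_norm]
    by_cases hx : ‖x‖ ≤ 1 <;> by_cases hy : ‖y‖ ≤ 1 <;> simp only [w, hx, hy, if_true, if_false]
    · exact hC.norm_sub_le (by simpa using hx) (by simpa using hy)
    · simpa using key x y hx (not_le.1 hy)
    · rw [zero_sub, norm_neg, norm_sub_rev]; exact key y x hy (not_le.1 hx)
    · simp; positivity
  have hfd : ∀ x ∈ Metric.ball (0 : E) 1, ‖fderiv ℝ v x‖ ≤ C := fun x hx =>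
    norm_fderiv_le_of_lipschitzOn ℝ (Metric.closedBall_mem_nhds_of_mem hx) hC
  obtain ⟨δ, hδ, hdet⟩ : ∃ δ > 0, ∀ A : E →L[ℝ] E, ‖A‖ < δ → 0 < (1 + A).det := by
    have hcont : Continuous fun A : E →L[ℝ] E => (1 + A).det :=
      ContinuousLinearMap.continuous_det.comp (by fun_prop)
    have : ∀ᶠ A in nhds (0 : E →L[ℝ] E), 0 < (1 + A).det := by
      refine hcont.continuousAt.eventually (lt_mem_nhds ?_)
      simp [ContinuousLinearMap.det]
    obtain ⟨δ, hδ, h⟩ := Metric.eventually_nhds_iff.1 this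
    exact ⟨δ, hδ, fun A hA => h (by simpa using hA)⟩
  obtain ⟨ε, hε, hε1, hεδ⟩ : ∃ ε : ℝ, 0 < ε ∧ ε * C < 1 ∧ ε * C < δ := by
    have : ∀ᶠ ε : ℝ in nhdsWithin (0:ℝ) (Set.Ioi 0), ε * C < min 1 δ :=
      nhdsWithin_le_nhds ((continuous_id.mul continuous_const).continuousAt.eventually
        (gt_mem_nhds (by simpa using hδ)))
    obtain ⟨ε, h1, h2⟩ := (this.and self_mem_nhdsWithin).exists
    exact ⟨ε, h2, h1.trans_le (min_le_left _ _), h1.trans_le (min_le_right _ _)⟩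
  set B := Metric.ball (0 : E) 1 with hB
  let J : ℝ → E → ℝ := fun t x => (1 + t • fderiv ℝ v x : E →L[ℝ] E).det
  have hvol : ∀ t ∈ Set.Icc 0 ε, IntegrableOn (J t) B ∧ ∫ x in B, J t x = volume.real B := by
    intro t ht
    have hbij := bijective_add_smul_of_lipschitz hwC ht.1
      (lt_of_le_of_lt (mul_le_mul_of_nonneg_right ht.2 C.2) hε1)
    have hout : ∀ x ∉ B, x + t • w x = x := by
      intro x hx
      have hx' : 1 ≤ ‖x‖ := by simpa [hB] using hx
      rcases hx'.eq_or_lt with h | h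
      · simp [w, hv0 x h.symm]
      · simp [w, not_le.2 h]
    have hin : ∀ x ∈ B, x + t • w x = x + t • v x := by
      intro x hx
      have hx' : ‖x‖ ≤ 1 := by simpa using (Metric.ball_subset_closedBall hx)
      simp [w, hx']
    have himg : (fun x => x + t • v x) '' B = B := by
      ext y
      constructor
      · rintro ⟨x, hx, rfl⟩
        by_contra hy
        have := hbij.1 (a₁ := x) (a₂ := x + t • v x)
          (by simp only; rw [hout _ hy, hin x hx])
        exact hy (by simp only; rw [← this]; exact hx)
      · intro hy
        obtain ⟨x, hx⟩ := hbij.2 y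
        have hxB : x ∈ B := by
          by_contra h
          have hx' : x + t • w x = y := hx
          rw [hout x h] at hx'; exact h (hx' ▸ hy)
        exact ⟨x, hxB, by rw [← hx]; exact (hin x hxB).symm⟩
    have hinj : Set.InjOn (fun x => x + t • v x) B := by
      intro x hx y hy hxy
      exact hbij.1 (by simp only; rw [hin x hx, hin y hy]; exact hxy)
    have hder : ∀ x ∈ B, HasFDerivWithinAt (fun x => x + t • v x)
        (1 + t • fderiv ℝ v x : E →L[ℝ] E) B x := fun x hx =>
      ((hasFDerivAt_id x).add ((hdiff x hx).hasFDerivAt.const_smul t)).hasFDerivWithinAt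
    have habs : ∀ x ∈ B, |J t x| = J t x := by
      intro x hx
      refine abs_of_pos (hdet _ ?_)
      rw [norm_smul, Real.norm_of_nonneg ht.1]
      exact lt_of_le_of_lt (mul_le_mul ht.2 (hfd x hx) (norm_nonneg _) hε.le) hεδ
    have hBm : MeasurableSet B := measurableSet_ball
    constructor
    · have := (integrableOn_image_iff_integrableOn_abs_det_fderiv_smul volume hBm hder hinj
        (fun _ => (1:ℝ))).1 (by
          rw [himg]; exact integrableOn_const measure_ball_lt_top.ne)
      refine this.congr_fun (fun x hx => ?_) hBm
      simp only [smul_eq_mul, mul_one]; exact habs x hx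
    · have := integral_image_eq_integral_abs_det_fderiv_smul volume hBm hder hinj
        (fun _ => (1:ℝ))
      rw [himg] at this
      rw [setIntegral_const, smul_eq_mul, mul_one] at this
      rw [this]
      refine setIntegral_congr_fun hBm (fun x hx => ?_)
      simp only [smul_eq_mul, mul_one]; exact (habs x hx).symm
  have hdet0 : ∀ x ∈ B, J 1 x = 0 := by
    intro x hx
    by_contra hne
    obtain ⟨h, hh⟩ := (LinearMap.equivOfDetNeZero
      (1 + (1:ℝ) • fderiv ℝ v x : E →L[ℝ] E).toLinearMap hne).surjective (x + v x)
    have hd : HasFDerivAt (fun x => x + v x) (1 + fderiv ℝ v x : E →L[ℝ] E) x :=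
      (hasFDerivAt_id x).add (hdiff x hx).hasFDerivAt
    have hd2 := hd.norm_sq
    have hev : (fun x => ‖x + v x‖ ^ 2) =ᶠ[nhds x] fun _ => (1:ℝ) := by
      filter_upwards [Metric.isOpen_ball.mem_nhds hx] with y hy
      rw [h1 y (by simpa using (Metric.ball_subset_closedBall hy))]; norm_num
    have hz := (hd2.congr_of_eventuallyEq hev.symm).unique (hasFDerivAt_const (1:ℝ) x)
    have hz' := DFunLike.congr_fun hz h
    have hh' : h + (fderiv ℝ v x) h = x + v x := by simpa using hh
    have hx1 := h1 x (by simpa using (Metric.ball_subset_closedBall hx))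
    have h3 : inner ℝ (x + v x) (h + (fderiv ℝ v x) h) = 0 := by
      simp only [inner_add_left, inner_add_right]
      simp at hz'
      linarith
    rw [hh', real_inner_self_eq_norm_sq, hx1] at h3
    norm_num at h3
  -- interpolation nodes
  let s : Finset ℝ := (Finset.range (Module.finrank ℝ E + 1)).image
    fun i : ℕ => ε * (i / (Module.finrank ℝ E + 1 : ℝ))
  have hcard : Module.finrank ℝ E < s.card := by
    rw [Finset.card_image_of_injective _ (fun i j hij => ?_)]
    · simp
    · have : (i : ℝ) = j := by
        have hpos : (0:ℝ) < Module.finrank ℝ E + 1 := by positivity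
        have h2 := mul_left_cancel₀ hε.ne' hij
        field_simp at h2; exact h2
      exact_mod_cast this
  have hsI : ∀ t ∈ s, t ∈ Set.Icc 0 ε := by
    intro t ht
    obtain ⟨i, hi, rfl⟩ := Finset.mem_image.1 ht
    have hi' : (i : ℝ) ≤ Module.finrank ℝ E + 1 := by exact_mod_cast (Finset.mem_range.1 hi).le
    refine ⟨by positivity, mul_le_of_le_one_right hε.le ?_⟩
    exact div_le_one_of_le₀ hi' (by positivity)
  have hJ : ∀ x, J 1 x = ∑ t ∈ s, J t x * (Lagrange.basis s id t).eval 1 := by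
    intro x
    obtain ⟨p, hp, hpe⟩ := exists_polynomial_det_one_add_smul (fderiv ℝ v x)
    simp only [J, hpe]
    exact sum_lagrange_det hcard p hp 1
  have hsum : (∑ t ∈ s, (Lagrange.basis s id t).eval (1:ℝ)) = 1 := by
    have := sum_lagrange_det hcard (1 : Polynomial ℝ) (by simp) 1
    simpa using this.symm
  have hfin : (0:ℝ) = volume.real B := by
    calc (0:ℝ) = ∫ x in B, J 1 x := by
          rw [setIntegral_congr_fun measurableSet_ball hdet0]; simp
      _ = ∫ x in B, ∑ t ∈ s, J t x * (Lagrange.basis s id t).eval 1 := by simp only [hJ]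
      _ = ∑ t ∈ s, ∫ x in B, J t x * (Lagrange.basis s id t).eval 1 :=
          integral_finsetSum _ fun t ht => (hvol t (hsI t ht)).1.mul_const _
      _ = ∑ t ∈ s, volume.real B * (Lagrange.basis s id t).eval 1 := by
          refine Finset.sum_congr rfl fun t ht => ?_
          rw [integral_mul_const, (hvol t (hsI t ht)).2]
      _ = volume.real B := by rw [← Finset.mul_sum, hsum, mul_one]
  have hpos : 0 < volume.real B :=
    ENNReal.toReal_pos (Metric.measure_ball_pos volume 0 one_pos).ne' measure_ball_lt_top.ne
  linarith

theorem exists_fixedPoint_of_norm_le {f : E → E} (hf : Continuous f) {r : ℝ} (hr : r < 1)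
    (hfr : ∀ x, ‖f x‖ ≤ r) : ∃ x, f x = x := by
  by_contra! hne
  obtain ⟨m, hm, hmf⟩ : ∃ m > 0, ∀ x ∈ Metric.closedBall (0 : E) 1, m ≤ ‖x - f x‖ := by
    obtain ⟨x₀, -, hx₀⟩ := (isCompact_closedBall (0 : E) 1).exists_isMinOn ⟨0, by simp⟩
      (f := fun x => ‖x - f x‖) (by fun_prop)
    exact ⟨_, norm_pos_iff.2 (sub_ne_zero.2 (hne x₀).symm), fun x hx => hx₀ hx⟩
  obtain ⟨g, hg, hgf, -⟩ := hf.exists_contDiff_approx 1 (ε := fun _ => min m (1 - r))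
    continuous_const (fun _ => lt_min hm (by linarith))
  have hg1 : ∀ x, ‖g x‖ < 1 := by
    intro x
    have h1 := (hgf x).trans_le (min_le_right _ _)
    rw [dist_eq_norm] at h1
    have h2 := norm_add_le (g x - f x) (f x)
    rw [sub_add_cancel] at h2
    linarith [hfr x]
  have hgx : ∀ x, x - g x ≠ 0 := by
    intro x h
    have hx : g x = x := (sub_eq_zero.1 h).symm
    have hx1 := hg1 x
    rw [hx] at hx1
    have h1 := (hgf x).trans_le (min_le_left _ _)
    rw [hx, dist_eq_norm] at h1
    linarith [hmf x (by simpa using hx1.le)]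
  let u : E → E := fun x => x - g x
  have hu : ContDiff ℝ 1 u := contDiff_id.sub (by simpa using hg)
  have ha : ∀ x, 0 < ‖u x‖ ^ 2 := fun x => by have := norm_pos_iff.2 (hgx x); positivity
  let D : E → ℝ := fun x => inner ℝ x (u x) ^ 2 + ‖u x‖ ^ 2 * (1 - ‖x‖ ^ 2)
  have hD : ContDiff ℝ 1 D :=
    ((contDiff_id.inner ℝ hu).pow 2).add ((hu.norm_sq ℝ).mul (contDiff_const.sub
      (contDiff_id.norm_sq ℝ)))
  have hinner : ∀ x : E, ‖x‖ = 1 → 0 < inner ℝ x (u x) := by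
    intro x hx
    have h1 := real_inner_le_norm x (g x)
    rw [hx, one_mul] at h1
    have h2 : inner ℝ x (u x) = 1 - inner ℝ x (g x) := by
      simp only [u]; rw [inner_sub_right, real_inner_self_eq_norm_sq, hx]; norm_num
    linarith [hg1 x]
  have hDpos : ∀ x : E, ‖x‖ ≤ 1 → 0 < D x := by
    intro x hx
    rcases hx.lt_or_eq with h | h
    · have : 0 < ‖u x‖ ^ 2 * (1 - ‖x‖ ^ 2) :=
        mul_pos (ha x) (by nlinarith [norm_nonneg x])
      simp only [D]; positivity
    · have := hinner x h
      simp only [D, h]; positivity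
  let τ : E → ℝ := fun x => (-inner ℝ x (u x) + √(D x)) / ‖u x‖ ^ 2
  refine no_smooth_retraction (v := fun x => τ x • u x) (U := {x | 0 < D x})
    (isOpen_lt continuous_const hD.continuous) (fun x hx => hDpos x (by simpa using hx)) ?_ ?_ ?_
  · refine ContDiffOn.smul ?_ hu.contDiffOn
    refine ContDiffOn.div ?_ (hu.norm_sq ℝ).contDiffOn (fun x _ => (ha x).ne')
    exact (contDiff_id.inner ℝ hu).neg.contDiffOn.add
      (hD.contDiffOn.sqrt fun x hx => (ne_of_gt hx))
  · intro x hx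
    have : τ x = 0 := by
      simp only [τ, D, hx]
      rw [show inner ℝ x (u x) ^ 2 + ‖u x‖ ^ 2 * (1 - 1 ^ 2) = inner ℝ x (u x) ^ 2 by ring,
        Real.sqrt_sq (hinner x hx).le]
      simp
    simp [this]
  · intro x hx
    have h1 : ‖u x‖ ^ 2 * τ x = -inner ℝ x (u x) + √(D x) := by
      simp only [τ]; exact mul_div_cancel₀ _ (ha x).ne'
    have h2 : √(D x) ^ 2 = D x := Real.sq_sqrt (hDpos x hx).le
    have h3 : ‖x + τ x • u x‖ ^ 2 = ‖x‖ ^ 2 + 2 * (τ x * inner ℝ x (u x)) + τ x ^ 2 * ‖u x‖ ^ 2 := by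
      rw [norm_add_sq_real, inner_smul_right, norm_smul, mul_pow, Real.norm_eq_abs, sq_abs]
    have h4 : ‖u x‖ ^ 2 * (‖x + τ x • u x‖ ^ 2 - 1) = 0 := by
      rw [h3]
      have : √(D x) = ‖u x‖ ^ 2 * τ x + inner ℝ x (u x) := by linarith
      rw [this] at h2
      simp only [D] at h2
      linear_combination h2
    have h5 : ‖x + τ x • u x‖ ^ 2 = 1 := by
      rcases mul_eq_zero.1 h4 with h | h
      · exact absurd h (ha x).ne'
      · linarith
    nlinarith [norm_nonneg (x + τ x • u x)]

theorem exists_fixedPoint_of_bounded {f : E → E} (hf : Continuous f) {R : ℝ}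
    (hfR : ∀ x, ‖f x‖ ≤ R) : ∃ x, f x = x := by
  have hR : 0 ≤ R := (norm_nonneg _).trans (hfR 0)
  have hc : 0 < (2 * R + 1)⁻¹ := by positivity
  obtain ⟨x, hx⟩ := exists_fixedPoint_of_norm_le
    (f := fun x => (2 * R + 1)⁻¹ • f ((2 * R + 1) • x)) (by fun_prop) (r := 1 / 2) (by norm_num)
    (fun x => by
      rw [norm_smul, Real.norm_of_nonneg hc.le, inv_mul_le_iff₀ (by positivity)]
      linarith [hfR ((2 * R + 1) • x)])
  refine ⟨(2 * R + 1) • x, ?_⟩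
  conv_rhs => rw [← hx]
  rw [smul_smul, mul_inv_cancel₀ (by positivity), one_smul]

end Brouwer

section Schauder

variable {E : Type*} [NormedAddCommGroup E] [NormedSpace ℝ E]

theorem exists_norm_sub_lt_of_compact_convex {S : Set E} (hS : IsCompact S) (hconv : Convex ℝ S)
    (hne : S.Nonempty) {f : E → E} (hf : ContinuousOn f S) (hfS : Set.MapsTo f S S) {ε : ℝ}
    (hε : 0 < ε) : ∃ x ∈ S, ‖f x - x‖ < ε := by
  classical
  obtain ⟨x₀, hx₀⟩ := hne
  obtain ⟨T', hT'S, hT'fin, hT'cov⟩ := hS.finite_cover_balls hε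
  lift T' to Finset E using hT'fin
  set T := T'
  let m : EuclideanSpace ℝ T → ℝ := fun t => ∑ i, max (t i) 0
  let M : EuclideanSpace ℝ T → ℝ := fun t => max (m t) 1
  let σ : EuclideanSpace ℝ T → E := fun t =>
    (M t)⁻¹ • (∑ i, max (t i) 0 • (i : E) + (M t - m t) • x₀)
  have hMpos : ∀ t, 0 < M t := fun t => lt_of_lt_of_le one_pos (le_max_right _ _)
  have hσc : Continuous σ := by
    have hm : Continuous m := by fun_prop
    have hM : Continuous M := hm.max continuous_const
    exact (hM.inv₀ fun t => (hMpos t).ne').smul (by fun_prop)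
  have hσS : ∀ t, σ t ∈ S := by
    intro t
    have := hconv.sum_mem (t := (Finset.univ : Finset (Option T)))
      (w := fun o => o.elim ((M t)⁻¹ * (M t - m t)) fun i => (M t)⁻¹ * max (t i) 0)
      (z := fun o => o.elim x₀ fun i => (i : E)) ?_ ?_ ?_
    · simpa [σ, Fintype.sum_option, Finset.smul_sum, smul_smul, add_comm] using this
    · rintro (_ | i) -
      · exact mul_nonneg (inv_nonneg.2 (hMpos t).le) (sub_nonneg.2 (le_max_left _ _))
      · exact mul_nonneg (inv_nonneg.2 (hMpos t).le) (le_max_right _ _)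
    · simp only [Fintype.sum_option, Option.elim, ← Finset.mul_sum]
      rw [← mul_add, show M t - m t + ∑ i, max (t i) 0 = M t by simp [m],
        inv_mul_cancel₀ (hMpos t).ne']
    · rintro (_ | i) -
      · exact hx₀
      · exact hT'S i.2
  let q : E → T → ℝ := fun y i => max (ε - ‖y - i‖) 0
  let Q : E → ℝ := fun y => ∑ i, q y i
  have hQ : ∀ y ∈ S, 0 < Q y := by
    intro y hy
    obtain ⟨i, hi, hyi⟩ := Set.mem_iUnion₂.1 (hT'cov hy)
    refine Finset.sum_pos' (fun j _ => le_max_right _ _) ⟨⟨i, hi⟩, Finset.mem_univ _, ?_⟩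
    exact lt_max_of_lt_left (by simpa [dist_eq_norm] using hyi)
  let F : EuclideanSpace ℝ T → EuclideanSpace ℝ T := fun t =>
    WithLp.toLp 2 fun i => (Q (f (σ t)))⁻¹ * q (f (σ t)) i
  have hFS : ∀ t, f (σ t) ∈ S := fun t => hfS (hσS t)
  have hfσ : Continuous fun t => f (σ t) := hf.comp_continuous hσc hσS
  have hFc : Continuous F := by
    refine (PiLp.continuous_toLp 2 _).comp (continuous_pi fun i => ?_)
    have hq : ∀ i, Continuous fun t => q (f (σ t)) i := fun i =>
      (continuous_const.sub (hfσ.sub continuous_const).norm).max continuous_const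
    exact ((continuous_finsetSum _ fun i _ => hq i).inv₀ fun t => (hQ _ (hFS t)).ne').mul (hq i)
  have hF0 : ∀ t i, 0 ≤ F t i := fun t i =>
    mul_nonneg (inv_nonneg.2 (hQ _ (hFS t)).le) (le_max_right _ _)
  have hF1 : ∀ t, ∑ i, F t i = 1 := fun t => by
    simp only [F, ← Finset.mul_sum]
    exact inv_mul_cancel₀ (hQ _ (hFS t)).ne'
  obtain ⟨t, ht⟩ := exists_fixedPoint_of_bounded hFc (R := 1) (fun t => by
    rw [EuclideanSpace.norm_eq]
    refine Real.sqrt_le_one.2 ?_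
    rw [← hF1 t]
    refine Finset.sum_le_sum fun i _ => ?_
    have h1 : F t i ≤ 1 := by
      rw [← hF1 t]; exact Finset.single_le_sum (fun j _ => hF0 t j) (Finset.mem_univ i)
    rw [Real.norm_of_nonneg (hF0 t i)]
    nlinarith [hF0 t i])
  have ht0 : ∀ i, 0 ≤ t i := fun i => ht ▸ hF0 t i
  have ht1 : ∑ i, t i = 1 := by
    have := hF1 t
    rwa [ht] at this
  have hm1 : m t = 1 := by simp only [m, max_eq_left (ht0 _), ht1]
  have hσt : σ t = ∑ i, t i • (i : E) := by
    simp [σ, M, hm1, max_eq_left (ht0 _)]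
  refine ⟨σ t, hσS t, ?_⟩
  have hdiff : f (σ t) - σ t = ∑ i, t i • (f (σ t) - (i : E)) := by
    simp only [smul_sub, Finset.sum_sub_distrib, ← Finset.sum_smul, ht1, one_smul, ← hσt]
  rw [hdiff]
  have hbound : ∀ i, ‖t i • (f (σ t) - (i : E))‖ ≤ t i * ε ∧
      (t i ≠ 0 → ‖t i • (f (σ t) - (i : E))‖ < t i * ε) := by
    intro i
    rw [norm_smul, Real.norm_of_nonneg (ht0 i)]
    by_cases h : t i = 0
    · simp [h]
    · have hpos : 0 < q (f (σ t)) i := by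
        refine lt_of_le_of_ne (le_max_right _ _) fun h0 => h ?_
        rw [← ht]; simp [F, ← h0]
      have : ‖f (σ t) - i‖ < ε := by
        rcases lt_max_iff.1 hpos with h' | h'
        · linarith
        · exact absurd h' (lt_irrefl _)
      have hti : 0 < t i := lt_of_le_of_ne (ht0 i) (Ne.symm h)
      exact ⟨(mul_lt_mul_of_pos_left this hti).le, fun _ => mul_lt_mul_of_pos_left this hti⟩
  calc ‖∑ i, t i • (f (σ t) - (i : E))‖ ≤ ∑ i, ‖t i • (f (σ t) - (i : E))‖ := norm_sum_le _ _
    _ < ∑ i, t i * ε := by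
        refine Finset.sum_lt_sum (fun i _ => (hbound i).1) ?_
        obtain ⟨i, -, hi⟩ : ∃ i ∈ Finset.univ, t i ≠ 0 :=
          Finset.exists_ne_zero_of_sum_ne_zero (by rw [ht1]; exact one_ne_zero)
        exact ⟨i, Finset.mem_univ _, (hbound i).2 hi⟩
    _ = ε := by rw [← Finset.sum_mul, ht1, one_mul]

/-- Schauder's fixed point theorem. -/
theorem exists_fixedPoint_of_compact_convex {S : Set E} (hS : IsCompact S) (hconv : Convex ℝ S)
    (hne : S.Nonempty) {f : E → E} (hf : ContinuousOn f S) (hfS : Set.MapsTo f S S) :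
    ∃ x ∈ S, f x = x := by
  obtain ⟨x, hx, hmin⟩ := hS.exists_isMinOn hne (f := fun x => ‖f x - x‖)
    (hf.sub continuousOn_id).norm
  refine ⟨x, hx, ?_⟩
  by_contra h
  obtain ⟨y, hy, hlt⟩ := exists_norm_sub_lt_of_compact_convex hS hconv hne hf hfS
    (norm_pos_iff.2 (sub_ne_zero.2 h))
  exact absurd (hmin hy) (not_le.2 hlt)

end Schauder

section Contour

/-- The holomorphic function whose square root extends the Whitham symbol. -/
noncomputable def tanhDiv (z : ℂ) : ℂ := Complex.sinh z / (Complex.cosh z * z)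

theorem tanhDiv_normSq_den (a b : ℝ) :
    Complex.normSq (Complex.cosh (a + b * Complex.I) * (a + b * Complex.I)) =
      (Real.sinh a ^ 2 + Real.cos b ^ 2) * (a ^ 2 + b ^ 2) := by
  rw [Complex.cosh_add, Complex.cosh_mul_I, Complex.sinh_mul_I, Complex.normSq_apply]
  simp only [← Complex.ofReal_cosh, ← Complex.ofReal_sinh, ← Complex.ofReal_cos,
    ← Complex.ofReal_sin]
  simp [-Complex.ofReal_sinh, -Complex.ofReal_cos, -Complex.ofReal_sin, -Complex.ofReal_cosh]
  linear_combination (a ^ 2 + b ^ 2) * (Real.cos b ^ 2 * Real.cosh_sq a +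
    Real.sinh a ^ 2 * Real.sin_sq_add_cos_sq b)

theorem tanhDiv_re (a b : ℝ) : (tanhDiv (a + b * Complex.I)).re =
    (a * (Real.sinh a * Real.cosh a) + b * (Real.sin b * Real.cos b)) /
      ((Real.sinh a ^ 2 + Real.cos b ^ 2) * (a ^ 2 + b ^ 2)) := by
  rw [tanhDiv, Complex.div_re, tanhDiv_normSq_den, ← add_div]
  congr 1
  rw [Complex.cosh_add, Complex.cosh_mul_I, Complex.sinh_mul_I, Complex.sinh_add,
    Complex.cosh_mul_I, Complex.sinh_mul_I]
  simp only [← Complex.ofReal_cosh, ← Complex.ofReal_sinh, ← Complex.ofReal_cos,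
    ← Complex.ofReal_sin]
  simp [-Complex.ofReal_sinh, -Complex.ofReal_cos, -Complex.ofReal_sin, -Complex.ofReal_cosh]
  linear_combination a * (Real.sinh a * Real.cosh a) * Real.sin_sq_add_cos_sq b +
    b * (Real.sin b * Real.cos b) * Real.cosh_sq a

theorem tanhDiv_im (a b : ℝ) : (tanhDiv (a + b * Complex.I)).im =
    (a * (Real.sin b * Real.cos b) - b * (Real.sinh a * Real.cosh a)) /
      ((Real.sinh a ^ 2 + Real.cos b ^ 2) * (a ^ 2 + b ^ 2)) := by
  rw [tanhDiv, Complex.div_im, tanhDiv_normSq_den, ← sub_div]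
  congr 1
  rw [Complex.cosh_add, Complex.cosh_mul_I, Complex.sinh_mul_I, Complex.sinh_add,
    Complex.cosh_mul_I, Complex.sinh_mul_I]
  simp only [← Complex.ofReal_cosh, ← Complex.ofReal_sinh, ← Complex.ofReal_cos,
    ← Complex.ofReal_sin]
  simp [-Complex.ofReal_sinh, -Complex.ofReal_cos, -Complex.ofReal_sin, -Complex.ofReal_cosh]
  linear_combination -b * (Real.sinh a * Real.cosh a) * Real.sin_sq_add_cos_sq b +
    a * (Real.sin b * Real.cos b) * Real.cosh_sq a

theorem tanhDiv_normSq (a b : ℝ) : Complex.normSq (tanhDiv (a + b * Complex.I)) =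
    (Real.sinh a ^ 2 + Real.sin b ^ 2) /
      ((Real.sinh a ^ 2 + Real.cos b ^ 2) * (a ^ 2 + b ^ 2)) := by
  rw [tanhDiv, Complex.normSq_div, tanhDiv_normSq_den]
  congr 1
  rw [Complex.sinh_add, Complex.cosh_mul_I, Complex.sinh_mul_I, Complex.normSq_apply]
  simp only [← Complex.ofReal_cosh, ← Complex.ofReal_sinh, ← Complex.ofReal_cos,
    ← Complex.ofReal_sin]
  simp [-Complex.ofReal_sinh, -Complex.ofReal_cos, -Complex.ofReal_sin, -Complex.ofReal_cosh]
  linear_combination Real.sin b ^ 2 * Real.cosh_sq a +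
    Real.sinh a ^ 2 * Real.sin_sq_add_cos_sq b

theorem tanhDiv_im_neg {a b : ℝ} (ha : 0 < a) (hb : 0 < b) :
    (tanhDiv (a + b * Complex.I)).im < 0 := by
  rw [tanhDiv_im]
  have hs : a < Real.sinh a := Real.self_lt_sinh_iff.2 ha
  refine div_neg_of_neg_of_pos ?_ (by positivity)
  have h1 : Real.sin b * Real.cos b < b := by
    have := Real.sin_lt (x := 2 * b) (by linarith)
    rw [Real.sin_two_mul] at this; linarith
  have h2 := Real.one_le_cosh a
  have h3 : a * (Real.sin b * Real.cos b) < a * b := mul_lt_mul_of_pos_left h1 ha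
  have h4 : a ≤ Real.sinh a * Real.cosh a := by nlinarith
  nlinarith

theorem tanhDiv_ofReal (a : ℝ) : tanhDiv a = (Real.tanh a / a : ℝ) := by
  rw [tanhDiv, Real.tanh_eq_sinh_div_cosh]; push_cast; rw [div_div]

theorem tanhDiv_mem_slitPlane {a b : ℝ} (ha : 0 < a) (hb : 0 ≤ b) :
    tanhDiv (a + b * Complex.I) ∈ Complex.slitPlane := by
  rcases hb.eq_or_lt with rfl | hb
  · left
    rw [tanhDiv_re]
    have hs := Real.sinh_pos_iff.2 ha
    have := Real.cosh_pos a
    simp only [Real.sin_zero, zero_mul, mul_zero, add_zero]; positivity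
  · exact Or.inr (tanhDiv_im_neg ha hb).ne

/-- The holomorphic extension of the Whitham symbol. -/
noncomputable def symbolCx (z : ℂ) : ℂ := tanhDiv z ^ (2⁻¹ : ℂ)

theorem norm_symbolCx_sq (z : ℂ) : ‖symbolCx z‖ ^ 2 = ‖tanhDiv z‖ := by
  rw [← norm_pow, symbolCx, Complex.cpow_ofNat_inv_pow]

theorem norm_symbolCx_pow_four (a b : ℝ) : ‖symbolCx (a + b * Complex.I)‖ ^ 4 =
    (Real.sinh a ^ 2 + Real.sin b ^ 2) /
      ((Real.sinh a ^ 2 + Real.cos b ^ 2) * (a ^ 2 + b ^ 2)) := by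
  rw [← tanhDiv_normSq, Complex.normSq_eq_norm_sq, ← norm_symbolCx_sq]; ring

theorem symbolCx_ofReal {a : ℝ} (ha : 0 < a) : symbolCx a = (whithamSymbol a : ℂ) := by
  have h : 0 ≤ Real.tanh a / a := by
    rw [Real.tanh_eq_sinh_div_cosh]
    have hs := Real.sinh_pos_iff.2 ha
    have := Real.cosh_pos a
    positivity
  rw [symbolCx, tanhDiv_ofReal, whithamSymbol, if_neg ha.ne', Real.sqrt_eq_rpow,
    Complex.ofReal_cpow h]
  norm_num

theorem differentiableAt_symbolCx {a b : ℝ} (ha : 0 < a) (hb : 0 ≤ b) :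
    DifferentiableAt ℂ symbolCx (a + b * Complex.I) := by
  have hden : Complex.cosh (a + b * Complex.I) * (a + b * Complex.I) ≠ 0 := by
    rw [← Complex.normSq_pos, tanhDiv_normSq_den]
    have hs := Real.sinh_pos_iff.2 ha
    positivity
  have h1 : DifferentiableAt ℂ tanhDiv (a + b * Complex.I) :=
    (Complex.differentiable_sinh _).div
      ((Complex.differentiable_cosh _).mul differentiableAt_id) hden
  exact h1.cpow (differentiableAt_const _) (tanhDiv_mem_slitPlane ha hb)

/-- The integrand on vertical lines, up to the exponential decay. -/
noncomputable def vertDensity (x a b : ℝ) : ℝ :=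
  -(symbolCx (a + b * Complex.I) * Complex.exp (a * x * Complex.I)).im

theorem norm_symbolCx_le_one (a : ℝ) {n : ℕ} (hn : 1 ≤ n) :
    ‖symbolCx (a + (n * π : ℝ) * Complex.I)‖ ≤ 1 := by
  rw [← pow_le_one_iff_of_nonneg (norm_nonneg _) (by norm_num : 4 ≠ 0), norm_symbolCx_pow_four]
  have h1 : Real.sin (n * π) = 0 := Real.sin_nat_mul_pi n
  have h2 : Real.cos (n * π) ^ 2 = 1 := by
    have := Real.sin_sq_add_cos_sq (n * π); rw [h1] at this; linarith
  have h3 : (1:ℝ) ≤ n * π := by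
    have : (1:ℝ) ≤ n := by exact_mod_cast hn
    nlinarith [Real.pi_gt_three]
  rw [h1, h2]
  refine div_le_one_of_le₀ ?_ (by positivity)
  have : 1 ≤ a ^ 2 + (n * π) ^ 2 := by nlinarith [sq_nonneg a]
  nlinarith [sq_nonneg (Real.sinh a)]

theorem norm_symbolCx_le {a b : ℝ} (ha : 1 ≤ a) :
    ‖symbolCx (a + b * Complex.I)‖ ≤ 2 / √a := by
  have ha0 : 0 < a := by linarith
  rw [← pow_le_pow_iff_left₀ (norm_nonneg _) (by positivity) (by norm_num : 4 ≠ 0),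
    norm_symbolCx_pow_four, div_pow, show √a ^ 4 = a ^ 2 by
      rw [show √a ^ 4 = (√a ^ 2) ^ 2 by ring, Real.sq_sqrt ha0.le]]
  have hs : 1 ≤ Real.sinh a := ha.trans (Real.self_le_sinh_iff.2 ha0.le)
  have hs2 : 1 ≤ Real.sinh a ^ 2 := one_le_pow₀ hs
  rw [div_le_div_iff₀ (by positivity) (by positivity)]
  have h1 := Real.sin_sq_le_one b
  calc (Real.sinh a ^ 2 + Real.sin b ^ 2) * a ^ 2 ≤ (2 * Real.sinh a ^ 2) * a ^ 2 := by
        gcongr; linarith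
    _ ≤ 2 ^ 4 * ((Real.sinh a ^ 2 + Real.cos b ^ 2) * (a ^ 2 + b ^ 2)) := by
        nlinarith [mul_nonneg (sq_nonneg (Real.sinh a)) (sq_nonneg b),
          mul_nonneg (sq_nonneg (Real.cos b)) (sq_nonneg b),
          mul_nonneg (sq_nonneg (Real.cos b)) (sq_nonneg a),
          mul_nonneg (sq_nonneg (Real.sinh a)) (sq_nonneg a)]

theorem contour_estimate {x ε R : ℝ} (hx : 0 < x) (hε : 0 < ε) (hεR : ε ≤ R) (hR : 1 ≤ R)
    {n : ℕ} (hn : 1 ≤ n) :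
    |(∫ ξ in ε..R, whithamSymbol ξ * Real.cos (x * ξ)) -
      ∫ η in (0:ℝ)..(n * π : ℝ), Real.exp (-(x * η)) * vertDensity x ε η| ≤
      R * Real.exp (-(x * (n * π))) + 2 / √R / x := by
  set T : ℝ := n * π with hT
  have hT0 : 0 ≤ T := by positivity
  let f : ℂ → ℂ := fun z => symbolCx z * Complex.exp (x * z * Complex.I)
  have hfd : ∀ a b : ℝ, 0 < a → 0 ≤ b → DifferentiableAt ℂ f (a + b * Complex.I) := by
    intro a b ha hb
    exact (differentiableAt_symbolCx ha hb).mul (by fun_prop)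
  have hnorm : ∀ a b : ℝ, ‖f (a + b * Complex.I)‖ =
      ‖symbolCx (a + b * Complex.I)‖ * Real.exp (-(x * b)) := by
    intro a b
    simp only [f]
    rw [norm_mul, Complex.norm_exp]
    congr 2
    simp
  have hrect := Complex.integral_boundary_rect_eq_zero_of_differentiableOn f
    (ε + (0:ℝ) * Complex.I) (R + T * Complex.I) (by
      intro z hz
      obtain ⟨h1, h2⟩ := hz
      simp [Set.uIcc_of_le hεR, Set.uIcc_of_le hT0] at h1 h2
      have := (hfd z.re z.im (hε.trans_le h1.1) h2.1)
      rw [Complex.re_add_im] at this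
      exact this.differentiableWithinAt)
  simp only [Complex.add_re, Complex.add_im, Complex.ofReal_re, Complex.ofReal_im, Complex.mul_re,
    Complex.mul_im, Complex.I_re, Complex.I_im, mul_zero, mul_one, sub_zero, add_zero,
    zero_add] at hrect
  have htop : ‖∫ ξ in ε..R, f (ξ + T * Complex.I)‖ ≤ R * Real.exp (-(x * T)) := by
    have := intervalIntegral.norm_integral_le_of_norm_le_const (a := ε) (b := R)
      (f := fun ξ : ℝ => f (ξ + T * Complex.I)) (C := Real.exp (-(x * T))) (fun ξ _ => by
        rw [hnorm]
        exact mul_le_of_le_one_left (Real.exp_nonneg _) (norm_symbolCx_le_one ξ hn))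
    refine this.trans ?_
    rw [abs_of_nonneg (by linarith), mul_comm]
    gcongr; linarith
  have hright : ‖∫ η in (0:ℝ)..T, f (R + η * Complex.I)‖ ≤ 2 / √R / x := by
    have h1 : ‖∫ η in (0:ℝ)..T, f (R + η * Complex.I)‖ ≤
        ∫ η in (0:ℝ)..T, 2 / √R * Real.exp (-(x * η)) :=
      intervalIntegral.norm_integral_le_of_norm_le hT0 (Eventually.of_forall fun η _ => by
        rw [hnorm]; gcongr; exact norm_symbolCx_le hR)
        (Continuous.intervalIntegrable (by fun_prop) _ _)
    refine h1.trans ?_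
    rw [intervalIntegral.integral_const_mul]
    have h2 : ∫ η in (0:ℝ)..T, Real.exp (-(x * η)) = (1 - Real.exp (-(x * T))) / x := by
      have := intervalIntegral.integral_eq_sub_of_hasDerivAt (a := 0) (b := T)
        (f := fun η => -1 / x * Real.exp (-(x * η))) (f' := fun η => Real.exp (-(x * η)))
        (fun η _ => by
          have := ((hasDerivAt_id' η).const_mul x).fun_neg.exp.const_mul (-1 / x)
          exact this.congr_deriv (by field_simp)) (Continuous.intervalIntegrable (by fun_prop) _ _)
      rw [this]; simp; ring
    rw [h2, ← mul_div_assoc]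
    have : 2 / √R * (1 - Real.exp (-(x * T))) ≤ 2 / √R :=
      mul_le_of_le_one_right (by positivity) (by linarith [Real.exp_nonneg (-(x * T))])
    gcongr
  have hbot : (∫ ξ in ε..R, f (ξ + (0:ℝ) * Complex.I)).re =
      ∫ ξ in ε..R, whithamSymbol ξ * Real.cos (x * ξ) := by
    have hint : IntervalIntegrable (fun ξ : ℝ => f (ξ + (0:ℝ) * Complex.I)) volume ε R := by
      refine ContinuousOn.intervalIntegrable fun ξ hξ => ?_
      rw [Set.uIcc_of_le hεR] at hξ
      refine (ContinuousAt.comp (g := f)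
        (f := fun ξ : ℝ => (ξ : ℂ) + (0:ℝ) * Complex.I) (x := ξ) (hfd ξ 0 (hε.trans_le hξ.1) le_rfl).continuousAt
        (by fun_prop)).continuousWithinAt
    rw [← Complex.reCLM_apply, ← ContinuousLinearMap.intervalIntegral_comp_comm _ hint]
    refine intervalIntegral.integral_congr fun ξ hξ => ?_
    rw [Set.uIcc_of_le hεR] at hξ
    simp only [f, Complex.reCLM_apply, Complex.ofReal_zero, zero_mul, add_zero]
    rw [symbolCx_ofReal (hε.trans_le hξ.1), Complex.re_ofReal_mul, Complex.exp_re]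
    simp
  have hleft : (Complex.I • ∫ η in (0:ℝ)..T, f (ε + η * Complex.I)).re =
      ∫ η in (0:ℝ)..T, Real.exp (-(x * η)) * vertDensity x ε η := by
    have hint : IntervalIntegrable (fun η : ℝ => f (ε + η * Complex.I)) volume 0 T := by
      refine ContinuousOn.intervalIntegrable fun η hη => ?_
      rw [Set.uIcc_of_le hT0] at hη
      refine (ContinuousAt.comp (g := f)
        (f := fun η : ℝ => (ε : ℂ) + η * Complex.I) (x := η) (hfd ε η hε hη.1).continuousAt
        (by fun_prop)).continuousWithinAt
    rw [smul_eq_mul, Complex.I_mul_re, ← Complex.imCLM_apply,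
      ← ContinuousLinearMap.intervalIntegral_comp_comm _ hint, ← intervalIntegral.integral_neg]
    refine intervalIntegral.integral_congr fun η _ => ?_
    simp only [f, Complex.imCLM_apply, vertDensity]
    have : Complex.exp (x * (ε + η * Complex.I) * Complex.I) =
        (Real.exp (-(x * η)) : ℂ) * Complex.exp (ε * x * Complex.I) := by
      rw [Complex.ofReal_exp, ← Complex.exp_add]
      congr 1
      push_cast
      linear_combination (x * η : ℂ) * Complex.I_sq
    rw [this, mul_left_comm, Complex.im_ofReal_mul]
    ring
  have hre := congrArg Complex.re hrect
  rw [Complex.sub_re, Complex.add_re, Complex.sub_re, hbot, hleft] at hre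
  have e1 := (Complex.abs_re_le_norm _).trans htop
  have e2 : |(Complex.I • ∫ η in (0:ℝ)..T, f (R + η * Complex.I)).re| ≤ 2 / √R / x :=
    (Complex.abs_re_le_norm _).trans (by rw [norm_smul, Complex.norm_I, one_mul]; exact hright)
  rw [abs_le] at e1 e2 ⊢
  rw [Complex.zero_re] at hre
  constructor <;> linarith [e1.1, e1.2, e2.1, e2.2]

end Contour

section KernelLaplace

/-- The (unnormalised) density of the Laplace representation of the Whitham kernel. -/
noncomputable def branchJump (η : ℝ) : ℝ := √(max 0 (-(Real.tan η / η)))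

theorem measurable_branchJump : Measurable branchJump := by
  unfold branchJump
  have : Measurable Real.tan := by
    rw [show Real.tan = fun x => Real.sin x / Real.cos x from funext Real.tan_eq_sin_div_cos]
    exact Real.measurable_sin.div Real.measurable_cos
  fun_prop

theorem branchJump_nonneg (η : ℝ) : 0 ≤ branchJump η := Real.sqrt_nonneg _

theorem branchJump_eq_zero {η : ℝ} (h0 : 0 < η) (h1 : η < π / 2) : branchJump η = 0 := by
  have := Real.tan_pos_of_pos_of_lt_pi_div_two h0 h1
  have h2 : 0 < Real.tan η / η := div_pos this h0
  rw [branchJump, max_eq_left (by linarith), Real.sqrt_zero]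

theorem tendsto_vertDensity (x : ℝ) {η : ℝ} (hη : 0 < η) (hc : Real.cos η ≠ 0) :
    Tendsto (fun ε => vertDensity x ε η) (nhdsWithin 0 (Set.Ioi 0)) (nhds (branchJump η)) := by
  let w : ℝ → ℂ := fun ε => tanhDiv (ε + η * Complex.I)
  have hw : ContinuousAt w 0 := by
    have hden : Complex.cosh ((0:ℝ) + η * Complex.I) * ((0:ℝ) + η * Complex.I) ≠ 0 := by
      rw [← Complex.normSq_pos, tanhDiv_normSq_den]
      have : 0 < Real.cos η ^ 2 := by positivity
      positivity
    refine ContinuousAt.div (by fun_prop) (by fun_prop) hden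
  have hre : (w 0).re = Real.tan η / η := by
    simp only [w]
    rw [tanhDiv_re, Real.tan_eq_sin_div_cos]
    simp
    field_simp
  have him : (w 0).im = 0 := by simp only [w]; rw [tanhDiv_im]; simp
  have hnorm : ‖w 0‖ = |Real.tan η / η| := by
    rw [← Complex.re_add_im (w 0), him, hre, Complex.ofReal_zero,
      zero_mul, add_zero, Complex.norm_real, Real.norm_eq_abs]
  have hval : branchJump η = √((‖w 0‖ - (w 0).re) / 2) * Real.cos (0 * x) -
      √((‖w 0‖ + (w 0).re) / 2) * Real.sin (0 * x) := by
    rw [hnorm, hre]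
    simp only [zero_mul, Real.cos_zero, Real.sin_zero, mul_one, mul_zero, sub_zero, branchJump]
    congr 1
    rcases le_total 0 (Real.tan η / η) with h | h
    · rw [abs_of_nonneg h, max_eq_left (by linarith)]; ring
    · rw [abs_of_nonpos h, max_eq_right (by linarith)]; ring
  rw [hval]
  have hcont : ContinuousAt (fun ε => √((‖w ε‖ - (w ε).re) / 2) * Real.cos (ε * x) -
      √((‖w ε‖ + (w ε).re) / 2) * Real.sin (ε * x)) 0 := by
    have h1 : ContinuousAt (fun ε => (w ε).re) 0 := Complex.continuous_re.continuousAt.comp hw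
    have h2 : ContinuousAt (fun ε => ‖w ε‖) 0 := hw.norm
    have h3 := (((h2.sub h1).div_const 2).sqrt).mul
      (show ContinuousAt (fun ε => Real.cos (ε * x)) 0 by fun_prop)
    have h4 := (((h2.add h1).div_const 2).sqrt).mul
      (show ContinuousAt (fun ε => Real.sin (ε * x)) 0 by fun_prop)
    exact h3.sub h4
  refine (hcont.tendsto.mono_left nhdsWithin_le_nhds).congr' ?_
  filter_upwards [self_mem_nhdsWithin] with ε hε
  have hexp : Complex.exp (ε * x * Complex.I) = Real.cos (ε * x) + Real.sin (ε * x) * Complex.I := by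
    rw [← Complex.ofReal_mul, Complex.exp_mul_I, Complex.ofReal_cos, Complex.ofReal_sin]
  rw [vertDensity, hexp, symbolCx, Complex.mul_im, Complex.cpow_inv_two_re,
    Complex.cpow_inv_two_im_eq_neg_sqrt (tanhDiv_im_neg hε hη)]
  simp [w, -Complex.ofReal_cos, -Complex.ofReal_sin]
  ring

theorem abs_vertDensity_le (x a b : ℝ) :
    |vertDensity x a b| ≤ ‖symbolCx (a + b * Complex.I)‖ := by
  rw [vertDensity, abs_neg]
  refine (Complex.abs_im_le_norm _).trans ?_
  rw [norm_mul, ← Complex.ofReal_mul, Complex.norm_exp_ofReal_mul_I, mul_one]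

theorem rpow_neg_half_pow_four {t : ℝ} (ht : 0 ≤ t) : (t ^ (-1/2 : ℝ)) ^ 4 = (t ^ 2)⁻¹ := by
  rw [← Real.rpow_natCast, ← Real.rpow_mul ht, ← Real.rpow_natCast, ← Real.rpow_neg ht]
  norm_num

theorem norm_symbolCx_le_vertical {a b : ℝ} (ha : 0 < a) (ha1 : a ≤ 1 / 2) (hb : 0 < b)
    (hc : Real.cos b ≠ 0) :
    ‖symbolCx (a + b * Complex.I)‖ ≤ 2 * (b ^ (-1/2 : ℝ) + |Real.cos b| ^ (-1/2 : ℝ)) := by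
  have hsh : Real.sinh a ^ 2 ≤ 1 := by
    have h1 : Real.sinh a ≤ 1 := by
      have h2 : Real.sinh a ≤ Real.sinh (1/2) := Real.sinh_le_sinh.2 ha1
      have h3 : Real.sinh (1/2) ≤ 1 := by
        rw [Real.sinh_eq]
        have h4 : Real.exp (1/2) ≤ 2 := by
          have h5 : Real.exp (1/2) ^ 2 = Real.exp 1 := by rw [← Real.exp_nat_mul]; norm_num
          nlinarith [Real.exp_one_lt_three, Real.exp_pos (1/2)]
        have := Real.exp_pos (-(1/2)); linarith
      linarith
    have h0 : 0 ≤ Real.sinh a := (Real.sinh_pos_iff.2 ha).le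
    nlinarith
  have hc2 : 0 < Real.cos b ^ 2 := by positivity
  have hbp : 0 ≤ b ^ (-1/2 : ℝ) := by positivity
  have hcp : 0 ≤ |Real.cos b| ^ (-1/2 : ℝ) := by positivity
  have hbd : ‖symbolCx (a + b * Complex.I)‖ ^ 4 ≤ 2 / (Real.cos b ^ 2 * b ^ 2) := by
    rw [norm_symbolCx_pow_four]
    have := Real.sin_sq_le_one b
    gcongr ?_ / (?_ * ?_)
    · linarith
    · nlinarith [sq_nonneg (Real.sinh a)]
    · nlinarith [sq_nonneg a]
  rw [← pow_le_pow_iff_left₀ (norm_nonneg _) (by positivity) (by norm_num : 4 ≠ 0)]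
  refine hbd.trans ?_
  rcases le_total b 1 with h | h
  · have hcos : 1 / 2 ≤ Real.cos b := by
      have := Real.one_sub_sq_div_two_le_cos (x := b); nlinarith
    calc 2 / (Real.cos b ^ 2 * b ^ 2) ≤ 2 / ((1 / 2) ^ 2 * b ^ 2) := by gcongr
      _ ≤ (2 * b ^ (-1/2 : ℝ)) ^ 4 := by
        rw [mul_pow, rpow_neg_half_pow_four hb.le]
        have : 0 < b ^ 2 := by positivity
        field_simp; norm_num
      _ ≤ _ := by gcongr; linarith
  · calc 2 / (Real.cos b ^ 2 * b ^ 2) ≤ 2 / (Real.cos b ^ 2 * 1) := by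
          gcongr; nlinarith
      _ ≤ (2 * |Real.cos b| ^ (-1/2 : ℝ)) ^ 4 := by
        rw [mul_pow, rpow_neg_half_pow_four (abs_nonneg _), sq_abs, mul_one, div_eq_mul_inv]
        have := inv_pos.2 hc2
        linarith
      _ ≤ _ := by gcongr; linarith

theorem intervalIntegrable_abs_rpow_neg_half (a b : ℝ) :
    IntervalIntegrable (fun x : ℝ => |x| ^ (-1/2 : ℝ)) volume a b := by
  refine intervalIntegrable_of_even (by simp) (fun x hx => ?_)
  refine (intervalIntegral.intervalIntegrable_rpow' (r := -1/2) (by norm_num)).congr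
    (fun t ht => ?_)
  rw [Set.uIoc_of_le hx.le] at ht
  simp only [abs_of_pos ht.1]

theorem intervalIntegrable_abs_cos_rpow (a b : ℝ) :
    IntervalIntegrable (fun x : ℝ => |Real.cos x| ^ (-1/2 : ℝ)) volume a b := by
  have hsin : IntervalIntegrable (fun x : ℝ => |Real.sin x| ^ (-1/2 : ℝ)) volume
      (a + π / 2) (b + π / 2) := by
    refine Function.Periodic.intervalIntegrable (T := π) (t := -(π / 2)) (fun x => by simp)
      Real.pi_ne_zero ?_ _ _
    rw [show -(π / 2) + π = π / 2 by ring]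
    refine (((intervalIntegrable_abs_rpow_neg_half (-(π / 2)) (π / 2)).const_mul
      ((2 / π) ^ (-1/2 : ℝ)))).mono_fun
      (Measurable.pow_const (by fun_prop) _).aestronglyMeasurable ?_
    rw [Set.uIoc_of_le (by linarith [Real.pi_pos])]
    refine (ae_restrict_iff' measurableSet_Ioc).2 ?_
    filter_upwards [(Set.countable_singleton (0:ℝ)).ae_notMem volume] with x hx0 hx
    have hx0' : 0 < |x| := abs_pos.2 (by simpa using hx0)
    have h1 := Real.mul_abs_le_abs_sin (x := x) (abs_le.2 ⟨hx.1.le, hx.2⟩)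
    rw [Real.norm_of_nonneg (by positivity), Real.norm_of_nonneg (by positivity),
      ← Real.mul_rpow (by positivity) (by positivity)]
    exact Real.rpow_le_rpow_of_nonpos (by positivity) h1 (by norm_num)
  have := hsin.comp_add_right (π / 2)
  simpa [Real.sin_add_pi_div_two] using this

theorem measurable_whithamSymbol : Measurable whithamSymbol := by
  have : Measurable Real.tanh := by
    rw [show Real.tanh = fun x => Real.sinh x / Real.cosh x from
      funext Real.tanh_eq_sinh_div_cosh]
    exact (Real.measurable_sinh).div Real.measurable_cosh
  exact Measurable.ite (measurableSet_singleton 0) measurable_const (by fun_prop)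

theorem whithamSymbol_nonneg (ξ : ℝ) : 0 ≤ whithamSymbol ξ := by
  unfold whithamSymbol; split_ifs <;> positivity

theorem tanh_le_self {ξ : ℝ} (hξ : 0 ≤ ξ) : Real.tanh ξ ≤ ξ := by
  rw [Real.tanh_eq_sinh_div_cosh, div_le_iff₀ (Real.cosh_pos _)]
  have hd : ∀ t : ℝ, HasDerivAt (fun t => t * Real.cosh t - Real.sinh t) (t * Real.sinh t) t := by
    intro t
    refine (((hasDerivAt_id' t).mul (Real.hasDerivAt_cosh t)).sub
      (Real.hasDerivAt_sinh t)).congr_deriv (by ring)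
  have hmono : MonotoneOn (fun t => t * Real.cosh t - Real.sinh t) (Set.Ici 0) := by
    refine monotoneOn_of_deriv_nonneg (convex_Ici 0)
      (fun t _ => (hd t).continuousAt.continuousWithinAt)
      (fun t _ => (hd t).differentiableAt.differentiableWithinAt) fun t ht => ?_
    rw [(hd t).deriv]
    have ht' : 0 ≤ t := by simpa using (interior_subset ht)
    exact mul_nonneg ht' (Real.sinh_nonneg_iff.2 ht')
  have := hmono (Set.mem_Ici.2 le_rfl) (Set.mem_Ici.2 hξ) hξ
  simp at this; linarith

theorem whithamSymbol_le_one (ξ : ℝ) : whithamSymbol ξ ≤ 1 := by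
  unfold whithamSymbol
  split_ifs with h
  · exact le_rfl
  · rw [Real.sqrt_le_one]
    rcases lt_or_gt_of_ne h with h | h
    · rw [← neg_div_neg_eq, ← Real.tanh_neg]
      exact div_le_one_of_le₀ (tanh_le_self (by linarith)) (by linarith)
    · exact div_le_one_of_le₀ (tanh_le_self h.le) h.le

theorem intervalIntegrable_symbol_mul_cos (x a b : ℝ) :
    IntervalIntegrable (fun ξ => whithamSymbol ξ * Real.cos (x * ξ)) volume a b := by
  refine (intervalIntegrable_const (c := (1:ℝ))).mono_fun
    (measurable_whithamSymbol.mul (by fun_prop)).aestronglyMeasurable ?_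
  refine Eventually.of_forall fun ξ => ?_
  beta_reduce
  rw [norm_mul, norm_one, Real.norm_of_nonneg (whithamSymbol_nonneg ξ)]
  exact mul_le_one₀ (whithamSymbol_le_one ξ) (norm_nonneg _) (Real.abs_cos_le_one _)

theorem ae_cos_ne_zero : ∀ᵐ η : ℝ, Real.cos η ≠ 0 := by
  have : (Set.range fun k : ℤ => (2 * (k:ℝ) + 1) * π / 2).Countable := Set.countable_range _
  filter_upwards [this.ae_notMem volume] with η hη h0
  obtain ⟨k, hk⟩ := Real.cos_eq_zero_iff.1 h0
  exact hη ⟨k, hk.symm⟩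

theorem truncated_kernel_estimate {x R : ℝ} (hx : 0 < x) (hR : 1 ≤ R) {n : ℕ} (hn : 1 ≤ n) :
    |(∫ ξ in (0:ℝ)..R, whithamSymbol ξ * Real.cos (x * ξ)) -
      ∫ η in (0:ℝ)..(n * π : ℝ), Real.exp (-(x * η)) * branchJump η| ≤
      R * Real.exp (-(x * (n * π))) + 2 / √R / x := by
  have hT : (0:ℝ) ≤ n * π := by positivity
  have h1 : Tendsto (fun ε => ∫ ξ in ε..R, whithamSymbol ξ * Real.cos (x * ξ))
      (nhdsWithin 0 (Set.Ioi 0))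
      (nhds (∫ ξ in (0:ℝ)..R, whithamSymbol ξ * Real.cos (x * ξ))) := by
    have hc : Continuous fun ε => ∫ ξ in R..ε, whithamSymbol ξ * Real.cos (x * ξ) :=
      intervalIntegral.continuous_primitive (intervalIntegrable_symbol_mul_cos x) R
    have := (hc.fun_neg.tendsto 0).mono_left (nhdsWithin_le_nhds (s := Set.Ioi 0))
    simpa only [← intervalIntegral.integral_symm] using this
  have h2 : Tendsto (fun ε => ∫ η in (0:ℝ)..(n * π : ℝ), Real.exp (-(x * η)) * vertDensity x ε η)
      (nhdsWithin 0 (Set.Ioi 0))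
      (nhds (∫ η in (0:ℝ)..(n * π : ℝ), Real.exp (-(x * η)) * branchJump η)) := by
    refine intervalIntegral.tendsto_integral_filter_of_dominated_convergence
      (fun η => 2 * (η ^ (-1/2 : ℝ) + |Real.cos η| ^ (-1/2 : ℝ))) ?_ ?_ ?_ ?_
    · refine Eventually.of_forall fun ε => Measurable.aestronglyMeasurable ?_
      have : Measurable fun η : ℝ => symbolCx (ε + η * Complex.I) := by
        unfold symbolCx tanhDiv
        have hs := Complex.continuous_sinh.measurable
        have hch := Complex.continuous_cosh.measurable
        fun_prop
      unfold vertDensity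
      have h3 := Complex.measurable_im.comp (this.mul_const (Complex.exp (ε * x * Complex.I)))
      exact (by fun_prop : Measurable fun η : ℝ => Real.exp (-(x * η))).mul h3.neg
    · have hev : ∀ᶠ ε : ℝ in nhdsWithin 0 (Set.Ioi 0), ε ≤ 1 / 2 :=
        nhdsWithin_le_nhds (eventually_le_nhds (by norm_num))
      filter_upwards [self_mem_nhdsWithin, hev] with ε hε hε1
      filter_upwards [ae_cos_ne_zero] with η hc hη
      rw [Set.uIoc_of_le hT] at hη
      rw [norm_mul, Real.norm_of_nonneg (Real.exp_nonneg _)]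
      refine (mul_le_of_le_one_left (norm_nonneg _) ?_).trans ((abs_vertDensity_le _ _ _).trans
        (norm_symbolCx_le_vertical hε hε1 hη.1 hc))
      rw [Real.exp_le_one_iff]
      have := mul_pos hx hη.1; linarith
    · exact ((intervalIntegral.intervalIntegrable_rpow' (by norm_num)).add
        (intervalIntegrable_abs_cos_rpow _ _)).const_mul 2
    · filter_upwards [ae_cos_ne_zero] with η hc hη
      rw [Set.uIoc_of_le hT] at hη
      exact (tendsto_vertDensity x hη.1 hc).const_mul _
  refine le_of_tendsto (h1.sub h2).abs ?_
  have hev : ∀ᶠ ε : ℝ in nhdsWithin 0 (Set.Ioi 0), ε ≤ R :=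
    nhdsWithin_le_nhds (eventually_le_nhds (by linarith))
  filter_upwards [self_mem_nhdsWithin, hev] with ε hε hεR
  exact contour_estimate hx hε hεR hR hn

end KernelLaplace

section KernelMeasure

theorem branchJump_le {η : ℝ} (hη : 0 < η) (hc : Real.cos η ≠ 0) :
    branchJump η ≤ 2 * (η ^ (-1/2 : ℝ) + |Real.cos η| ^ (-1/2 : ℝ)) := by
  refine le_of_tendsto (tendsto_vertDensity 0 hη hc) ?_
  have hev : ∀ᶠ ε : ℝ in nhdsWithin 0 (Set.Ioi 0), ε ≤ 1 / 2 :=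
    nhdsWithin_le_nhds (eventually_le_nhds (by norm_num))
  filter_upwards [self_mem_nhdsWithin, hev] with ε hε hε1
  exact (le_abs_self _).trans ((abs_vertDensity_le _ _ _).trans
    (norm_symbolCx_le_vertical hε hε1 hη hc))

theorem intervalIntegrable_exp_mul_branchJump {x T : ℝ} (hx : 0 < x) (hT : 0 ≤ T) :
    IntervalIntegrable (fun η => Real.exp (-(x * η)) * branchJump η) volume 0 T := by
  have hm : Measurable fun η => Real.exp (-(x * η)) * branchJump η :=
    (by fun_prop : Measurable fun η : ℝ => Real.exp (-(x * η))).mul measurable_branchJump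
  refine (((intervalIntegral.intervalIntegrable_rpow' (r := -1/2) (by norm_num)).add
        (intervalIntegrable_abs_cos_rpow 0 T)).const_mul 2).mono_fun hm.aestronglyMeasurable ?_
  rw [Set.uIoc_of_le hT]
  refine (ae_restrict_iff' measurableSet_Ioc).2 ?_
  filter_upwards [ae_cos_ne_zero] with η hc hη
  rw [norm_mul, Real.norm_of_nonneg (Real.exp_nonneg _), Real.norm_of_nonneg (branchJump_nonneg _)]
  refine (mul_le_of_le_one_left (branchJump_nonneg _) ?_).trans ((branchJump_le hη.1 hc).trans
    (Real.le_norm_self _))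
  rw [Real.exp_le_one_iff]
  have := mul_pos hx hη.1; linarith

theorem abs_integral_symbol_mul_cos_le (x : ℝ) {R : ℝ} (hR : 0 ≤ R) :
    |∫ ξ in (0:ℝ)..R, whithamSymbol ξ * Real.cos (x * ξ)| ≤ R := by
  have := intervalIntegral.norm_integral_le_of_norm_le_const (a := 0) (b := R) (C := 1)
    (f := fun ξ => whithamSymbol ξ * Real.cos (x * ξ)) fun ξ _ => by
      rw [norm_mul, Real.norm_of_nonneg (whithamSymbol_nonneg ξ)]
      exact mul_le_one₀ (whithamSymbol_le_one ξ) (norm_nonneg _) (Real.abs_cos_le_one _)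
  rwa [one_mul, sub_zero, abs_of_nonneg hR] at this

theorem tendsto_natCast_mul_pi : Tendsto (fun n : ℕ => (n * π : ℝ)) atTop atTop :=
  tendsto_natCast_atTop_atTop.atTop_mul_const Real.pi_pos

theorem integrableOn_exp_mul_branchJump {x : ℝ} (hx : 0 < x) :
    IntegrableOn (fun η => Real.exp (-(x * η)) * branchJump η) (Set.Ioi 0) := by
  refine integrableOn_Ioi_of_intervalIntegral_norm_bounded (l := atTop)
    (b := fun n : ℕ => (n * π : ℝ)) (2 + 2 / x) 0 (fun n => ?_) tendsto_natCast_mul_pi ?_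
  · exact (intervalIntegrable_iff_integrableOn_Ioc_of_le (by positivity)).1
      (intervalIntegrable_exp_mul_branchJump hx (by positivity))
  · filter_upwards [eventually_ge_atTop 1] with n hn
    have h1 := truncated_kernel_estimate hx le_rfl hn
    have h2 := abs_integral_symbol_mul_cos_le x (zero_le_one' ℝ)
    have h3 : Real.exp (-(x * (n * π))) ≤ 1 := by
      rw [Real.exp_le_one_iff]; have : 0 ≤ x * (n * π) := by positivity
      linarith
    have h4 : ∀ η, ‖Real.exp (-(x * η)) * branchJump η‖ = Real.exp (-(x * η)) * branchJump η :=
      fun η => Real.norm_of_nonneg (mul_nonneg (Real.exp_nonneg _) (branchJump_nonneg _))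
    simp_rw [h4]
    rw [Real.sqrt_one, div_one] at h1
    have h5 := (abs_le.1 h1).1
    have h6 := (abs_le.1 h2).2
    linarith

/-- The measure representing the Whitham kernel as a Laplace transform. -/
noncomputable def whithamMeasure : Measure ℝ :=
  (volume.restrict (Set.Ioi 0)).withDensity fun η => ENNReal.ofReal (branchJump η / π)

instance : SFinite whithamMeasure := by unfold whithamMeasure; infer_instance

theorem integral_whithamMeasure (g : ℝ → ℝ) :
    ∫ η, g η ∂whithamMeasure = (1 / π) * ∫ η in Set.Ioi 0, g η * branchJump η := by
  rw [whithamMeasure, integral_withDensity_eq_integral_toReal_smul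
    (measurable_branchJump.div_const _).ennreal_ofReal (by simp), ← integral_const_mul]
  congr 1; ext η
  rw [ENNReal.toReal_ofReal (div_nonneg (branchJump_nonneg _) Real.pi_pos.le), smul_eq_mul]
  ring

theorem integrable_whithamMeasure_iff {g : ℝ → ℝ} :
    Integrable g whithamMeasure ↔ IntegrableOn (fun η => g η * branchJump η) (Set.Ioi 0) := by
  rw [whithamMeasure, integrable_withDensity_iff_integrable_smul'
    (measurable_branchJump.div_const _).ennreal_ofReal (by simp), IntegrableOn,
    ← integrable_const_mul_iff (c := π) (by simp [Real.pi_ne_zero])]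
  refine integrable_congr (Eventually.of_forall fun η => ?_)
  beta_reduce
  rw [ENNReal.toReal_ofReal (div_nonneg (branchJump_nonneg _) Real.pi_pos.le), smul_eq_mul]
  have := Real.pi_ne_zero
  field_simp

theorem ae_whithamMeasure : ∀ᵐ η ∂whithamMeasure, π / 2 ≤ η := by
  rw [whithamMeasure, ae_withDensity_iff (measurable_branchJump.div_const _).ennreal_ofReal]
  refine (ae_restrict_iff' measurableSet_Ioi).2 (Eventually.of_forall fun η hη hne => ?_)
  by_contra! h
  exact hne (by rw [branchJump_eq_zero hη h]; simp)

theorem ae_whithamMeasure_pos : ∀ᵐ η ∂whithamMeasure, 0 < η := by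
  filter_upwards [ae_whithamMeasure] with η h
  linarith [Real.pi_pos]

theorem integrable_exp_whithamMeasure {x : ℝ} (hx : 0 < x) :
    Integrable (fun η => Real.exp (-(η * x))) whithamMeasure := by
  rw [integrable_whithamMeasure_iff]
  simpa only [mul_comm x] using integrableOn_exp_mul_branchJump hx

theorem abs_integral_symbol_sub_le {x R : ℝ} (hx : 0 < x) (hR : 1 ≤ R) :
    |(1 / π) * (∫ ξ in (0:ℝ)..R, whithamSymbol ξ * Real.cos (x * ξ)) -
      ∫ η, Real.exp (-(η * x)) ∂whithamMeasure| ≤ 2 / √R / x := by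
  rw [integral_whithamMeasure, ← mul_sub, abs_mul, abs_of_pos (by positivity)]
  have h1 : (1 / π) ≤ 1 := by
    rw [div_le_one Real.pi_pos]; linarith [Real.pi_gt_three]
  refine (mul_le_of_le_one_left (abs_nonneg _) h1).trans ?_
  have ht := intervalIntegral_tendsto_integral_Ioi 0 (integrableOn_exp_mul_branchJump hx)
    tendsto_natCast_mul_pi
  have hexp : Tendsto (fun n : ℕ => R * Real.exp (-(x * (n * π))) + 2 / √R / x) atTop
      (nhds (2 / √R / x)) := by
    have h2 := Real.tendsto_exp_neg_atTop_nhds_zero.comp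
      (tendsto_natCast_mul_pi.const_mul_atTop hx)
    simpa using (h2.const_mul R).add_const (2 / √R / x)
  simp only [mul_comm x] at ht ⊢
  refine le_of_tendsto_of_tendsto (ht.const_sub _).abs hexp ?_
  filter_upwards [eventually_ge_atTop 1] with n hn
  simpa only [mul_comm x] using truncated_kernel_estimate hx hR hn

theorem tendsto_integral_symbol_mul_cos {x : ℝ} (hx : x ≠ 0) :
    Tendsto (fun R : ℝ => (1 / π) * ∫ ξ in (0:ℝ)..R, whithamSymbol ξ * Real.cos (x * ξ)) atTop
      (nhds (∫ η, Real.exp (-(η * |x|)) ∂whithamMeasure)) := by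
  have hx' : 0 < |x| := abs_pos.2 hx
  rw [tendsto_iff_dist_tendsto_zero]
  have h0 : Tendsto (fun R : ℝ => 2 / √R / |x|) atTop (nhds 0) := by
    simpa using (Real.tendsto_sqrt_atTop.const_div_atTop (2:ℝ)).div_const |x|
  refine squeeze_zero' (Eventually.of_forall fun _ => dist_nonneg) ?_ h0
  filter_upwards [eventually_ge_atTop 1] with R hR
  have := abs_integral_symbol_sub_le hx' hR
  rw [Real.dist_eq]
  convert this using 6 with ξ
  rcases abs_choice x with h | h <;> rw [h]
  simp

theorem whithamKernel_eq {x : ℝ} (hx : x ≠ 0) :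
    whithamKernel x = ∫ η, Real.exp (-(η * |x|)) ∂whithamMeasure := by
  rw [whithamKernel, if_neg hx]
  exact (tendsto_integral_symbol_mul_cos hx).limUnder_eq

theorem whithamKernel_neg (x : ℝ) : whithamKernel (-x) = whithamKernel x := by
  rcases eq_or_ne x 0 with rfl | h
  · simp
  · rw [whithamKernel_eq h, whithamKernel_eq (neg_ne_zero.2 h), abs_neg]

theorem whithamKernel_abs (x : ℝ) : whithamKernel |x| = whithamKernel x := by
  rcases abs_choice x with h | h <;> rw [h]
  exact whithamKernel_neg x

theorem whithamKernel_nonneg (x : ℝ) : 0 ≤ whithamKernel x := by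
  rcases eq_or_ne x 0 with rfl | h
  · simp [whithamKernel]
  · rw [whithamKernel_eq h]; exact integral_nonneg fun _ => (Real.exp_nonneg _)

theorem whithamSymbol_le_rpow {ξ : ℝ} (hξ : 0 < ξ) : whithamSymbol ξ ≤ ξ ^ (-1/2 : ℝ) := by
  rw [whithamSymbol, if_neg hξ.ne', show (-1/2 : ℝ) = -(1/2) by norm_num, Real.rpow_neg hξ.le,
    ← Real.sqrt_eq_rpow, ← Real.sqrt_inv]
  refine Real.sqrt_le_sqrt ?_
  rw [div_eq_mul_inv]
  exact mul_le_of_le_one_left (inv_nonneg.2 hξ.le) (Real.tanh_lt_one ξ).le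

theorem abs_integral_symbol_mul_cos_le_sqrt (x : ℝ) {R : ℝ} (hR : 0 ≤ R) :
    |∫ ξ in (0:ℝ)..R, whithamSymbol ξ * Real.cos (x * ξ)| ≤ 2 * √R := by
  have h : ∫ ξ in (0:ℝ)..R, ξ ^ (-1/2 : ℝ) = 2 * √R := by
    rw [integral_rpow (by norm_num), Real.sqrt_eq_rpow]; norm_num; ring
  rw [← h, ← Real.norm_eq_abs]
  refine intervalIntegral.norm_integral_le_of_norm_le hR (Eventually.of_forall fun ξ hξ => ?_)
    (intervalIntegral.intervalIntegrable_rpow' (by norm_num))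
  rw [norm_mul, Real.norm_of_nonneg (whithamSymbol_nonneg ξ)]
  exact (mul_le_of_le_one_right (whithamSymbol_nonneg _) (Real.abs_cos_le_one _)).trans
    (whithamSymbol_le_rpow hξ.1)

theorem whithamKernel_le_exp {x : ℝ} (hx : 1 ≤ x) :
    whithamKernel x ≤ whithamKernel 1 * Real.exp (-(x - 1)) := by
  have hx0 : 0 < x := by linarith
  rw [whithamKernel_eq hx0.ne', whithamKernel_eq one_ne_zero, abs_of_pos hx0, abs_one,
    ← integral_mul_const]
  refine integral_mono_ae (integrable_exp_whithamMeasure hx0)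
    ((integrable_exp_whithamMeasure one_pos).mul_const _) ?_
  filter_upwards [ae_whithamMeasure] with η hη
  rw [← Real.exp_add]
  have := Real.pi_gt_three
  exact Real.exp_le_exp.2 (by nlinarith)

theorem whithamKernel_le_inv_sqrt {x : ℝ} (hx : 0 < x) : whithamKernel x ≤ 4 / √x := by
  have small : ∀ y : ℝ, 0 < y → y ≤ 1 → whithamKernel y ≤ 4 / √y := by
    intro y hy hy1
    have h1 := abs_integral_symbol_sub_le hy ((one_le_inv₀ hy).2 hy1)
    have h2 := abs_integral_symbol_mul_cos_le_sqrt y (inv_nonneg.2 hy.le)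
    have h3 : (1 / π) ≤ 1 := by
      rw [div_le_one Real.pi_pos]; linarith [Real.pi_gt_three]
    rw [whithamKernel_eq hy.ne', abs_of_pos hy]
    have h4 : (1 / π) * (∫ ξ in (0:ℝ)..y⁻¹, whithamSymbol ξ * Real.cos (y * ξ)) ≤ 2 * √y⁻¹ := by
      refine (le_abs_self _).trans ?_
      rw [abs_mul, abs_of_pos (by positivity)]
      exact (mul_le_of_le_one_left (abs_nonneg _) h3).trans h2
    have h5 : 2 / √y⁻¹ / y = 2 / √y := by
      rw [Real.sqrt_inv, div_inv_eq_mul, div_eq_div_iff hy.ne' (by positivity), mul_assoc,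
        Real.mul_self_sqrt hy.le]
    have h6 : 2 * √y⁻¹ = 2 / √y := by rw [Real.sqrt_inv]; rfl
    rw [h5] at h1; rw [h6] at h4
    have := (abs_le.1 h1).1
    have h7 : 4 / √y = 2 / √y + 2 / √y := by ring
    linarith
  rcases le_total x 1 with h | h
  · exact small x hx h
  · have h1 := small 1 one_pos le_rfl
    rw [Real.sqrt_one, div_one] at h1
    have hs : 0 < √x := Real.sqrt_pos.2 hx
    refine (whithamKernel_le_exp h).trans ?_
    rw [le_div_iff₀ hs, mul_assoc]
    have h3 : √x ≤ Real.exp (x - 1) := by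
      have h4 := Real.add_one_le_exp (x - 1)
      have h5 : √x ≤ x := by rw [Real.sqrt_le_left (by linarith)]; nlinarith
      linarith
    have h6 : Real.exp (-(x - 1)) * √x ≤ 1 := by
      rw [Real.exp_neg, inv_mul_le_iff₀ (Real.exp_pos _), mul_one]; exact h3
    exact (mul_le_mul h1 h6 (by positivity) (by norm_num)).trans (by norm_num)

theorem abs_truncated_kernel_le {x R : ℝ} (hx : x ≠ 0) (hR : 1 ≤ R) :
    |(1 / π) * ∫ ξ in (0:ℝ)..R, whithamSymbol ξ * Real.cos (x * ξ)| ≤ 6 / √|x| := by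
  have key : ∀ y : ℝ, 0 < y →
      |(1 / π) * ∫ ξ in (0:ℝ)..R, whithamSymbol ξ * Real.cos (y * ξ)| ≤ 6 / √y := by
    intro y hy
    have hs : 0 < √y := Real.sqrt_pos.2 hy
    have hRs : 0 < √R := Real.sqrt_pos.2 (by linarith)
    rcases le_total 1 (y * R) with h | h
    · have h1 := abs_integral_symbol_sub_le hy hR
      have h2 := whithamKernel_le_inv_sqrt hy
      have h3 := whithamKernel_nonneg y
      rw [whithamKernel_eq hy.ne', abs_of_pos hy] at h2 h3
      have h4 : 2 / √R / y ≤ 2 / √y := by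
        rw [div_div]
        refine div_le_div_of_nonneg_left (by norm_num) hs ?_
        have h5 : 1 ≤ √y * √R := by rw [← Real.sqrt_mul hy.le]; exact Real.one_le_sqrt.2 h
        nlinarith [Real.mul_self_sqrt hy.le]
      have h7 : 6 / √y = 4 / √y + 2 / √y := by ring
      rw [h7]
      rw [abs_le] at h1 ⊢
      constructor <;> linarith [div_pos (four_pos (α := ℝ)) hs]
    · have h2 := abs_integral_symbol_mul_cos_le_sqrt y (by linarith : 0 ≤ R)
      have h3 : (1 / π) ≤ 1 := by
        rw [div_le_one Real.pi_pos]; linarith [Real.pi_gt_three]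
      rw [abs_mul, abs_of_pos (by positivity)]
      refine (mul_le_of_le_one_left (abs_nonneg _) h3).trans (h2.trans ?_)
      rw [le_div_iff₀ hs]
      have h5 : √y * √R ≤ 1 := by rw [← Real.sqrt_mul hy.le]; exact Real.sqrt_le_one.2 h
      nlinarith
  have := key |x| (abs_pos.2 hx)
  convert this using 5 with ξ
  rcases abs_choice x with h | h <;> rw [h]
  simp

end KernelMeasure

section KernelMass

theorem integrable_comp_abs {f : ℝ → ℝ} (hf : IntegrableOn f (Set.Ioi 0)) :
    Integrable fun x => f |x| := by
  have h1 : IntegrableOn (fun x => f |x|) (Set.Ioi 0) :=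
    hf.congr_fun (fun x hx => by simp only [abs_of_pos (Set.mem_Ioi.1 hx)]) measurableSet_Ioi
  have h2 : IntegrableOn (fun x ↦ f |x|) (Set.Iic 0) := by
    rw [← Measure.map_neg_eq_self (volume : Measure ℝ)]
    let m : MeasurableEmbedding fun x : ℝ => -x := (Homeomorph.neg ℝ).measurableEmbedding
    rw [m.integrableOn_map_iff]
    simp_rw [Function.comp_def, abs_neg, Set.neg_preimage, Set.neg_Iic, neg_zero]
    exact Iff.mpr integrableOn_Ici_iff_integrableOn_Ioi h1
  rw [← integrableOn_univ, ← Set.Iic_union_Ioi (a := (0:ℝ))]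
  exact h2.union h1

theorem integrable_exp_neg_mul_abs {η : ℝ} (hη : 0 < η) :
    Integrable fun y : ℝ => Real.exp (-(η * |y|)) := by
  refine integrable_comp_abs (f := fun y => Real.exp (-(η * y))) ?_
  simpa only [neg_mul] using integrableOn_exp_mul_Ioi (neg_lt_zero.2 hη) 0

theorem integral_exp_neg_mul_abs_mul_cos {η : ℝ} (hη : 0 < η) (ξ : ℝ) :
    ∫ y : ℝ, Real.exp (-(η * |y|)) * Real.cos (ξ * y) = 2 * (η / (η ^ 2 + ξ ^ 2)) := by
  have h1 := integral_comp_abs (f := fun y => Real.exp (-(η * y)) * Real.cos (ξ * y))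
  have h2 : ∀ y : ℝ, Real.cos (ξ * |y|) = Real.cos (ξ * y) := fun y => by
    rcases abs_choice y with h | h <;> rw [h]
    rw [mul_neg, Real.cos_neg]
  simp only [h2] at h1
  rw [h1]
  congr 1
  have ha : (-(η:ℂ) + ξ * Complex.I).re < 0 := by simpa using hη
  have h3 := integral_exp_mul_complex_Ioi ha 0
  have hint := integrableOn_exp_mul_complex_Ioi ha 0
  have h4 := congrArg Complex.re h3
  rw [← RCLike.re_to_complex, ← integral_re hint] at h4
  convert h4 using 1
  · refine setIntegral_congr_fun measurableSet_Ioi fun y _ => ?_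
    simp only [RCLike.re_to_complex]
    rw [Complex.exp_re]
    simp
  · have hd : η ^ 2 + ξ ^ 2 ≠ 0 := by positivity
    simp only [Complex.ofReal_zero, mul_zero, Complex.exp_zero,
      Complex.div_re, Complex.normSq_apply]
    simp
    field_simp

theorem integral_exp_neg_mul_abs {η : ℝ} (hη : 0 < η) :
    ∫ y : ℝ, Real.exp (-(η * |y|)) = 2 / η := by
  have := integral_exp_neg_mul_abs_mul_cos hη 0
  simp only [zero_mul, Real.cos_zero, mul_one] at this
  rw [this]; field_simp; ring

theorem whithamKernel_le {x : ℝ} (hx : 0 < x) :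
    whithamKernel x ≤ 12 * (x ^ (-1/2 : ℝ) * Real.exp (-(x / 2))) := by
  have hs : 0 < √x := Real.sqrt_pos.2 hx
  have hr : x ^ (-1/2 : ℝ) = 1 / √x := by
    rw [show (-1/2 : ℝ) = -(1/2) by norm_num, Real.rpow_neg hx.le, ← Real.sqrt_eq_rpow, one_div]
  rw [hr]
  have he := Real.exp_pos (-(x / 2))
  rcases le_total x 1 with h | h
  · refine (whithamKernel_le_inv_sqrt hx).trans ?_
    have h1 := Real.add_one_le_exp (-(x / 2))
    rw [div_le_iff₀ hs]
    have : 12 * (1 / √x * Real.exp (-(x / 2))) * √x = 12 * Real.exp (-(x / 2)) := by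
      field_simp
    rw [this]; linarith
  · refine (whithamKernel_le_exp h).trans ?_
    have h1 := whithamKernel_le_inv_sqrt one_pos
    rw [Real.sqrt_one, div_one] at h1
    have h2 : Real.exp (-(x - 1)) = Real.exp 1 * Real.exp (-(x/2)) * Real.exp (-(x/2)) := by
      rw [← Real.exp_add, ← Real.exp_add]; congr 1; ring
    have h3 : √x * Real.exp (-(x/2)) ≤ 1 := by
      have h4 := Real.add_one_le_exp (x / 2)
      have h5 : √x ≤ x / 2 + 1 := by nlinarith [Real.mul_self_sqrt hx.le, sq_nonneg (√x - 1)]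
      rw [Real.exp_neg, mul_inv_le_iff₀ (Real.exp_pos _)]; linarith
    have h6 : Real.exp (-(x/2)) ≤ 1 / √x := by rw [le_div_iff₀ hs]; linarith
    have h7 := whithamKernel_nonneg 1
    have h8 := Real.exp_one_lt_three
    rw [h2]
    calc whithamKernel 1 * (Real.exp 1 * Real.exp (-(x/2)) * Real.exp (-(x/2)))
        ≤ 4 * (3 * (1 / √x) * Real.exp (-(x/2))) := by gcongr
      _ = _ := by ring

theorem integrableOn_rpow_mul_exp_half {s : ℝ} (hs : -1 < s) {ε : ℝ} (hε : 0 < ε) :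
    IntegrableOn (fun x : ℝ => x ^ s * Real.exp (-(ε * x))) (Set.Ioi 0) := by
  simpa only [Real.rpow_one, neg_mul] using
    integrableOn_rpow_mul_exp_neg_mul_rpow hs one_pos hε

theorem measurable_whithamKernel : Measurable whithamKernel := by
  have h : StronglyMeasurable fun x : ℝ => ∫ η, Real.exp (-(η * |x|)) ∂whithamMeasure := by
    refine StronglyMeasurable.integral_prod_right (f := fun x η => Real.exp (-(η * |x|))) ?_
    exact Continuous.stronglyMeasurable (by fun_prop)
  have h2 : whithamKernel = fun x => if x = 0 then 0 else
      ∫ η, Real.exp (-(η * |x|)) ∂whithamMeasure := by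
    ext x
    split_ifs with hx
    · rw [hx, whithamKernel, if_pos rfl]
    · exact whithamKernel_eq hx
  rw [h2]
  exact Measurable.ite (measurableSet_singleton 0) measurable_const h.measurable

theorem integrable_rpow_mul_whithamKernel {s : ℝ} (hs : -1/2 < s) :
    Integrable fun x => |x| ^ s * whithamKernel x := by
  have h : IntegrableOn (fun x => x ^ s * whithamKernel x) (Set.Ioi 0) := by
    refine ((integrableOn_rpow_mul_exp_half (s := s - 1/2) (by linarith)
      (one_half_pos (α := ℝ))).const_mul 12).mono'
      ((Measurable.pow_const measurable_id _).mul measurable_whithamKernel).aestronglyMeasurable ?_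
    refine (ae_restrict_iff' measurableSet_Ioi).2 (Eventually.of_forall fun x hx => ?_)
    have hx' : 0 < x := hx
    rw [Real.norm_of_nonneg (mul_nonneg (by positivity) (whithamKernel_nonneg x))]
    calc x ^ s * whithamKernel x ≤ x ^ s * (12 * (x ^ (-1/2 : ℝ) * Real.exp (-(x / 2)))) := by
          gcongr; exact whithamKernel_le hx'
      _ = 12 * ((x ^ s * x ^ (-1/2 : ℝ)) * Real.exp (-(x / 2))) := by ring
      _ = _ := by rw [← Real.rpow_add hx']; ring_nf
  simpa only [whithamKernel_abs] using integrable_comp_abs h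

theorem integrable_whithamKernel : Integrable whithamKernel := by
  simpa using integrable_rpow_mul_whithamKernel (s := 0) (by norm_num)

theorem integral_truncated_kernel_mul_exp {ε R : ℝ} (hε : 0 < ε) (hR : 0 ≤ R) :
    ∫ x : ℝ, ((1 / π) * ∫ ξ in (0:ℝ)..R, whithamSymbol ξ * Real.cos (x * ξ)) *
      Real.exp (-(ε * |x|)) =
    (2 / π) * ∫ ξ in (0:ℝ)..R, whithamSymbol ξ * (ε / (ε ^ 2 + ξ ^ 2)) := by
  simp only [intervalIntegral.integral_of_le hR]
  have hswap : ∫ x : ℝ, ∫ ξ in Set.Ioc 0 R,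
      Real.exp (-(ε * |x|)) * (whithamSymbol ξ * Real.cos (x * ξ)) =
      ∫ ξ in Set.Ioc 0 R, ∫ x : ℝ,
        Real.exp (-(ε * |x|)) * (whithamSymbol ξ * Real.cos (x * ξ)) := by
    refine integral_integral_swap ?_
    have hg : Integrable (fun z : ℝ × ℝ => Real.exp (-(ε * |z.1|)) * (1:ℝ))
        (volume.prod (volume.restrict (Set.Ioc 0 R))) :=
      (integrable_exp_neg_mul_abs hε).mul_prod (integrable_const 1)
    refine hg.mono' ?_ (Eventually.of_forall fun z => ?_)
    · have := measurable_whithamSymbol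
      refine Measurable.aestronglyMeasurable ?_
      unfold Function.uncurry
      fun_prop
    · simp only [Function.uncurry]
      rw [norm_mul, Real.norm_of_nonneg (Real.exp_nonneg _), norm_mul,
        Real.norm_of_nonneg (whithamSymbol_nonneg _)]
      gcongr
      exact mul_le_one₀ (whithamSymbol_le_one _) (norm_nonneg _) (Real.abs_cos_le_one _)
  have h1 : ∀ x : ℝ, ((1 / π) * ∫ ξ in Set.Ioc 0 R, whithamSymbol ξ * Real.cos (x * ξ)) *
      Real.exp (-(ε * |x|)) = (1 / π) * ∫ ξ in Set.Ioc 0 R,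
      Real.exp (-(ε * |x|)) * (whithamSymbol ξ * Real.cos (x * ξ)) := fun x => by
    rw [integral_const_mul]; ring
  simp_rw [h1]
  rw [integral_const_mul, hswap]
  have h2 : ∀ ξ : ℝ, ∫ x : ℝ, Real.exp (-(ε * |x|)) * (whithamSymbol ξ * Real.cos (x * ξ)) =
      2 * (whithamSymbol ξ * (ε / (ε ^ 2 + ξ ^ 2))) := fun ξ => by
    have h3 := integral_exp_neg_mul_abs_mul_cos hε ξ
    have h4 : ∀ x, Real.exp (-(ε * |x|)) * (whithamSymbol ξ * Real.cos (x * ξ)) =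
      whithamSymbol ξ * (Real.exp (-(ε * |x|)) * Real.cos (ξ * x)) := fun x => by
        rw [mul_comm x]; ring
    simp_rw [h4]
    rw [integral_const_mul, h3]; ring
  simp_rw [h2]
  rw [integral_const_mul]; ring

theorem integrable_inv_sqrt_mul_exp {ε : ℝ} (hε : 0 < ε) :
    Integrable fun x : ℝ => 6 / √|x| * Real.exp (-(ε * |x|)) := by
  have := (integrableOn_rpow_mul_exp_half (s := -1/2) (by norm_num) hε).const_mul 6
  refine (integrable_comp_abs this).congr (Eventually.of_forall fun x => ?_)
  beta_reduce
  rw [show (-1/2 : ℝ) = -(1/2) by norm_num, Real.rpow_neg (abs_nonneg x), ← Real.sqrt_eq_rpow]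
  ring

theorem integrableOn_symbol_mul_lorentz {ε : ℝ} (hε : 0 < ε) :
    Integrable (fun ξ : ℝ => whithamSymbol ξ * (ε / (ε ^ 2 + ξ ^ 2))) := by
  have h : Integrable fun ξ : ℝ => ε⁻¹ * (1 + (ξ * ε⁻¹) ^ 2)⁻¹ :=
    ((integrable_inv_one_add_sq.comp_mul_right' (inv_ne_zero hε.ne'))).const_mul _
  have hm := measurable_whithamSymbol
  refine h.mono' (by fun_prop) (Eventually.of_forall fun ξ => ?_)
  rw [norm_mul, Real.norm_of_nonneg (whithamSymbol_nonneg ξ), Real.norm_of_nonneg (by positivity)]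
  refine (mul_le_of_le_one_left (by positivity) (whithamSymbol_le_one ξ)).trans (le_of_eq ?_)
  have : ε ^ 2 + ξ ^ 2 ≠ 0 := by positivity
  field_simp

theorem integral_kernel_mul_exp {ε : ℝ} (hε : 0 < ε) :
    ∫ x : ℝ, whithamKernel x * Real.exp (-(ε * |x|)) =
    (2 / π) * ∫ t in Set.Ioi (0:ℝ), whithamSymbol (ε * t) * (1 + t ^ 2)⁻¹ := by
  have hl : Tendsto (fun R : ℝ => ∫ x : ℝ,
      ((1 / π) * ∫ ξ in (0:ℝ)..R, whithamSymbol ξ * Real.cos (x * ξ)) * Real.exp (-(ε * |x|)))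
      atTop (nhds (∫ x : ℝ, whithamKernel x * Real.exp (-(ε * |x|)))) := by
    refine tendsto_integral_filter_of_dominated_convergence _ ?_ ?_
      (integrable_inv_sqrt_mul_exp hε) ?_
    · refine (eventually_ge_atTop 0).mono fun R hR => ?_
      have hsm : StronglyMeasurable fun x : ℝ => ∫ ξ in (0:ℝ)..R,
          whithamSymbol ξ * Real.cos (x * ξ) := by
        simp only [intervalIntegral.integral_of_le hR]
        refine StronglyMeasurable.integral_prod_right
          (f := fun x ξ => whithamSymbol ξ * Real.cos (x * ξ)) ?_
        have := measurable_whithamSymbol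
        refine Measurable.stronglyMeasurable ?_
        unfold Function.uncurry
        fun_prop
      exact ((hsm.const_mul (1/π)).mul
        (Continuous.stronglyMeasurable (by fun_prop))).aestronglyMeasurable
    · refine (eventually_ge_atTop 1).mono fun R hR => ?_
      filter_upwards [(Set.countable_singleton (0:ℝ)).ae_notMem volume] with x hx
      rw [norm_mul, Real.norm_of_nonneg (Real.exp_nonneg _)]
      gcongr
      exact abs_truncated_kernel_le (by simpa using hx) hR
    · filter_upwards [(Set.countable_singleton (0:ℝ)).ae_notMem volume] with x hx
      have hx' : x ≠ 0 := by simpa using hx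
      have := tendsto_integral_symbol_mul_cos hx'
      rw [← whithamKernel_eq hx'] at this
      exact this.mul_const _
  have hr := (intervalIntegral_tendsto_integral_Ioi 0
    (integrableOn_symbol_mul_lorentz hε).integrableOn tendsto_id).const_mul (2 / π)
  have hl' := hl.congr' ((eventually_ge_atTop (0:ℝ)).mono fun R hR =>
    integral_truncated_kernel_mul_exp hε hR)
  have h1 := tendsto_nhds_unique hl' hr
  have h2 := integral_comp_mul_left_Ioi'
    (fun ξ : ℝ => whithamSymbol ξ * (ε / (ε ^ 2 + ξ ^ 2))) 0 hε
  rw [mul_zero, smul_eq_mul, ← integral_const_mul] at h2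
  rw [h1, ← h2]
  congr 1
  refine setIntegral_congr_fun measurableSet_Ioi fun t _ => ?_
  have : 1 + t ^ 2 ≠ 0 := by positivity
  rw [show ε ^ 2 + (ε * t) ^ 2 = ε ^ 2 * (1 + t ^ 2) by ring]
  field_simp

theorem tendsto_whithamSymbol_zero : Tendsto whithamSymbol (nhds 0) (nhds 1) := by
  have hlow : ∀ ξ, (Real.cosh ξ)⁻¹ ≤ whithamSymbol ξ := by
    intro ξ
    have hc1 := Real.one_le_cosh ξ
    unfold whithamSymbol
    split_ifs with h
    · exact inv_le_one_of_one_le₀ hc1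
    · refine Real.le_sqrt_of_sq_le ?_
      have h1 : (Real.cosh ξ)⁻¹ ≤ Real.tanh ξ / ξ := by
        rw [Real.tanh_eq_sinh_div_cosh, div_div, inv_eq_one_div, mul_comm, ← div_div]
        gcongr
        rcases lt_or_gt_of_ne h with h | h
        · rw [le_div_iff_of_neg h, one_mul]; exact Real.sinh_le_self_iff.2 h.le
        · rw [le_div_iff₀ h, one_mul]; exact Real.self_le_sinh_iff.2 h.le
      refine le_trans ?_ h1
      have h2 : (Real.cosh ξ)⁻¹ ≤ 1 := inv_le_one_of_one_le₀ hc1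
      have h3 : 0 ≤ (Real.cosh ξ)⁻¹ := by positivity
      nlinarith
  have hc : Tendsto (fun ξ => (Real.cosh ξ)⁻¹) (nhds 0) (nhds 1) := by
    have : ContinuousAt (fun ξ => (Real.cosh ξ)⁻¹) 0 :=
      Real.continuous_cosh.continuousAt.inv₀ (Real.cosh_pos 0).ne'
    simpa [ContinuousAt] using this
  exact tendsto_of_tendsto_of_tendsto_of_le_of_le hc tendsto_const_nhds hlow whithamSymbol_le_one

theorem integral_whithamKernel : ∫ x, whithamKernel x = 1 := by
  have hz : Tendsto (fun n : ℕ => 1 / ((n:ℝ) + 1)) atTop (nhds 0) :=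
    tendsto_one_div_add_atTop_nhds_zero_nat
  have hl : Tendsto (fun n : ℕ => ∫ x : ℝ,
      whithamKernel x * Real.exp (-(1 / ((n:ℝ) + 1) * |x|))) atTop
      (nhds (∫ x : ℝ, whithamKernel x)) := by
    refine tendsto_integral_of_dominated_convergence whithamKernel (fun n => ?_)
      integrable_whithamKernel (fun n => Eventually.of_forall fun x => ?_)
      (Eventually.of_forall fun x => ?_)
    · exact (measurable_whithamKernel.mul (by fun_prop)).aestronglyMeasurable
    · rw [norm_mul, Real.norm_of_nonneg (whithamKernel_nonneg x),
        Real.norm_of_nonneg (Real.exp_nonneg _)]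
      refine mul_le_of_le_one_right (whithamKernel_nonneg x) ?_
      rw [Real.exp_le_one_iff]
      have : 0 ≤ 1 / ((n:ℝ) + 1) * |x| := by positivity
      linarith
    · have h1 : Tendsto (fun n : ℕ => Real.exp (-(1 / ((n:ℝ) + 1) * |x|))) atTop
          (nhds (Real.exp (-(0 * |x|)))) := (Real.continuous_exp.tendsto _).comp
          ((hz.mul_const _).neg)
      simpa using h1.const_mul (whithamKernel x)
  have hr : Tendsto (fun n : ℕ => (2 / π) * ∫ t in Set.Ioi (0:ℝ),
      whithamSymbol (1 / ((n:ℝ) + 1) * t) * (1 + t ^ 2)⁻¹) atTop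
      (nhds ((2 / π) * ∫ t in Set.Ioi (0:ℝ), 1 * (1 + t ^ 2)⁻¹)) := by
    refine Tendsto.const_mul _ ?_
    refine tendsto_integral_of_dominated_convergence (fun t : ℝ => (1 + t ^ 2)⁻¹) (fun n => ?_)
      integrable_inv_one_add_sq.integrableOn (fun n => Eventually.of_forall fun t => ?_)
      (Eventually.of_forall fun t => ?_)
    · have := measurable_whithamSymbol
      exact Measurable.aestronglyMeasurable (by fun_prop)
    · rw [norm_mul, Real.norm_of_nonneg (whithamSymbol_nonneg _),
        Real.norm_of_nonneg (by positivity)]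
      exact mul_le_of_le_one_left (by positivity) (whithamSymbol_le_one _)
    · refine Tendsto.mul_const _ ?_
      have := hz.mul_const t
      rw [zero_mul] at this
      exact tendsto_whithamSymbol_zero.comp this
  have h := tendsto_nhds_unique (hl.congr fun n => integral_kernel_mul_exp (by positivity)) hr
  rw [h]
  simp only [one_mul]
  rw [integral_Ioi_inv_one_add_sq, Real.arctan_zero, sub_zero]
  have := Real.pi_ne_zero
  field_simp

end KernelMass

section KernelFubini

theorem ae_ne_zero : ∀ᵐ x : ℝ, x ≠ 0 := by
  filter_upwards [(Set.countable_singleton (0:ℝ)).ae_notMem volume] with x hx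
  simpa using hx

theorem integrable_exp_mul_prod {g : ℝ → ℝ} (hg : Measurable g)
    (hK : Integrable fun y => whithamKernel y * g y) :
    Integrable (fun z : ℝ × ℝ => Real.exp (-(z.2 * |z.1|)) * g z.1)
      (volume.prod whithamMeasure) := by
  have hm : Measurable fun z : ℝ × ℝ => Real.exp (-(z.2 * |z.1|)) * g z.1 := by fun_prop
  rw [integrable_prod_iff hm.aestronglyMeasurable]
  constructor
  · filter_upwards [ae_ne_zero] with y hy
    exact (integrable_exp_whithamMeasure (abs_pos.2 hy)).mul_const _
  · refine hK.norm.congr ?_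
    filter_upwards [ae_ne_zero] with y hy
    simp only [norm_mul, Real.norm_of_nonneg (Real.exp_nonneg _),
      Real.norm_of_nonneg (whithamKernel_nonneg y)]
    rw [integral_mul_const, whithamKernel_eq hy]

theorem integral_whithamKernel_mul {g : ℝ → ℝ} (hg : Measurable g)
    (hK : Integrable fun y => whithamKernel y * g y) :
    ∫ y, whithamKernel y * g y =
      ∫ η, (∫ y, Real.exp (-(η * |y|)) * g y) ∂whithamMeasure := by
  rw [← integral_integral_swap (f := fun y η => Real.exp (-(η * |y|)) * g y)
    (integrable_exp_mul_prod hg hK)]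
  refine integral_congr_ae ?_
  filter_upwards [ae_ne_zero] with y hy
  rw [integral_mul_const, whithamKernel_eq hy]

theorem integrable_whithamKernel_mul {g : ℝ → ℝ} (hg : Measurable g) {M : ℝ}
    (hM : ∀ x, |g x| ≤ M) : Integrable fun y => whithamKernel y * g y :=
  integrable_whithamKernel.mul_bdd (c := M) hg.aestronglyMeasurable (Eventually.of_forall hM)

theorem integrable_integral_exp_mul {g : ℝ → ℝ} (hg : Measurable g)
    (hK : Integrable fun y => whithamKernel y * g y) :
    Integrable (fun η => ∫ y, Real.exp (-(η * |y|)) * g y) whithamMeasure :=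
  (integrable_exp_mul_prod hg hK).integral_prod_right

theorem integrable_inv_whithamMeasure :
    Integrable (fun η => 2 / η) whithamMeasure ∧ ∫ η, 2 / η ∂whithamMeasure = 1 := by
  have hK : Integrable fun y => whithamKernel y * (1:ℝ) := by
    simpa using integrable_whithamKernel
  have h1 := integrable_integral_exp_mul (g := fun _ => 1) measurable_const hK
  have h2 := integral_whithamKernel_mul (g := fun _ => 1) measurable_const hK
  have hae : (fun η => ∫ y : ℝ, Real.exp (-(η * |y|)) * 1) =ᵐ[whithamMeasure] fun η => 2 / η := by
    filter_upwards [ae_whithamMeasure_pos] with η hη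
    simp only [mul_one]
    exact integral_exp_neg_mul_abs hη
  refine ⟨h1.congr hae, ?_⟩
  rw [← integral_congr_ae hae, ← h2]
  simpa using integral_whithamKernel

theorem integrable_rpow_whithamMeasure {s : ℝ} (hs : 1 / 2 < s) :
    Integrable (fun η : ℝ => η ^ (-s)) whithamMeasure := by
  have hK : Integrable fun y => whithamKernel y * |y| ^ (s - 1) := by
    simpa only [mul_comm] using integrable_rpow_mul_whithamKernel (s := s - 1) (by linarith)
  have hm : Measurable fun y : ℝ => |y| ^ (s - 1) :=
    Measurable.pow_const (by fun_prop) _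
  have h1 := (integrable_integral_exp_mul hm hK).const_mul (2 * Real.Gamma s)⁻¹
  refine h1.congr ?_
  filter_upwards [ae_whithamMeasure_pos] with η hη
  have hG := Real.Gamma_pos_of_pos (show 0 < s by linarith)
  have h2 := integral_comp_abs (f := fun y => Real.exp (-(η * y)) * y ^ (s - 1))
  have h3 := Real.integral_rpow_mul_exp_neg_mul_Ioi (show 0 < s by linarith) hη
  simp only [mul_comm (Real.exp _)] at h2 ⊢
  rw [h2, h3, Real.rpow_neg hη.le, one_div, Real.inv_rpow hη.le]
  field_simp

theorem integral_whithamKernel_le_sqrt {h : ℝ} (hh : 0 ≤ h) :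
    ∫ x in (0:ℝ)..h, whithamKernel x ≤ 8 * √h := by
  have h1 : ∫ x in (0:ℝ)..h, 4 * x ^ (-1/2 : ℝ) = 8 * √h := by
    rw [intervalIntegral.integral_const_mul, integral_rpow (by norm_num), Real.sqrt_eq_rpow]
    norm_num; ring
  rw [← h1]
  refine intervalIntegral.integral_mono_on_of_le_Ioo hh
    integrable_whithamKernel.intervalIntegrable
    ((intervalIntegral.intervalIntegrable_rpow' (by norm_num)).const_mul 4) fun x hx => ?_
  refine (whithamKernel_le_inv_sqrt hx.1).trans (le_of_eq ?_)
  rw [show (-1/2 : ℝ) = -(1/2) by norm_num, Real.rpow_neg hx.1.le, ← Real.sqrt_eq_rpow]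
  rfl

theorem integral_one_sub_exp_le {h : ℝ} (hh : 0 ≤ h) :
    Integrable (fun η => (1 - Real.exp (-(η * h))) / η) whithamMeasure ∧
    ∫ η, (1 - Real.exp (-(η * h))) / η ∂whithamMeasure ≤ 8 * √h := by
  set g : ℝ → ℝ := Set.indicator (Set.Ioc 0 h) 1 with hg
  have hgm : Measurable g := measurable_one.indicator measurableSet_Ioc
  have hK : Integrable fun y => whithamKernel y * g y :=
    integrable_whithamKernel_mul hgm (M := 1) fun x => by
      simp only [hg, Set.indicator_apply]; split_ifs <;> simp
  have h1 := integrable_integral_exp_mul hgm hK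
  have h2 := integral_whithamKernel_mul hgm hK
  have hind : ∀ f : ℝ → ℝ, ∫ y, f y * g y = ∫ y in (0:ℝ)..h, f y := fun f => by
    rw [intervalIntegral.integral_of_le hh, ← integral_indicator measurableSet_Ioc]
    congr 1; ext y
    simp only [hg, Set.indicator_apply]; split_ifs <;> simp
  have hae : (fun η => ∫ y : ℝ, Real.exp (-(η * |y|)) * g y) =ᵐ[whithamMeasure]
      fun η => (1 - Real.exp (-(η * h))) / η := by
    filter_upwards [ae_whithamMeasure_pos] with η hη
    rw [hind]
    have h3 : ∫ y in (0:ℝ)..h, Real.exp (-(η * |y|)) = ∫ y in (0:ℝ)..h, Real.exp (-η * y) := by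
      refine intervalIntegral.integral_congr fun y hy => ?_
      rw [Set.uIcc_of_le hh] at hy
      simp only [abs_of_nonneg hy.1, neg_mul]
    rw [h3, intervalIntegral.integral_comp_mul_left Real.exp (neg_ne_zero.2 hη.ne'), integral_exp]
    simp
    field_simp
    ring
  refine ⟨h1.congr hae, ?_⟩
  rw [← integral_congr_ae hae, ← h2, hind]
  exact integral_whithamKernel_le_sqrt hh

theorem exists_whithamMeasure_lower :
    ∃ c > 0, ∃ T₀ > 0, ∀ T ≥ T₀,
      c * √T ≤ whithamMeasure.real (Set.Ioc T (2 * T)) := by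
  let g : ℝ → ℝ := fun η => min 1 (max 0 (-Real.tan η))
  have htan : Measurable Real.tan := by
    rw [show Real.tan = fun x => Real.sin x / Real.cos x from funext Real.tan_eq_sin_div_cos]
    exact Real.measurable_sin.div Real.measurable_cos
  have hgm : Measurable g := by fun_prop
  have hg0 : ∀ η, 0 ≤ g η := fun η => by simp [g]
  have hg1 : ∀ η, g η ≤ 1 := fun η => by simp [g]
  have hint : ∀ a b, IntervalIntegrable g volume a b := fun a b =>
    (intervalIntegrable_const (c := (1:ℝ))).mono_fun hgm.aestronglyMeasurable
      (Eventually.of_forall fun η => by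
        simp only [norm_one, Real.norm_of_nonneg (hg0 η)]; exact hg1 η)
  have hper : Function.Periodic g π := fun η => by simp only [g, Real.tan_add_pi]
  set I := ∫ x in (0:ℝ)..π, g x with hI
  have hIpos : 0 < I := by
    rw [hI, ← intervalIntegral.integral_add_adjacent_intervals (hint 0 (π/2)) (hint _ _)]
    have h1 : 0 ≤ ∫ x in (0:ℝ)..(π/2), g x :=
      intervalIntegral.integral_nonneg (by positivity) fun _ _ => hg0 _
    have h2 : 0 < ∫ x in (π/2)..π, g x := by
      refine intervalIntegral.intervalIntegral_pos_of_pos_on (hint _ _) (fun x hx => ?_)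
        (by linarith [Real.pi_pos])
      have : 0 < -Real.tan x := by
        have h3 := Real.tan_pos_of_pos_of_lt_pi_div_two (x := π - x) (by linarith [hx.2])
          (by linarith [hx.1])
        rwa [Real.tan_pi_sub] at h3
      simp only [g]
      exact lt_min one_pos (lt_max_of_lt_right this)
    linarith
  have hlow : ∀ T ≥ 2 * π, I / (2 * π) * T ≤ ∫ x in T..(2 * T), g x := by
    intro T hT
    have hper' : Function.Periodic (fun x => g (T + x)) π := fun x => by
      simp only [← add_assoc]; exact hper _
    have hint' : ∀ a b, IntervalIntegrable (fun x => g (T + x)) volume a b := fun a b => by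
      simpa using (hint (T + a) (T + b)).comp_add_left T
    have h1 := hper'.sInf_add_zsmul_le_integral_of_pos (hint' _ _) Real.pi_pos T
    have h2 : 0 ≤ sInf ((fun t => ∫ x in (0:ℝ)..t, g (T + x)) '' Set.Icc 0 π) := by
      refine Real.sInf_nonneg ?_
      rintro _ ⟨t, ht, rfl⟩
      exact intervalIntegral.integral_nonneg ht.1 fun _ _ => hg0 _
    have h3 : ∫ x in (0:ℝ)..π, g (T + x) = I := by
      rw [intervalIntegral.integral_comp_add_left, add_zero,
        hper.intervalIntegral_add_eq T 0, zero_add]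
    have h4 : ∫ x in (0:ℝ)..T, g (T + x) = ∫ x in T..(2 * T), g x := by
      rw [intervalIntegral.integral_comp_add_left, add_zero, two_mul]
    rw [h3, h4, zsmul_eq_mul] at h1
    have h5 : T / (2 * π) ≤ (⌊T / π⌋ : ℝ) := by
      have h6 := Int.sub_one_lt_floor (T / π)
      have h7 : T / π = 2 * (T / (2 * π)) := by field_simp
      have h8 : 1 ≤ T / (2 * π) := by rw [le_div_iff₀ (by positivity)]; linarith
      linarith
    calc I / (2 * π) * T = T / (2 * π) * I := by ring
      _ ≤ ⌊T / π⌋ * I := by gcongr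
      _ ≤ _ := by linarith
  refine ⟨I / (2 * π) / π / 2, by positivity, 2 * π, by positivity, fun T hT => ?_⟩
  have hTpos : 0 < T := by linarith [Real.pi_pos]
  have hsub : whithamMeasure.real (Set.Ioc T (2 * T)) =
      ∫ η, Set.indicator (Set.Ioc T (2 * T)) 1 η ∂whithamMeasure := by
    rw [integral_indicator_one measurableSet_Ioc]
  have hfin : IntegrableOn (fun η => branchJump η) (Set.Ioc T (2 * T)) := by
    have h1 := (integrableOn_exp_mul_branchJump one_pos).mono_set
      (show Set.Ioc T (2 * T) ⊆ Set.Ioi 0 from fun η hη => hTpos.trans hη.1)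
    have h2 := h1.const_mul (Real.exp (2 * T))
    refine h2.mono' measurable_branchJump.aestronglyMeasurable
      ((ae_restrict_iff' measurableSet_Ioc).2 (Eventually.of_forall fun η hη => ?_))
    rw [Real.norm_of_nonneg (branchJump_nonneg _), ← mul_assoc, ← Real.exp_add, one_mul]
    exact le_mul_of_one_le_left (branchJump_nonneg _) (Real.one_le_exp (by linarith [hη.2]))
  rw [hsub, integral_whithamMeasure]
  have h3 : ∫ η in Set.Ioi (0:ℝ), Set.indicator (Set.Ioc T (2 * T)) 1 η * branchJump η =
      ∫ η in Set.Ioc T (2 * T), branchJump η := by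
    have : (fun η => Set.indicator (Set.Ioc T (2 * T)) (1 : ℝ → ℝ) η * branchJump η) =
        Set.indicator (Set.Ioc T (2 * T)) branchJump := by
      ext η; simp only [Set.indicator_apply]; split_ifs <;> simp
    rw [this, setIntegral_indicator measurableSet_Ioc]
    congr 2
    exact Set.inter_eq_right.2 fun η hη => hTpos.trans hη.1
  rw [h3]
  have h4 : (√(2 * T))⁻¹ * ∫ x in T..(2 * T), g x ≤ ∫ η in Set.Ioc T (2 * T), branchJump η := by
    rw [intervalIntegral.integral_of_le (by linarith), ← integral_const_mul]
    refine setIntegral_mono_on (((intervalIntegrable_iff_integrableOn_Ioc_of_le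
      (by linarith)).1 (hint T (2 * T))).const_mul _) hfin measurableSet_Ioc fun η hη => ?_
    have hηpos : 0 < η := hTpos.trans hη.1
    have h5 : √(max 0 (-Real.tan η)) / √η ≤ branchJump η := by
      rw [branchJump, ← Real.sqrt_div' _ hηpos.le]
      refine Real.sqrt_le_sqrt ?_
      rcases le_total 0 (-Real.tan η) with h | h
      · rw [max_eq_right h, ← neg_div]; exact le_max_right _ _
      · rw [max_eq_left h, zero_div]; exact le_max_left _ _
    refine le_trans ?_ h5
    have h6 : g η ≤ √(max 0 (-Real.tan η)) := by
      have h7 : g η ^ 2 ≤ max 0 (-Real.tan η) := by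
        have : g η ≤ max 0 (-Real.tan η) := min_le_right _ _
        nlinarith [hg0 η, hg1 η]
      exact Real.le_sqrt_of_sq_le h7
    rw [inv_mul_eq_div]
    exact div_le_div₀ (Real.sqrt_nonneg _) h6 (Real.sqrt_pos.2 hηpos)
      (Real.sqrt_le_sqrt hη.2)
  have h8 := hlow T hT
  have hs2 : √(2 * T) ≤ 2 * √T := by
    rw [Real.sqrt_le_left (by positivity)]
    rw [mul_pow, Real.sq_sqrt hTpos.le]; linarith
  have hsT : 0 < √T := Real.sqrt_pos.2 hTpos
  have h9 : (2 * √T)⁻¹ * (I / (2 * π) * T) ≤ ∫ η in Set.Ioc T (2 * T), branchJump η := by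
    refine le_trans ?_ h4
    have : 0 < √(2 * T) := Real.sqrt_pos.2 (by linarith)
    gcongr
  calc I / (2 * π) / π / 2 * √T = 1 / π * ((2 * √T)⁻¹ * (I / (2 * π) * (√T * √T))) := by
        field_simp
    _ ≤ _ := by rw [Real.mul_self_sqrt hTpos.le]; gcongr

end KernelFubini

section Operator

/-- Bounded measurable functions on the line. -/
def BddMeas (f : ℝ → ℝ) : Prop := Measurable f ∧ ∃ M, ∀ x, |f x| ≤ M

namespace BddMeas

theorem const (c : ℝ) : BddMeas fun _ => c := ⟨measurable_const, |c|, fun _ => le_rfl⟩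

theorem neg {f : ℝ → ℝ} (hf : BddMeas f) : BddMeas fun x => -f x := by
  obtain ⟨hm, M, hM⟩ := hf
  exact ⟨hm.neg, M, fun x => by simpa using hM x⟩

theorem add {f g : ℝ → ℝ} (hf : BddMeas f) (hg : BddMeas g) : BddMeas fun x => f x + g x := by
  obtain ⟨hm, M, hM⟩ := hf
  obtain ⟨hn, N, hN⟩ := hg
  exact ⟨hm.add hn, M + N, fun x => (abs_add_le _ _).trans (add_le_add (hM x) (hN x))⟩

theorem mul {f g : ℝ → ℝ} (hf : BddMeas f) (hg : BddMeas g) : BddMeas fun x => f x * g x := by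
  obtain ⟨hm, M, hM⟩ := hf
  obtain ⟨hn, N, hN⟩ := hg
  refine ⟨hm.mul hn, M * N, fun x => ?_⟩
  rw [abs_mul]
  exact mul_le_mul (hM x) (hN x) (abs_nonneg _) ((abs_nonneg _).trans (hM x))

theorem sub {f g : ℝ → ℝ} (hf : BddMeas f) (hg : BddMeas g) : BddMeas fun x => f x - g x := by
  simpa only [sub_eq_add_neg] using hf.add hg.neg

theorem comp {f g : ℝ → ℝ} (hf : BddMeas f) (hg : Measurable g) : BddMeas fun x => f (g x) :=
  ⟨hf.1.comp hg, hf.2.imp fun _ h x => h (g x)⟩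

theorem integrable_kernel_mul {f : ℝ → ℝ} (hf : BddMeas f) :
    Integrable fun y => whithamKernel y * f y :=
  integrable_whithamKernel_mul hf.1 hf.2.choose_spec

theorem integrable_exp_mul {f : ℝ → ℝ} (hf : BddMeas f) {η : ℝ} (hη : 0 < η) :
    Integrable fun y => Real.exp (-(η * |y|)) * f y :=
  (integrable_exp_neg_mul_abs hη).mul_bdd (c := hf.2.choose) hf.1.aestronglyMeasurable
    (Eventually.of_forall hf.2.choose_spec)

theorem comp_sub {f : ℝ → ℝ} (hf : BddMeas f) (x : ℝ) : BddMeas fun y => f (x - y) :=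
  hf.comp (by fun_prop)

end BddMeas

/-- Convolution with the two-sided exponential `exp (-η |y|)`. -/
noncomputable def expConv (η : ℝ) (f : ℝ → ℝ) (x : ℝ) : ℝ :=
  ∫ y, Real.exp (-(η * |y|)) * f (x - y)

theorem Lop_eq (K f : ℝ → ℝ) (x : ℝ) : Lop K f x = ∫ y, K y * f (x - y) := by
  unfold Lop
  rw [← integral_sub_left_eq_self (fun y => K (x - y) * f y) volume x]
  simp

theorem integrable_expConv {f : ℝ → ℝ} (hf : BddMeas f) (x : ℝ) :
    Integrable (fun η => expConv η f x) whithamMeasure :=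
  integrable_integral_exp_mul (hf.comp_sub x).1 (hf.comp_sub x).integrable_kernel_mul

theorem Lop_eq_expConv {f : ℝ → ℝ} (hf : BddMeas f) (x : ℝ) :
    Lop whithamKernel f x = ∫ η, expConv η f x ∂whithamMeasure := by
  rw [Lop_eq]
  exact integral_whithamKernel_mul (hf.comp_sub x).1 (hf.comp_sub x).integrable_kernel_mul

theorem Lop_add {f g : ℝ → ℝ} (hf : BddMeas f) (hg : BddMeas g) (x : ℝ) :
    Lop whithamKernel (fun x => f x + g x) x = Lop whithamKernel f x + Lop whithamKernel g x := by
  simp only [Lop_eq, mul_add]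
  exact integral_add (hf.comp_sub x).integrable_kernel_mul (hg.comp_sub x).integrable_kernel_mul

theorem Lop_sub {f g : ℝ → ℝ} (hf : BddMeas f) (hg : BddMeas g) (x : ℝ) :
    Lop whithamKernel (fun x => f x - g x) x = Lop whithamKernel f x - Lop whithamKernel g x := by
  simp only [Lop_eq, mul_sub]
  exact integral_sub (hf.comp_sub x).integrable_kernel_mul (hg.comp_sub x).integrable_kernel_mul

theorem Lop_const (c x : ℝ) : Lop whithamKernel (fun _ => c) x = c := by
  rw [Lop_eq, integral_mul_const, integral_whithamKernel, one_mul]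

theorem Lop_nonneg {f : ℝ → ℝ} (hf : ∀ x, 0 ≤ f x) (x : ℝ) : 0 ≤ Lop whithamKernel f x :=
  integral_nonneg fun y => mul_nonneg (whithamKernel_nonneg _) (hf y)

theorem Lop_mono {f g : ℝ → ℝ} (hf : BddMeas f) (hg : BddMeas g) (h : ∀ x, f x ≤ g x) (x : ℝ) :
    Lop whithamKernel f x ≤ Lop whithamKernel g x := by
  simp only [Lop_eq]
  exact integral_mono (hf.comp_sub x).integrable_kernel_mul (hg.comp_sub x).integrable_kernel_mul
    fun y => mul_le_mul_of_nonneg_left (h _) (whithamKernel_nonneg _)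

theorem abs_Lop_le {f : ℝ → ℝ} (hf : Measurable f) {M : ℝ} (hM : ∀ x, |f x| ≤ M) (x : ℝ) :
    |Lop whithamKernel f x| ≤ M := by
  have hb : BddMeas f := ⟨hf, M, hM⟩
  rw [abs_le]
  constructor
  · have := Lop_mono (BddMeas.const (-M)) hb (fun x => (abs_le.1 (hM x)).1) x
    rwa [Lop_const] at this
  · have := Lop_mono hb (BddMeas.const M) (fun x => (abs_le.1 (hM x)).2) x
    rwa [Lop_const] at this

theorem Lop_periodic {f : ℝ → ℝ} {P : ℝ} (hf : Function.Periodic f P) :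
    Function.Periodic (Lop whithamKernel f) P := fun x => by
  simp only [Lop_eq]
  congr 1; ext y
  rw [show x + P - y = (x - y) + P by ring, hf]

theorem Lop_even {f : ℝ → ℝ} (hf : ∀ x, f (-x) = f x) (x : ℝ) :
    Lop whithamKernel f (-x) = Lop whithamKernel f x := by
  simp only [Lop_eq]
  rw [← integral_neg_eq_self (fun y => whithamKernel y * f (-x - y))]
  congr 1; ext y
  rw [whithamKernel_neg, ← hf (-x - -y)]
  congr 2; ring

theorem abs_exp_neg_abs_sub_le {η : ℝ} (hη : 0 < η) {h : ℝ} (hh : 0 ≤ h) (z : ℝ) :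
    |Real.exp (-(η * |z + h|)) - Real.exp (-(η * |z|))| ≤
      η * h * (Real.exp (-(η * |z + h|)) + Real.exp (-(η * |z|))) := by
  have key : ∀ a b : ℝ, 0 ≤ a → 0 ≤ b → b - a ≤ h →
      Real.exp (-(η * a)) - Real.exp (-(η * b)) ≤ η * h * Real.exp (-(η * a)) := by
    intro a b ha hb hab
    have h1 : Real.exp (-(η * b)) = Real.exp (-(η * a)) * Real.exp (-(η * (b - a))) := by
      rw [← Real.exp_add]; congr 1; ring
    have h2 : 1 - η * h ≤ Real.exp (-(η * (b - a))) := by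
      have := Real.add_one_le_exp (-(η * (b - a)))
      nlinarith
    rw [h1]
    nlinarith [Real.exp_pos (-(η * a))]
  have h3 : |z + h| - |z| ≤ h := by
    have := abs_add_le z h; rw [abs_of_nonneg hh] at this; linarith
  have h4 : |z| - |z + h| ≤ h := by
    have := abs_add_le (z + h) (-h); rw [abs_neg, abs_of_nonneg hh] at this
    simp at this; linarith
  have k1 := key |z + h| |z| (abs_nonneg _) (abs_nonneg _) h4
  have k2 := key |z| |z + h| (abs_nonneg _) (abs_nonneg _) h3
  have hp1 : 0 ≤ η * h * Real.exp (-(η * |z + h|)) := by positivity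
  have hp2 : 0 ≤ η * h * Real.exp (-(η * |z|)) := by positivity
  rw [abs_le]; constructor <;> linarith

theorem expConv_eq (η : ℝ) (f : ℝ → ℝ) (x : ℝ) :
    expConv η f x = ∫ y, Real.exp (-(η * |x - y|)) * f y := by
  unfold expConv
  rw [← integral_sub_left_eq_self (fun y => Real.exp (-(η * |x - y|)) * f y) volume x]
  simp

theorem expConv_shift (η : ℝ) (f : ℝ → ℝ) (x h : ℝ) :
    expConv η f (x + h) = ∫ z, Real.exp (-(η * |z + h|)) * f (x - z) := by
  rw [expConv, ← integral_add_right_eq_self _ h]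
  congr 1; ext z; congr 2; ring

theorem abs_expConv_le {f : ℝ → ℝ} {M : ℝ} (hM : ∀ x, |f x| ≤ M) {η : ℝ}
    (hη : 0 < η) (x : ℝ) : |expConv η f x| ≤ M * (2 / η) := by
  rw [← Real.norm_eq_abs, expConv]
  refine (norm_integral_le_of_norm_le ((integrable_exp_neg_mul_abs hη).const_mul M)
    (Eventually.of_forall fun y => ?_)).trans_eq ?_
  · rw [norm_mul, Real.norm_of_nonneg (Real.exp_nonneg _), mul_comm]
    exact mul_le_mul_of_nonneg_right (hM _) (Real.exp_nonneg _)
  · rw [integral_const_mul, integral_exp_neg_mul_abs hη]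

theorem integrable_exp_shift {η : ℝ} (hη : 0 < η) (h : ℝ) :
    Integrable fun z => Real.exp (-(η * |z + h|)) :=
  (integrable_exp_neg_mul_abs hη).comp_add_right h

theorem abs_expConv_sub_le {f : ℝ → ℝ} (hf : Measurable f) {M : ℝ} (hM : ∀ x, |f x| ≤ M) {η : ℝ}
    (hη : 0 < η) (x : ℝ) {h : ℝ} (hh : 0 ≤ h) :
    |expConv η f (x + h) - expConv η f x| ≤ 8 * M * ((1 - Real.exp (-(η * h))) / η) := by
  have hM0 : 0 ≤ M := (abs_nonneg _).trans (hM 0)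
  have hb : BddMeas f := ⟨hf, M, hM⟩
  have hb1 : |expConv η f (x + h) - expConv η f x| ≤ 4 * M / η := by
    refine (abs_sub _ _).trans ?_
    have e : 4 * M / η = M * (2 / η) + M * (2 / η) := by ring
    rw [e]
    exact add_le_add (abs_expConv_le hM hη _) (abs_expConv_le hM hη _)
  have hb2 : |expConv η f (x + h) - expConv η f x| ≤ 4 * M * h := by
    have i1 : Integrable fun z => Real.exp (-(η * |z + h|)) * f (x - z) :=
      (integrable_exp_shift hη h).mul_bdd (c := M)
        (hb.comp_sub x).1.aestronglyMeasurable (Eventually.of_forall fun z => hM _)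
    rw [expConv_shift, expConv, ← integral_sub i1 ((hb.comp_sub x).integrable_exp_mul hη),
      ← Real.norm_eq_abs]
    refine (norm_integral_le_of_norm_le (((integrable_exp_shift hη h).add
      (integrable_exp_neg_mul_abs hη)).const_mul (η * h * M))
      (Eventually.of_forall fun z => ?_)).trans_eq ?_
    · rw [← sub_mul, norm_mul]
      calc _ ≤ (η * h * (Real.exp (-(η * |z + h|)) + Real.exp (-(η * |z|)))) * M :=
            mul_le_mul (abs_exp_neg_abs_sub_le hη hh z) (hM _) (abs_nonneg _) (by positivity)
        _ = _ := by simp only [Pi.add_apply]; ring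
    · rw [integral_const_mul]
      simp only [Pi.add_apply]
      rw [integral_add (integrable_exp_shift hη h) (integrable_exp_neg_mul_abs hη),
        integral_add_right_eq_self (fun z => Real.exp (-(η * |z|))) h,
        integral_exp_neg_mul_abs hη]
      field_simp; ring
  rcases le_total 1 (η * h) with h1 | h1
  · have : Real.exp (-(η * h)) ≤ 1 / 2 := by
      have h2 : Real.exp (-(η * h)) ≤ Real.exp (-1) := Real.exp_le_exp.2 (by linarith)
      have := Real.exp_neg_one_lt_d9
      linarith
    refine hb1.trans ?_
    rw [mul_div_assoc', div_le_div_iff_of_pos_right hη]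
    nlinarith
  · have h2 : η * h / 2 ≤ 1 - Real.exp (-(η * h)) := by
      have h0 : 0 ≤ η * h := by positivity
      have h3 := Real.add_one_le_exp (η * h)
      have h4 : Real.exp (-(η * h)) * Real.exp (η * h) = 1 := by rw [← Real.exp_add]; simp
      nlinarith [Real.exp_pos (-(η * h))]
    refine hb2.trans ?_
    rw [mul_div_assoc', le_div_iff₀ hη]
    nlinarith

theorem abs_Lop_sub_le {f : ℝ → ℝ} (hf : Measurable f) {M : ℝ} (hM : ∀ x, |f x| ≤ M) (x y : ℝ) :
    |Lop whithamKernel f x - Lop whithamKernel f y| ≤ 64 * M * √|x - y| := by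
  have hM0 : 0 ≤ M := (abs_nonneg _).trans (hM 0)
  have key : ∀ x h : ℝ, 0 ≤ h →
      |Lop whithamKernel f (x + h) - Lop whithamKernel f x| ≤ 64 * M * √h := by
    intro x h hh
    have hb : BddMeas f := ⟨hf, M, hM⟩
    obtain ⟨hi, hle⟩ := integral_one_sub_exp_le hh
    rw [Lop_eq_expConv hb, Lop_eq_expConv hb,
      ← integral_sub (integrable_expConv hb _) (integrable_expConv hb _), ← Real.norm_eq_abs]
    refine (norm_integral_le_of_norm_le (hi.const_mul (8 * M)) ?_).trans ?_
    · filter_upwards [ae_whithamMeasure_pos] with η hη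
      exact abs_expConv_sub_le hf hM hη x hh
    · rw [integral_const_mul]
      nlinarith
  rcases le_total x y with h | h
  · have := key x (y - x) (by linarith)
    rw [abs_sub_comm, abs_sub_comm x y, abs_of_nonneg (sub_nonneg.2 h)]
    simpa using this
  · have := key y (x - y) (by linarith)
    rw [abs_of_nonneg (sub_nonneg.2 h)]
    simpa using this

theorem continuous_of_abs_sub_le_sqrt {f : ℝ → ℝ} {C : ℝ}
    (h : ∀ x y, |f x - f y| ≤ C * √|x - y|) : Continuous f := by
  rw [continuous_iff_continuousAt]
  intro x
  have h1 : Tendsto (fun y => C * √|y - x|) (nhds x) (nhds 0) := by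
    have : Continuous fun y => C * √|y - x| := by fun_prop
    simpa using this.tendsto x
  rw [ContinuousAt, tendsto_iff_dist_tendsto_zero]
  exact squeeze_zero (fun _ => dist_nonneg) (fun y => h y x) h1

theorem continuous_Lop {f : ℝ → ℝ} (hf : BddMeas f) : Continuous (Lop whithamKernel f) :=
  continuous_of_abs_sub_le_sqrt (abs_Lop_sub_le hf.1 hf.2.choose_spec)

end Operator

section Bell

/-- The triangle wave: the distance from `x` to the lattice `P ℤ`. -/
noncomputable def tri (P x : ℝ) : ℝ := ‖(x : AddCircle P)‖

theorem tri_nonneg (P x : ℝ) : 0 ≤ tri P x := norm_nonneg _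

theorem tri_periodic (P : ℝ) : Function.Periodic (tri P) P := fun x => by simp [tri]

theorem tri_neg (P x : ℝ) : tri P (-x) = tri P x := by simp [tri]

theorem tri_le {P : ℝ} (hP : 0 < P) (x : ℝ) : tri P x ≤ P / 2 := by
  have := AddCircle.norm_le_half_period (x := (x : AddCircle P)) P hP.ne'
  rwa [abs_of_pos hP] at this

theorem tri_eq_abs {P : ℝ} (hP : 0 < P) {x : ℝ} (hx : |x| ≤ P / 2) : tri P x = |x| :=
  (AddCircle.norm_coe_eq_abs_iff P hP.ne').2 (by rwa [abs_of_pos hP])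

theorem tri_eq {P : ℝ} (hP : 0 < P) {x : ℝ} (hx0 : 0 ≤ x) (hx : x ≤ P / 2) : tri P x = x := by
  rw [tri_eq_abs hP (by rwa [abs_of_nonneg hx0]), abs_of_nonneg hx0]

theorem tri_eq_sub {P : ℝ} (hP : 0 < P) {x : ℝ} (hx0 : P / 2 ≤ x) (hx : x ≤ P) :
    tri P x = P - x := by
  rw [← tri_neg, ← tri_periodic P, tri_eq hP (by linarith) (by linarith)]; ring

theorem tri_le_abs (P x : ℝ) : tri P x ≤ |x| := by
  unfold tri
  have := QuotientAddGroup.norm_mk_le_norm (S := AddSubgroup.zmultiples P) (m := x)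
  simpa using this

theorem abs_tri_sub_le (P x y : ℝ) : |tri P x - tri P y| ≤ |x - y| := by
  refine (abs_norm_sub_norm_le _ _).trans ?_
  have := tri_le_abs P (x - y)
  simpa [tri] using this

theorem continuous_tri (P : ℝ) : Continuous (tri P) := by
  refine LipschitzWith.continuous (K := 1) (LipschitzWith.of_dist_le_mul fun x y => ?_)
  simpa [Real.dist_eq] using abs_tri_sub_le P x y

theorem exists_tri_eq (P x : ℝ) : ∃ n : ℤ, tri P x = |x - n * P| :=
  ⟨round (P⁻¹ * x), by unfold tri; rw [AddCircle.norm_eq]⟩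

theorem comp_tri {P : ℝ} {f : ℝ → ℝ} (hper : Function.Periodic f P) (heven : ∀ x, f (-x) = f x)
    (x : ℝ) : f (tri P x) = f x := by
  obtain ⟨n, hn⟩ := exists_tri_eq P x
  rw [hn]
  have h1 : f (x - n * P) = f x := hper.sub_int_mul_eq n
  rcases abs_choice (x - n * P) with h | h
  · rw [h, h1]
  · rw [h, heven, h1]

theorem tri_sub_le_tri_add {P : ℝ} (hP : 0 < P) {a b : ℝ} (ha : 0 ≤ a) (ha' : a ≤ P / 2)
    (hb : 0 ≤ b) (hb' : b ≤ P / 2) : tri P (a - b) ≤ tri P (a + b) := by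
  rw [tri_eq_abs hP (by rw [abs_le]; constructor <;> linarith)]
  rcases le_total (a + b) (P / 2) with h | h
  · rw [tri_eq hP (by linarith) h, abs_le]; constructor <;> linarith
  · rw [tri_eq_sub hP h (by linarith), abs_le]; constructor <;> linarith

theorem tri_sub_lt_tri_add {P : ℝ} (hP : 0 < P) {a b : ℝ} (ha : 0 < a) (ha' : a < P / 2)
    (hb : 0 < b) (hb' : b < P / 2) : tri P (a - b) < tri P (a + b) := by
  rw [tri_eq_abs hP (by rw [abs_le]; constructor <;> linarith)]
  rcases le_total (a + b) (P / 2) with h | h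
  · rw [tri_eq hP (by linarith) h, abs_lt]; constructor <;> linarith
  · rw [tri_eq_sub hP h (by linarith), abs_lt]; constructor <;> linarith

/-- Continuous, even, `P`-periodic functions which increase on the half-period `[0, P / 2]`. -/
structure IsBell (P : ℝ) (f : ℝ → ℝ) : Prop where
  continuous : Continuous f
  even : ∀ x, f (-x) = f x
  periodic : Function.Periodic f P
  mono : MonotoneOn f (Set.Icc 0 (P / 2))

namespace IsBell

variable {P : ℝ} {f : ℝ → ℝ}

theorem comp_tri (hf : IsBell P f) (x : ℝ) : f (tri P x) = f x :=
  _root_.comp_tri hf.periodic hf.even x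

theorem le_of_tri_le (hP : 0 < P) (hf : IsBell P f) {x y : ℝ} (h : tri P x ≤ tri P y) :
    f x ≤ f y := by
  rw [← hf.comp_tri x, ← hf.comp_tri y]
  exact hf.mono ⟨tri_nonneg P x, tri_le hP x⟩ ⟨tri_nonneg P y, tri_le hP y⟩ h

theorem zero_le (hP : 0 < P) (hf : IsBell P f) (x : ℝ) : f 0 ≤ f x :=
  hf.le_of_tri_le hP (by rw [tri_eq hP le_rfl (by linarith)]; exact tri_nonneg P x)

theorem le_half (hP : 0 < P) (hf : IsBell P f) (x : ℝ) : f x ≤ f (P / 2) :=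
  hf.le_of_tri_le hP (by rw [tri_eq hP (x := P/2) (by linarith) le_rfl]; exact tri_le hP x)

theorem bddMeas (hP : 0 < P) (hf : IsBell P f) : BddMeas f :=
  ⟨hf.continuous.measurable, max |f 0| |f (P / 2)|,
    fun x => abs_le_max_abs_abs (hf.zero_le hP x) (hf.le_half hP x)⟩

theorem symm_diff_nonneg (hP : 0 < P) (hf : IsBell P f) {c t : ℝ} (hc : 0 ≤ c) (hc' : c ≤ P / 2)
    (ht : 0 ≤ t) (ht' : t ≤ P / 2) : 0 ≤ f (c + t) - f (c - t) :=
  sub_nonneg.2 (hf.le_of_tri_le hP (tri_sub_le_tri_add hP hc hc' ht ht'))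

end IsBell

/-- The `P`-periodization of `exp (-η |y|)`. -/
noncomputable def perExp (P η y : ℝ) : ℝ :=
  (Real.exp (-(η * tri P y)) + Real.exp (-(η * (P - tri P y)))) / (1 - Real.exp (-(η * P)))

theorem continuous_perExp (P η : ℝ) : Continuous (perExp P η) := by
  have := continuous_tri P
  unfold perExp
  fun_prop

theorem one_sub_exp_pos {a : ℝ} (ha : 0 < a) : 0 < 1 - Real.exp (-a) := by
  have : Real.exp (-a) < 1 := by rw [Real.exp_lt_one_iff]; linarith
  linarith

theorem perExp_aux {P : ℝ} {η : ℝ} (hη : 0 < η) {s t : ℝ} (hst : s < t)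
    (hsum : s + t < P) : Real.exp (-(η * t)) + Real.exp (-(η * (P - t))) <
      Real.exp (-(η * s)) + Real.exp (-(η * (P - s))) := by
  have e1 : Real.exp (-(η * t)) = Real.exp (-(η * s)) * Real.exp (-(η * (t - s))) := by
    rw [← Real.exp_add]; congr 1; ring
  have e2 : Real.exp (-(η * (P - s))) = Real.exp (-(η * (P - t))) * Real.exp (-(η * (t - s))) := by
    rw [← Real.exp_add]; congr 1; ring
  have h1 : Real.exp (-(η * (P - t))) < Real.exp (-(η * s)) := by
    rw [Real.exp_lt_exp]; nlinarith
  have h2 := one_sub_exp_pos (mul_pos hη (sub_pos.2 hst))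
  rw [e1, e2]
  nlinarith

theorem perExp_lt {P : ℝ} (hP : 0 < P) {η : ℝ} (hη : 0 < η) {x y : ℝ} (h : tri P x < tri P y) :
    perExp P η y < perExp P η x := by
  unfold perExp
  refine div_lt_div_of_pos_right ?_ (one_sub_exp_pos (mul_pos hη hP))
  exact perExp_aux hη h (by linarith [tri_le hP x, tri_le hP y])

theorem perExp_le {P : ℝ} (hP : 0 < P) {η : ℝ} (hη : 0 < η) {x y : ℝ} (h : tri P x ≤ tri P y) :
    perExp P η y ≤ perExp P η x := by
  rcases h.eq_or_lt with h | h
  · unfold perExp; rw [h]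
  · exact (perExp_lt hP hη h).le

theorem perExp_eq {P : ℝ} (hP : 0 < P) (η : ℝ) {y : ℝ} (hy : 0 ≤ y) (hy' : y ≤ P) :
    perExp P η y = (Real.exp (-(η * y)) + Real.exp (-(η * (P - y)))) / (1 - Real.exp (-(η * P))) := by
  unfold perExp
  rcases le_total y (P / 2) with h | h
  · rw [tri_eq hP hy h]
  · rw [tri_eq_sub hP h hy', add_comm]; congr 4; ring

theorem BddMeas.integrableOn_exp_mul_Ioi {g : ℝ → ℝ} (hg : BddMeas g) {η : ℝ} (hη : 0 < η) (a : ℝ) :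
    IntegrableOn (fun y => Real.exp (-(η * y)) * g y) (Set.Ioi a) := by
  refine Integrable.mul_bdd (c := hg.2.choose) ?_ hg.1.aestronglyMeasurable
    (Eventually.of_forall hg.2.choose_spec)
  have := _root_.integrableOn_exp_mul_Ioi (a := -η) (by linarith) a
  simp only [neg_mul] at this
  exact this

theorem integral_exp_mul_Ioi_periodic {P : ℝ} (hP : 0 < P) {g : ℝ → ℝ}
    (hb : BddMeas g) (hper : Function.Periodic g P) {η : ℝ} (hη : 0 < η) :
    ∫ y in Set.Ioi (0:ℝ), Real.exp (-(η * y)) * g y =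
      (∫ y in (0:ℝ)..P, Real.exp (-(η * y)) * g y) / (1 - Real.exp (-(η * P))) := by
  rw [eq_div_iff (one_sub_exp_pos (mul_pos hη hP)).ne']
  have h1 := intervalIntegral.integral_interval_add_Ioi (a := 0) (b := P)
    (f := fun y => Real.exp (-(η * y)) * g y) (μ := volume)
    (hb.integrableOn_exp_mul_Ioi hη 0) (hb.integrableOn_exp_mul_Ioi hη P)
  have h2 : ∫ y in Set.Ioi P, Real.exp (-(η * y)) * g y =
      Real.exp (-(η * P)) * ∫ y in Set.Ioi (0:ℝ), Real.exp (-(η * y)) * g y := by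
    have h3 := (measurePreserving_add_right volume P).setIntegral_preimage_emb
      (measurableEmbedding_addRight P) (fun y => Real.exp (-(η * y)) * g y) (Set.Ioi P)
    rw [Set.preimage_add_const_Ioi, sub_self] at h3
    rw [← h3, ← integral_const_mul]
    congr 1; ext y
    rw [hper y, ← mul_assoc, ← Real.exp_add]
    congr 2; ring
  rw [h2] at h1
  linarith

theorem integral_exp_mul_periodic {P : ℝ} (hP : 0 < P) {g : ℝ → ℝ} (hg : Continuous g)
    (hb : BddMeas g) (hper : Function.Periodic g P) {η : ℝ} (hη : 0 < η) :
    ∫ y, Real.exp (-(η * |y|)) * g y = ∫ y in (0:ℝ)..P, perExp P η y * g y := by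
  have h0 : ∫ y, Real.exp (-(η * |y|)) * g y =
      (∫ y in Set.Ioi (0:ℝ), Real.exp (-(η * y)) * g y) +
      ∫ y in Set.Ioi (0:ℝ), Real.exp (-(η * y)) * g (-y) := by
    rw [← integral_add_compl (measurableSet_Ioi (a := (0:ℝ))) (hb.integrable_exp_mul hη)]
    congr 1
    · refine setIntegral_congr_fun measurableSet_Ioi fun y hy => ?_
      simp only [abs_of_pos (Set.mem_Ioi.1 hy)]
    · rw [Set.compl_Ioi, show Set.Iic (0:ℝ) = Set.Iic (-0) by simp,
        ← integral_comp_neg_Ioi (0:ℝ) (fun y => Real.exp (-(η * |y|)) * g y)]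
      refine setIntegral_congr_fun measurableSet_Ioi fun y hy => ?_
      simp only [abs_neg, abs_of_pos (Set.mem_Ioi.1 hy)]
  have hper' : Function.Periodic (fun y => g (-y)) P := fun y => by
    show g (-(y + P)) = g (-y)
    rw [neg_add, ← sub_eq_add_neg, hper.sub_eq]
  rw [h0, integral_exp_mul_Ioi_periodic hP hb hper hη,
    integral_exp_mul_Ioi_periodic hP (g := fun y => g (-y)) (hb.comp (by fun_prop)) hper' hη]
  have h1 : ∫ y in (0:ℝ)..P, Real.exp (-(η * y)) * g (-y) =
      ∫ y in (0:ℝ)..P, Real.exp (-(η * (P - y))) * g y := by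
    have := intervalIntegral.integral_comp_sub_left (a := 0) (b := P)
      (fun y => Real.exp (-(η * y)) * g (-y)) P
    simp only [sub_self, sub_zero] at this
    rw [← this]
    congr 1; ext y
    rw [neg_sub, hper.sub_eq]
  rw [h1, ← add_div, ← intervalIntegral.integral_add
    (Continuous.intervalIntegrable (by fun_prop) _ _) (Continuous.intervalIntegrable (by fun_prop) _ _),
    ← intervalIntegral.integral_div]
  refine intervalIntegral.integral_congr fun y hy => ?_
  rw [Set.uIcc_of_le hP.le] at hy
  simp only [perExp_eq hP η hy.1 hy.2]
  ring

theorem bddMeas_of_periodic {P : ℝ} (hP : 0 < P) {g : ℝ → ℝ} (hg : Continuous g)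
    (hper : Function.Periodic g P) : BddMeas g := by
  refine ⟨hg.measurable, ?_⟩
  obtain ⟨M, hM⟩ := isCompact_Icc.exists_bound_of_continuousOn (s := Set.Icc 0 P) hg.continuousOn
  refine ⟨M, fun x => ?_⟩
  obtain ⟨y, hy, hxy⟩ := hper.exists_mem_Ico₀ hP x
  rw [hxy]
  exact hM y ⟨hy.1, hy.2.le⟩

theorem perExp_periodic (P η : ℝ) : Function.Periodic (perExp P η) P := fun y => by
  unfold perExp; rw [tri_periodic P y]

theorem perExp_neg (P η y : ℝ) : perExp P η (-y) = perExp P η y := by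
  unfold perExp; rw [tri_neg]

theorem expConv_sub_eq {P : ℝ} (hP : 0 < P) {f : ℝ → ℝ} (hf : Continuous f)
    (hper : Function.Periodic f P) {η : ℝ} (hη : 0 < η) (c e : ℝ) :
    expConv η f (c + e) - expConv η f (c - e) =
      ∫ t in (0:ℝ)..(P / 2), (perExp P η (e - t) - perExp P η (e + t)) * (f (c + t) - f (c - t)) := by
  have hb := bddMeas_of_periodic hP hf hper
  have hw := continuous_perExp P η
  set d : ℝ → ℝ := fun t => f (c + t) - f (c - t) with hd
  have hdc : Continuous d := by fun_prop
  have hdper : Function.Periodic d P := fun t => by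
    simp only [hd, ← add_assoc, ← sub_sub, hper _, hper.sub_eq]
  have hdodd : ∀ t, d (-t) = -d t := fun t => by
    simp only [hd, sub_neg_eq_add, ← sub_eq_add_neg]; ring
  have h1 : expConv η f (c - e) = ∫ y, Real.exp (-(η * |y|)) * f (c - e + y) := by
    rw [expConv, ← integral_neg_eq_self]
    simp
  have hb2 : BddMeas fun y => f (c - e + y) := hb.comp (by fun_prop)
  have h2 : expConv η f (c + e) - expConv η f (c - e) = ∫ y, Real.exp (-(η * |y|)) * d (e - y) := by
    rw [h1, expConv, ← integral_sub ((hb.comp_sub _).integrable_exp_mul hη) (hb2.integrable_exp_mul hη)]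
    congr 1; ext y
    rw [← mul_sub]; simp only [hd]
    congr 3 <;> ring
  have hdper' : Function.Periodic (fun y => d (e - y)) P := fun y => by
    show d (e - (y + P)) = d (e - y)
    rw [← sub_sub, hdper.sub_eq]
  rw [h2, integral_exp_mul_periodic hP (g := fun y => d (e - y)) (by fun_prop)
    (bddMeas_of_periodic hP (by fun_prop) hdper') hdper' hη]
  have h3 : Function.Periodic (fun y => perExp P η y * d (e - y)) P := fun y => by
    show perExp P η (y + P) * d (e - (y + P)) = perExp P η y * d (e - y)
    rw [perExp_periodic P η y]; congr 1; exact hdper' y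
  have h4 := h3.intervalIntegral_add_eq 0 (e - P / 2)
  rw [zero_add, show e - P / 2 + P = e + P / 2 by ring] at h4
  rw [h4]
  have h5 := intervalIntegral.integral_comp_sub_left (a := -(P / 2)) (b := P / 2)
      (fun y => perExp P η y * d (e - y)) e
  rw [sub_neg_eq_add] at h5
  rw [← h5]
  simp only [sub_sub_cancel]
  have hc1 : Continuous fun t => perExp P η (e - t) * d t := by fun_prop
  rw [← intervalIntegral.integral_add_adjacent_intervals (b := 0)
    (hc1.intervalIntegrable _ _) (hc1.intervalIntegrable _ _)]
  have h6 := intervalIntegral.integral_comp_neg (a := 0) (b := P / 2)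
    (fun t => perExp P η (e - t) * d t)
  rw [neg_zero] at h6
  rw [← h6, ← intervalIntegral.integral_add
    (Continuous.intervalIntegrable (by fun_prop) _ _) (Continuous.intervalIntegrable (by fun_prop) _ _)]
  congr 1; ext t
  rw [hdodd, sub_neg_eq_add]; simp only [hd]; ring

end Bell

section BellOperator

theorem integral_whithamMeasure_pos {f : ℝ → ℝ} (hi : Integrable f whithamMeasure)
    (hf : ∀ η, 0 < η → 0 < f η) : 0 < ∫ η, f η ∂whithamMeasure := by
  have hae : ∀ᵐ η ∂whithamMeasure, 0 < f η := ae_whithamMeasure_pos.mono hf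
  refine lt_of_le_of_ne (integral_nonneg_of_ae (hae.mono fun η h => h.le)) fun h0 => ?_
  have h1 := (integral_eq_zero_iff_of_nonneg_ae (hae.mono fun η h => h.le) hi).1 h0.symm
  have h2 : ∀ᵐ η ∂whithamMeasure, False := by
    filter_upwards [h1, hae] with η h h'
    exact h'.ne' h
  have h3 : whithamMeasure = 0 := by
    rw [← ae_eq_bot]; exact eventually_false_iff_eq_bot.1 h2
  have := integrable_inv_whithamMeasure.2
  rw [h3] at this
  simp at this

variable {P : ℝ} {f : ℝ → ℝ}

theorem Lop_sub_eq (hP : 0 < P) (hf : IsBell P f) (c e : ℝ) :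
    Lop whithamKernel f (c + e) - Lop whithamKernel f (c - e) =
      ∫ η, (expConv η f (c + e) - expConv η f (c - e)) ∂whithamMeasure := by
  rw [Lop_eq_expConv (hf.bddMeas hP), Lop_eq_expConv (hf.bddMeas hP),
    ← integral_sub (integrable_expConv (hf.bddMeas hP) _) (integrable_expConv (hf.bddMeas hP) _)]

theorem perExp_sub_nonneg (hP : 0 < P) {η : ℝ} (hη : 0 < η) {e t : ℝ} (he : 0 ≤ e)
    (he' : e ≤ P / 2) (ht : 0 ≤ t) (ht' : t ≤ P / 2) :
    0 ≤ perExp P η (e - t) - perExp P η (e + t) :=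
  sub_nonneg.2 (perExp_le hP hη (tri_sub_le_tri_add hP he he' ht ht'))

theorem expConv_mono (hP : 0 < P) (hf : IsBell P f) {η : ℝ} (hη : 0 < η) {c e : ℝ} (he : 0 ≤ e)
    (hc : e ≤ c) (hc' : c + e ≤ P / 2) : 0 ≤ expConv η f (c + e) - expConv η f (c - e) := by
  rw [expConv_sub_eq hP hf.continuous hf.periodic hη]
  refine intervalIntegral.integral_nonneg (by linarith) fun t ht => ?_
  exact mul_nonneg (perExp_sub_nonneg hP hη he (by linarith) ht.1 ht.2)
    (hf.symm_diff_nonneg hP (by linarith) (by linarith) ht.1 ht.2)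

theorem IsBell.lop (hP : 0 < P) (hf : IsBell P f) : IsBell P (Lop whithamKernel f) where
  continuous := continuous_Lop (hf.bddMeas hP)
  even := Lop_even hf.even
  periodic := Lop_periodic hf.periodic
  mono := fun x hx y hy hxy => by
    have h := Lop_sub_eq hP hf ((x + y) / 2) ((y - x) / 2)
    have h1 : 0 ≤ ∫ η, (expConv η f ((x + y) / 2 + (y - x) / 2) -
        expConv η f ((x + y) / 2 - (y - x) / 2)) ∂whithamMeasure := by
      refine integral_nonneg_of_ae (ae_whithamMeasure_pos.mono fun η hη => ?_)
      exact expConv_mono hP hf hη (by linarith) (by linarith [hx.1]) (by linarith [hy.2])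
    rw [← h] at h1
    rw [show (x + y) / 2 + (y - x) / 2 = y by ring, show (x + y) / 2 - (y - x) / 2 = x by ring] at h1
    linarith

theorem IsBell.eq_of_periodic (hP : 0 < P) (hf : IsBell P f) {Q : ℝ} (hQ : 0 < Q)
    (hQ' : Q < P) (hper : Function.Periodic f Q) : f 0 = f (P / 2) := by
  wlog hle : Q ≤ P / 2 generalizing Q
  · refine this (Q := P - Q) (by linarith) (by linarith) (fun x => ?_) (by linarith)
    rw [← hper, show x + (P - Q) + Q = x + P by ring, hf.periodic]
  have hc : ∀ x ∈ Set.Icc 0 Q, f x = f 0 := fun x hx => by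
    have h1 : f Q = f 0 := by simpa using hper 0
    refine le_antisymm ?_ (hf.zero_le hP x)
    rw [← h1]
    exact hf.mono ⟨hx.1, hx.2.trans hle⟩ ⟨hQ.le, hle⟩ hx.2
  obtain ⟨y, hy, hxy⟩ := hper.exists_mem_Ico₀ hQ (P / 2)
  rw [hxy, hc y ⟨hy.1, hy.2.le⟩]

theorem IsBell.lop_lt (hP : 0 < P) (hf : IsBell P f) (hlt : f 0 < f (P / 2)) {x y : ℝ}
    (hx : 0 ≤ x) (hxy : x < y) (hy : y ≤ P / 2) :
    Lop whithamKernel f x < Lop whithamKernel f y := by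
  have h := Lop_sub_eq hP hf ((x + y) / 2) ((y - x) / 2)
  rw [show (x + y) / 2 + (y - x) / 2 = y by ring, show (x + y) / 2 - (y - x) / 2 = x by ring] at h
  rw [← sub_pos, h]
  have hb := hf.bddMeas hP
  refine integral_whithamMeasure_pos ((integrable_expConv hb _).sub (integrable_expConv hb _))
    fun η hη => ?_
  have h1 := expConv_sub_eq hP hf.continuous hf.periodic hη ((x + y) / 2) ((y - x) / 2)
  rw [show (x + y) / 2 + (y - x) / 2 = y by ring, show (x + y) / 2 - (y - x) / 2 = x by ring] at h1
  rw [h1]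
  have hfc := hf.continuous
  have hw := continuous_perExp P η
  have hex : ∃ t ∈ Set.Ioo 0 (P / 2), 0 < f ((x + y) / 2 + t) - f ((x + y) / 2 - t) := by
    by_contra! hno
    have hz : ∀ t ∈ Set.Icc 0 (P / 2), f ((x + y) / 2 + t) = f ((x + y) / 2 - t) := by
      have : Set.EqOn (fun t => f ((x + y) / 2 + t)) (fun t => f ((x + y) / 2 - t))
          (closure (Set.Ioo 0 (P / 2))) := by
        refine Set.EqOn.closure (fun t ht => ?_) (by fun_prop) (by fun_prop)
        have := hf.symm_diff_nonneg hP (c := (x + y) / 2) (by linarith) (by linarith) ht.1.le ht.2.le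
        have := hno t ht
        linarith
      rw [closure_Ioo (by linarith)] at this
      exact this
    have hz' : ∀ t, f ((x + y) / 2 + t) = f ((x + y) / 2 - t) := by
      intro t
      obtain ⟨n, hn⟩ := exists_tri_eq P t
      have h2 := hz (tri P t) ⟨tri_nonneg P t, tri_le hP t⟩
      have e1 : ∀ s, f (s + (t - n * P)) = f (s + t) := fun s => by
        rw [← add_sub_assoc]; exact hf.periodic.sub_int_mul_eq n
      have e2 : ∀ s, f (s - (t - n * P)) = f (s - t) := fun s => by
        rw [show s - (t - n * P) = s - t + n * P by ring]; exact hf.periodic.int_mul n _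
      rw [hn] at h2
      rcases abs_choice (t - n * P) with h3 | h3
      · rw [h3, e1, e2] at h2; exact h2
      · rw [h3, sub_neg_eq_add, ← sub_eq_add_neg, e1, e2] at h2; exact h2.symm
    refine hlt.ne (hf.eq_of_periodic hP (Q := x + y) (by linarith) (by linarith) fun t => ?_)
    have := hz' ((x + y) / 2 + t)
    rw [show (x + y) / 2 + ((x + y) / 2 + t) = t + (x + y) by ring,
      show (x + y) / 2 - ((x + y) / 2 + t) = -t by ring, hf.even] at this
    exact this
  obtain ⟨t, ht, hpos⟩ := hex
  refine intervalIntegral.integral_pos (by linarith) (by fun_prop) (fun s hs => ?_) ⟨t, ⟨ht.1.le, ht.2.le⟩, ?_⟩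
  · exact mul_nonneg (perExp_sub_nonneg hP hη (by linarith) (by linarith) hs.1.le hs.2)
      (hf.symm_diff_nonneg hP (by linarith) (by linarith) hs.1.le hs.2)
  · exact mul_pos (sub_pos.2 (perExp_lt hP hη (tri_sub_lt_tri_add hP (by linarith) (by linarith)
      ht.1 ht.2))) hpos

/-- The Fourier multiplier of the Whitham operator, written through the kernel. -/
noncomputable def kernelSymbol (ξ : ℝ) : ℝ := ∫ y, whithamKernel y * Real.cos (ξ * y)

theorem kernelSymbol_zero : kernelSymbol 0 = 1 := by
  simp [kernelSymbol, integral_whithamKernel]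

theorem bddMeas_cos (ξ : ℝ) : BddMeas fun y => Real.cos (ξ * y) :=
  ⟨by fun_prop, 1, fun _ => Real.abs_cos_le_one _⟩

theorem bddMeas_sin (ξ : ℝ) : BddMeas fun y => Real.sin (ξ * y) :=
  ⟨by fun_prop, 1, fun _ => Real.abs_sin_le_one _⟩

theorem kernelSymbol_eq (ξ : ℝ) :
    Integrable (fun η => 2 * (η / (η ^ 2 + ξ ^ 2))) whithamMeasure ∧
    kernelSymbol ξ = ∫ η, 2 * (η / (η ^ 2 + ξ ^ 2)) ∂whithamMeasure := by
  have h := integral_whithamKernel_mul (bddMeas_cos ξ).1 (bddMeas_cos ξ).integrable_kernel_mul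
  have hi := integrable_integral_exp_mul (bddMeas_cos ξ).1 (bddMeas_cos ξ).integrable_kernel_mul
  have hae : (fun η => ∫ y, Real.exp (-(η * |y|)) * Real.cos (ξ * y)) =ᵐ[whithamMeasure]
      fun η => 2 * (η / (η ^ 2 + ξ ^ 2)) := by
    filter_upwards [ae_whithamMeasure_pos] with η hη
    exact integral_exp_neg_mul_abs_mul_cos hη ξ
  exact ⟨hi.congr hae, by rw [kernelSymbol, h, integral_congr_ae hae]⟩

theorem kernelSymbol_pos (ξ : ℝ) : 0 < kernelSymbol ξ := by
  rw [(kernelSymbol_eq ξ).2]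
  exact integral_whithamMeasure_pos (kernelSymbol_eq ξ).1 fun η hη => by positivity

theorem kernelSymbol_lt_one {ξ : ℝ} (hξ : ξ ≠ 0) : kernelSymbol ξ < 1 := by
  rw [(kernelSymbol_eq ξ).2, ← integrable_inv_whithamMeasure.2, ← sub_pos,
    ← integral_sub integrable_inv_whithamMeasure.1 (kernelSymbol_eq ξ).1]
  refine integral_whithamMeasure_pos (integrable_inv_whithamMeasure.1.sub (kernelSymbol_eq ξ).1)
    fun η hη => ?_
  have hξ2 : 0 < ξ ^ 2 := by positivity
  have : 2 / η - 2 * (η / (η ^ 2 + ξ ^ 2)) = 2 * ξ ^ 2 / (η * (η ^ 2 + ξ ^ 2)) := by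
    field_simp; ring
  rw [this]; positivity

theorem integral_kernel_mul_sin (ξ : ℝ) : ∫ y, whithamKernel y * Real.sin (ξ * y) = 0 := by
  have h := integral_neg_eq_self (fun y => whithamKernel y * Real.sin (ξ * y)) volume
  simp only [whithamKernel_neg, mul_neg, Real.sin_neg, integral_neg] at h
  linarith

theorem integral_Lop_mul_cos (hP : 0 < P) (hf : Continuous f) (hper : Function.Periodic f P)
    {ξ : ℝ} {n : ℤ} (hξ : ξ * P = n * (2 * π)) :
    ∫ x in (0:ℝ)..P, Lop whithamKernel f x * Real.cos (ξ * x) =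
      kernelSymbol ξ * ∫ x in (0:ℝ)..P, f x * Real.cos (ξ * x) := by
  obtain ⟨M, hM⟩ := (bddMeas_of_periodic hP hf hper).2
  have hswap : ∫ x in (0:ℝ)..P, Lop whithamKernel f x * Real.cos (ξ * x) =
      ∫ y, whithamKernel y * ∫ x in (0:ℝ)..P, f (x - y) * Real.cos (ξ * x) := by
    have hcomm := intervalIntegral_integral_swap (a := 0) (b := P) (μ := volume)
      (f := fun x y => whithamKernel y * (f (x - y) * Real.cos (ξ * x))) ?_
    · simp only [Lop_eq, ← integral_mul_const, mul_assoc]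
      rw [hcomm]
      simp only [intervalIntegral.integral_const_mul]
    · have : IsFiniteMeasure ((volume : Measure ℝ).restrict (Set.uIoc 0 P)) := by
        rw [Set.uIoc_of_le hP.le]; infer_instance
      have h1 : Integrable (fun z : ℝ × ℝ => (1:ℝ) * whithamKernel z.2)
          ((volume.restrict (Set.uIoc 0 P)).prod volume) :=
        Integrable.mul_prod (integrable_const (1:ℝ)) integrable_whithamKernel
      refine (h1.mul_bdd (c := M * 1)
        (g := fun z : ℝ × ℝ => f (z.1 - z.2) * Real.cos (ξ * z.1)) ?_ ?_).congr ?_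
      · exact Measurable.aestronglyMeasurable (by fun_prop)
      · refine Eventually.of_forall fun z => ?_
        rw [norm_mul]
        exact mul_le_mul (hM _) (Real.abs_cos_le_one _) (norm_nonneg _) ((abs_nonneg _).trans (hM 0))
      · exact Eventually.of_forall fun z => by simp [Function.uncurry]
  have hinner : ∀ y, ∫ x in (0:ℝ)..P, f (x - y) * Real.cos (ξ * x) =
      (∫ x in (0:ℝ)..P, f x * Real.cos (ξ * x)) * Real.cos (ξ * y) -
      (∫ x in (0:ℝ)..P, f x * Real.sin (ξ * x)) * Real.sin (ξ * y) := by
    intro y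
    have hp : Function.Periodic (fun x => f x * Real.cos (ξ * (x + y))) P := fun x => by
      show f (x + P) * Real.cos (ξ * (x + P + y)) = _
      rw [hper, show ξ * (x + P + y) = ξ * (x + y) + ξ * P by ring, hξ, Real.cos_add_int_mul_two_pi]
    have h1 := intervalIntegral.integral_comp_sub_right (a := 0) (b := P)
      (fun x => f x * Real.cos (ξ * (x + y))) y
    simp only [sub_add_cancel] at h1
    have h2 := hp.intervalIntegral_add_eq (0 - y) 0
    rw [zero_add, show 0 - y + P = P - y by ring] at h2
    rw [h1, h2, ← intervalIntegral.integral_mul_const, ← intervalIntegral.integral_mul_const,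
      ← intervalIntegral.integral_sub (Continuous.intervalIntegrable (by fun_prop) _ _)
        (Continuous.intervalIntegrable (by fun_prop) _ _)]
    congr 1; ext x
    rw [mul_add, Real.cos_add]; ring
  rw [hswap]
  simp only [hinner, mul_sub, mul_left_comm (whithamKernel _)]
  rw [integral_sub ((bddMeas_cos ξ).integrable_kernel_mul.const_mul _)
    ((bddMeas_sin ξ).integrable_kernel_mul.const_mul _), integral_const_mul, integral_const_mul,
    integral_kernel_mul_sin, mul_zero, sub_zero, mul_comm, kernelSymbol]

theorem integral_Lop_periodic (hP : 0 < P) (hf : Continuous f) (hper : Function.Periodic f P) :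
    ∫ x in (0:ℝ)..P, Lop whithamKernel f x = ∫ x in (0:ℝ)..P, f x := by
  have := integral_Lop_mul_cos hP hf hper (ξ := 0) (n := 0) (by simp)
  simpa [kernelSymbol_zero] using this

theorem integral_even_periodic {g : ℝ → ℝ} (hg : Continuous g)
    (hper : Function.Periodic g P) (heven : ∀ x, g (-x) = g x) :
    ∫ x in (0:ℝ)..P, g x = 2 * ∫ x in (0:ℝ)..(P / 2), g x := by
  rw [← intervalIntegral.integral_add_adjacent_intervals (b := P / 2)
    (hg.intervalIntegrable _ _) (hg.intervalIntegrable _ _)]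
  have h := intervalIntegral.integral_comp_sub_left (a := 0) (b := P / 2) g P
  rw [sub_zero, show P - P / 2 = P / 2 by ring] at h
  rw [← h]
  have h2 : (fun x => g (P - x)) = g := by
    ext x
    rw [← heven, neg_sub, hper.sub_eq]
  rw [h2]; ring

/-- Minus the first cosine coefficient of `f` over a period. -/
noncomputable def cosCoeff (P : ℝ) (f : ℝ → ℝ) : ℝ :=
  -∫ x in (0:ℝ)..P, f x * Real.cos (2 * π / P * x)

theorem cosCoeff_lop (hP : 0 < P) (hf : Continuous f) (hper : Function.Periodic f P) :
    cosCoeff P (Lop whithamKernel f) = kernelSymbol (2 * π / P) * cosCoeff P f := by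
  rw [cosCoeff, cosCoeff, integral_Lop_mul_cos hP hf hper (n := 1) (by field_simp; simp)]
  ring

theorem cosCoeff_eq (hP : 0 < P) (hf : Continuous f) (hper : Function.Periodic f P)
    (heven : ∀ x, f (-x) = f x) :
    cosCoeff P f =
      2 * ∫ x in (0:ℝ)..(P / 4), (f (P / 2 - x) - f x) * Real.cos (2 * π / P * x) := by
  have hs : ∀ x, Real.cos (2 * π / P * (x + P)) = Real.cos (2 * π / P * x) := fun x => by
    rw [show 2 * π / P * (x + P) = 2 * π / P * x + 2 * π by field_simp, Real.cos_add_two_pi]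
  have hs2 : ∀ x, Real.cos (2 * π / P * (P / 2 - x)) = -Real.cos (2 * π / P * x) := fun x => by
    rw [show 2 * π / P * (P / 2 - x) = π - 2 * π / P * x by field_simp, Real.cos_pi_sub]
  rw [cosCoeff, integral_even_periodic (P := P) (by fun_prop)
    (fun x => by simp only [hper x, hs]) (fun x => by simp only [heven x, mul_neg, Real.cos_neg]),
    ← intervalIntegral.integral_add_adjacent_intervals (b := P / 4)
    (Continuous.intervalIntegrable (by fun_prop) _ _) (Continuous.intervalIntegrable (by fun_prop) _ _)]
  have h := intervalIntegral.integral_comp_sub_left (a := 0) (b := P / 4)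
    (fun x => f x * Real.cos (2 * π / P * x)) (P / 2)
  rw [sub_zero, show P / 2 - P / 4 = P / 4 by ring] at h
  rw [← h]
  simp only [hs2]
  rw [← intervalIntegral.integral_add
    (Continuous.intervalIntegrable (by fun_prop) _ _) (Continuous.intervalIntegrable (by fun_prop) _ _),
    ← mul_neg, ← intervalIntegral.integral_neg]
  congr 2; ext x; ring

theorem cos_nonneg_of_le_quarter (hP : 0 < P) {x : ℝ} (hx : 0 ≤ x) (hx' : x ≤ P / 4) :
    0 ≤ Real.cos (2 * π / P * x) := by
  refine Real.cos_nonneg_of_neg_pi_div_two_le_of_le ?_ ?_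
  · have : 0 ≤ 2 * π / P * x := by positivity
    linarith [Real.pi_pos]
  · calc 2 * π / P * x ≤ 2 * π / P * (P / 4) := by gcongr
      _ = π / 2 := by field_simp; norm_num

theorem cosCoeff_mono (hP : 0 < P) {g : ℝ → ℝ} (hf : IsBell P f) (hg : IsBell P g) {r : ℝ}
    (h : ∀ x y, 0 ≤ x → x ≤ y → y ≤ P / 2 → f y - f x ≤ r * (g y - g x)) :
    cosCoeff P f ≤ r * cosCoeff P g := by
  have hfc := hf.continuous
  have hgc := hg.continuous
  rw [cosCoeff_eq hP hfc hf.periodic hf.even, cosCoeff_eq hP hgc hg.periodic hg.even,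
    mul_left_comm]
  refine mul_le_mul_of_nonneg_left ?_ zero_le_two
  rw [← intervalIntegral.integral_const_mul]
  refine intervalIntegral.integral_mono_on (by linarith) ?_ ?_ fun x hx => ?_
  · exact Continuous.intervalIntegrable (by fun_prop) _ _
  · exact Continuous.intervalIntegrable (by fun_prop) _ _
  rw [← mul_assoc]
  exact mul_le_mul_of_nonneg_right (h _ _ hx.1 (by linarith [hx.2]) (by linarith [hx.1]))
    (cos_nonneg_of_le_quarter hP hx.1 hx.2)

theorem cosCoeff_nonneg (hP : 0 < P) (hf : IsBell P f) : 0 ≤ cosCoeff P f := by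
  rw [cosCoeff_eq hP hf.continuous hf.periodic hf.even]
  refine mul_nonneg zero_le_two (intervalIntegral.integral_nonneg (by linarith) fun x hx => ?_)
  exact mul_nonneg (sub_nonneg.2 (hf.mono ⟨hx.1, by linarith [hx.2]⟩
    ⟨by linarith [hx.2], by linarith [hx.1]⟩ (by linarith [hx.2]))) (cos_nonneg_of_le_quarter hP hx.1 hx.2)

end BellOperator

section Coefficient

variable {P : ℝ} {f g : ℝ → ℝ}

theorem cosCoeff_add_mul (hf : Continuous f) (hg : Continuous g) (r : ℝ) :
    cosCoeff P (fun x => f x + r * g x) = cosCoeff P f + r * cosCoeff P g := by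
  unfold cosCoeff
  simp only [add_mul, mul_assoc]
  rw [intervalIntegral.integral_add (Continuous.intervalIntegrable (by fun_prop) _ _)
    (Continuous.intervalIntegrable (by fun_prop) _ _), intervalIntegral.integral_const_mul]
  ring

theorem cosCoeff_const (hP : 0 < P) (c : ℝ) : cosCoeff P (fun _ => c) = 0 := by
  rw [cosCoeff_eq hP continuous_const (fun _ => rfl) fun _ => rfl]; simp

theorem cosCoeff_sub_const (hP : 0 < P) (hf : Continuous f) (c : ℝ) :
    cosCoeff P (fun x => f x - c) = cosCoeff P f := by
  have := cosCoeff_add_mul (P := P) hf (continuous_const (y := c)) (-1)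
  rw [cosCoeff_const hP] at this
  simpa [sub_eq_add_neg] using this

theorem abs_cosCoeff_sub_le (hP : 0 < P) (hf : Continuous f) (hg : Continuous g) {M : ℝ}
    (hM : ∀ x, |f x - g x| ≤ M) : |cosCoeff P f - cosCoeff P g| ≤ P * M := by
  unfold cosCoeff
  rw [neg_sub_neg, abs_sub_comm, ← intervalIntegral.integral_sub
    (Continuous.intervalIntegrable (by fun_prop) _ _)
    (Continuous.intervalIntegrable (by fun_prop) _ _), ← Real.norm_eq_abs]
  have := intervalIntegral.norm_integral_le_of_norm_le_const (a := 0) (b := P) (C := M)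
    (f := fun x => f x * Real.cos (2 * π / P * x) - g x * Real.cos (2 * π / P * x)) fun x _ => by
      rw [← sub_mul, norm_mul]
      calc _ ≤ M * 1 := mul_le_mul (hM x) (Real.abs_cos_le_one _) (abs_nonneg _)
            ((abs_nonneg _).trans (hM x))
        _ = M := mul_one M
  rw [sub_zero, abs_of_pos hP] at this
  linarith

theorem cosCoeff_le (hP : 0 < P) (hf : Continuous f) (h0 : ∀ x, 0 ≤ f x) (h1 : ∀ x, f x ≤ 1) :
    cosCoeff P f ≤ P := by
  have := abs_cosCoeff_sub_le hP hf (continuous_const (y := (0:ℝ))) (M := 1) fun x => by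
    rw [sub_zero, abs_of_nonneg (h0 x)]; exact h1 x
  rw [cosCoeff_const hP, sub_zero, mul_one] at this
  exact (le_abs_self _).trans this

theorem exists_cosCoeff_lower (hP : 0 < P) {ε C : ℝ} (hε : 0 < ε) (hC : 0 < C) :
    ∃ δ > 0, ∀ h : ℝ → ℝ, IsBell P h → (∀ x y, |h x - h y| ≤ C * √|x - y|) →
      ε ≤ h (P / 2) - h 0 → δ ≤ cosCoeff P h := by
  set d := min (P / 6) ((ε / (4 * C)) ^ 2) with hd
  have hd0 : 0 < d := by rw [hd]; positivity
  have hd6 : d ≤ P / 6 := min_le_left _ _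
  refine ⟨d * (ε / 2), by positivity, fun h hb hmod hh => ?_⟩
  have hc := hb.continuous
  rw [cosCoeff_eq hP hc hb.periodic hb.even]
  have hint : ∀ a b, IntervalIntegrable
      (fun x => (h (P / 2 - x) - h x) * Real.cos (2 * π / P * x)) volume a b :=
    fun a b => Continuous.intervalIntegrable (by fun_prop) _ _
  rw [← intervalIntegral.integral_add_adjacent_intervals (b := d) (hint _ _) (hint _ _)]
  have h1 : 0 ≤ ∫ x in d..(P / 4), (h (P / 2 - x) - h x) * Real.cos (2 * π / P * x) := by
    refine intervalIntegral.integral_nonneg (by linarith) fun x hx => ?_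
    have hx0 : 0 ≤ x := hd0.le.trans hx.1
    exact mul_nonneg (sub_nonneg.2 (hb.mono ⟨hx0, by linarith [hx.2]⟩
      ⟨by linarith [hx.2], by linarith⟩ (by linarith [hx.2]))) (cos_nonneg_of_le_quarter hP hx0 hx.2)
  have h2 : ∫ _ in (0:ℝ)..d, ε / 2 * (1 / 2) ≤
      ∫ x in (0:ℝ)..d, (h (P / 2 - x) - h x) * Real.cos (2 * π / P * x) := by
    refine intervalIntegral.integral_mono_on hd0.le (by simp) (hint _ _) fun x hx => ?_
    have hsq : √x ≤ ε / (4 * C) := by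
      rw [← Real.sqrt_sq (show 0 ≤ ε / (4 * C) by positivity)]
      exact Real.sqrt_le_sqrt (hx.2.trans (min_le_right _ _))
    have hCs : C * √x ≤ ε / 4 := by
      calc C * √x ≤ C * (ε / (4 * C)) := by gcongr
        _ = ε / 4 := by field_simp
    have e1 := hmod (P / 2) (P / 2 - x)
    have e2 := hmod x 0
    rw [sub_sub_cancel, abs_of_nonneg hx.1] at e1
    rw [sub_zero, abs_of_nonneg hx.1] at e2
    have e1' := (abs_le.1 e1).2
    have e2' := (abs_le.1 e2).2
    have hcos : 1 / 2 ≤ Real.cos (2 * π / P * x) := by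
      rw [← Real.cos_pi_div_three]
      refine Real.cos_le_cos_of_nonneg_of_le_pi ?_ (by linarith [Real.pi_pos]) ?_
      · have := hx.1; positivity
      · calc 2 * π / P * x ≤ 2 * π / P * (P / 6) := by gcongr; exact hx.2.trans hd6
          _ = π / 3 := by field_simp; norm_num
    exact mul_le_mul (by linarith) hcos (by norm_num) (by linarith)
  rw [intervalIntegral.integral_const, smul_eq_mul, sub_zero] at h2
  nlinarith

theorem isCompact_of_modulus {α : Type*} [MetricSpace α] [CompactSpace α] {A : Set C(α, ℝ)}
    (hA : IsClosed A) {M : ℝ} (hM : ∀ f ∈ A, ∀ x, f x ∈ Set.Icc (-M) M) {b : ℝ → ℝ}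
    (hb : Tendsto b (nhds 0) (nhds 0)) (hmod : ∀ f ∈ A, ∀ x y, |f x - f y| ≤ b (dist x y)) :
    IsCompact A := by
  have hcomp : IsCompact ((ContinuousMap.isometryEquivBoundedOfCompact α ℝ).toHomeomorph.symm ⁻¹' A) := by
    refine BoundedContinuousFunction.arzela_ascoli₂ (Set.Icc (-M) M) isCompact_Icc _
      (hA.preimage (Homeomorph.continuous _)) (fun f x hf => hM _ hf x) ?_
    refine Metric.equicontinuous_of_continuity_modulus b hb _ fun x y f => ?_
    exact hmod _ f.2 x y
  rwa [Homeomorph.isCompact_preimage] at hcomp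

theorem abs_sqrt_sub_sqrt_le {p q : ℝ} (hp : 0 ≤ p) (hq : 0 ≤ q) : |√p - √q| ≤ √|p - q| := by
  have h1 := Real.sqrt_nonneg p
  have h2 := Real.sqrt_nonneg q
  refine Real.le_sqrt_of_sq_le ?_
  rw [sq_abs]
  have e : p - q = (√p - √q) * (√p + √q) := by
    nlinarith [Real.sq_sqrt hp, Real.sq_sqrt hq]
  rw [e, abs_mul, abs_of_nonneg (add_nonneg h1 h2), ← sq_abs, sq]
  refine mul_le_mul_of_nonneg_left ?_ (abs_nonneg _)
  rw [abs_le]; constructor <;> linarith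

end Coefficient

section Profile

variable {P : ℝ}

/-- The right-hand side of the profile equation `(a + G)² = a² + (LG - LG(0))`, solved for `G`. -/
noncomputable def profileStep (a : ℝ) (G : ℝ → ℝ) (x : ℝ) : ℝ :=
  √(a ^ 2 + (Lop whithamKernel G x - Lop whithamKernel G 0)) - a

theorem IsBell.lop_sub_nonneg {G : ℝ → ℝ} (hP : 0 < P) (hG : IsBell P G) (x : ℝ) :
    0 ≤ Lop whithamKernel G x - Lop whithamKernel G 0 :=
  sub_nonneg.2 ((hG.lop hP).zero_le hP x)

theorem profileStep_zero {a : ℝ} (ha : 0 ≤ a) (G : ℝ → ℝ) : profileStep a G 0 = 0 := by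
  simp [profileStep, Real.sqrt_sq ha]

theorem IsBell.profileStep {G : ℝ → ℝ} (hP : 0 < P) (hG : IsBell P G) (a : ℝ) :
    IsBell P (profileStep a G) where
  continuous := by
    have := (hG.lop hP).continuous
    unfold _root_.profileStep
    fun_prop
  even x := by simp only [_root_.profileStep, (hG.lop hP).even]
  periodic x := by simp only [_root_.profileStep, (hG.lop hP).periodic x]
  mono := fun x hx y hy hxy => by
    have := (hG.lop hP).mono hx hy hxy
    unfold _root_.profileStep
    gcongr

theorem abs_Lop_sub_le_of_le_one {G : ℝ → ℝ} (hP : 0 < P) (hG : IsBell P G) (h0 : G 0 = 0)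
    (h1 : ∀ x, G x ≤ 1) (x y : ℝ) :
    |Lop whithamKernel G x - Lop whithamKernel G y| ≤ 64 * √|x - y| := by
  have := abs_Lop_sub_le hG.continuous.measurable (M := 1) (fun z => by
    rw [abs_of_nonneg (h0 ▸ hG.zero_le hP z)]; exact h1 z) x y
  rwa [mul_one] at this

theorem lop_sub_le_one {G : ℝ → ℝ} (hP : 0 < P) (hG : IsBell P G) (h0 : G 0 = 0)
    (h1 : ∀ x, G x ≤ 1) (x : ℝ) : Lop whithamKernel G x - Lop whithamKernel G 0 ≤ 1 := by
  have hn : ∀ z, 0 ≤ G z := fun z => h0 ▸ hG.zero_le hP z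
  have e1 := abs_Lop_le hG.continuous.measurable (M := 1) (fun z => by
    rw [abs_of_nonneg (hn z)]; exact h1 z) x
  have e2 := Lop_nonneg hn 0
  have := (abs_le.1 e1).2
  linarith

theorem profileStep_le_one {G : ℝ → ℝ} (hP : 0 < P) (hG : IsBell P G) (h0 : G 0 = 0)
    (h1 : ∀ x, G x ≤ 1) {a : ℝ} (ha : 0 ≤ a) (x : ℝ) : profileStep a G x ≤ 1 := by
  have := lop_sub_le_one hP hG h0 h1 x
  rw [profileStep, sub_le_iff_le_add, Real.sqrt_le_left (by linarith)]
  nlinarith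

theorem abs_profileStep_sub_le {G : ℝ → ℝ} (hP : 0 < P) (hG : IsBell P G) (h0 : G 0 = 0)
    (h1 : ∀ x, G x ≤ 1) (a x y : ℝ) :
    |profileStep a G x - profileStep a G y| ≤ 8 * √√|x - y| := by
  unfold profileStep
  rw [sub_sub_sub_cancel_right]
  have n1 := hG.lop_sub_nonneg hP x
  have n2 := hG.lop_sub_nonneg hP y
  refine (abs_sqrt_sub_sqrt_le (by positivity) (by positivity)).trans ?_
  rw [add_sub_add_left_eq_sub, sub_sub_sub_cancel_right]
  refine (Real.sqrt_le_sqrt (abs_Lop_sub_le_of_le_one hP hG h0 h1 x y)).trans_eq ?_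
  rw [Real.sqrt_mul (by norm_num), show (64:ℝ) = 8 ^ 2 by norm_num, Real.sqrt_sq (by norm_num)]

theorem cosCoeff_profileStep {G : ℝ → ℝ} (hP : 0 < P) (hG : IsBell P G)
    (a : ℝ) : kernelSymbol (2 * π / P) * cosCoeff P G ≤
      2 * √(a ^ 2 + (Lop whithamKernel G (P / 2) - Lop whithamKernel G 0)) *
        cosCoeff P (profileStep a G) := by
  rw [← cosCoeff_lop hP hG.continuous hG.periodic]
  refine cosCoeff_mono hP (hG.lop hP) (hG.profileStep hP a) fun x y hx hxy hy => ?_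
  unfold profileStep
  rw [sub_sub_sub_cancel_right]
  set p := a ^ 2 + (Lop whithamKernel G y - Lop whithamKernel G 0)
  set q := a ^ 2 + (Lop whithamKernel G x - Lop whithamKernel G 0)
  have n1 := hG.lop_sub_nonneg hP x
  have n2 := hG.lop_sub_nonneg hP y
  have hq : 0 ≤ q := by positivity
  have hp : 0 ≤ p := by positivity
  have hqp : q ≤ p := by
    have := (hG.lop hP).mono ⟨hx, hxy.trans hy⟩ ⟨hx.trans hxy, hy⟩ hxy
    simp only [p, q]; linarith
  have hpm : p ≤ a ^ 2 + (Lop whithamKernel G (P / 2) - Lop whithamKernel G 0) := by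
    have := (hG.lop hP).le_half hP y
    simp only [p]; linarith
  have e : Lop whithamKernel G y - Lop whithamKernel G x = (√p + √q) * (√p - √q) := by
    have h1 := Real.sq_sqrt hp
    have h2 := Real.sq_sqrt hq
    have : p - q = Lop whithamKernel G y - Lop whithamKernel G x := by simp only [p, q]; ring
    rw [← this]; nlinarith
  rw [e]
  have s1 := Real.sqrt_le_sqrt hqp
  have s2 := Real.sqrt_le_sqrt hpm
  exact mul_le_mul_of_nonneg_right (by linarith) (by linarith)

theorem exists_cosCoeff_profileStep_ge (hP : 0 < P) {A : ℝ} (hA0 : 0 ≤ A)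
    (hA : A < kernelSymbol (2 * π / P) / 2) : ∃ δ₀ > 0, ∀ δ ≤ δ₀, ∀ G : ℝ → ℝ, IsBell P G → G 0 = 0 →
      (∀ x, G x ≤ 1) → δ ≤ cosCoeff P G → ∀ a, 0 ≤ a → a ≤ A → δ ≤ cosCoeff P (profileStep a G) := by
  set m := kernelSymbol (2 * π / P) with hm
  have hm0 : 0 < m := kernelSymbol_pos _
  have hm1 : m < 1 := kernelSymbol_lt_one (by positivity)
  obtain ⟨δ₁, hδ₁, hlow⟩ := exists_cosCoeff_lower hP (ε := m ^ 2 / 4 - A ^ 2) (C := 64)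
    (by nlinarith) (by norm_num)
  refine ⟨δ₁ / 3, by positivity, fun δ hδ G hG h0 h1 hδG a ha haA => ?_⟩
  have hstep := cosCoeff_profileStep hP hG a
  rw [← hm] at hstep
  have hc0 : 0 ≤ cosCoeff P (profileStep a G) := cosCoeff_nonneg hP (hG.profileStep hP a)
  set H := Lop whithamKernel G (P / 2) - Lop whithamKernel G 0 with hH
  have hH1 : H ≤ 1 := lop_sub_le_one hP hG h0 h1 _
  rcases le_total H (m ^ 2 / 4 - A ^ 2) with h | h
  · have : √(a ^ 2 + H) ≤ m / 2 := by
      rw [Real.sqrt_le_left (by positivity)]; nlinarith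
    have : m * cosCoeff P G ≤ m * cosCoeff P (profileStep a G) :=
      hstep.trans (mul_le_mul_of_nonneg_right (by linarith) hc0)
    exact hδG.trans (le_of_mul_le_mul_left this hm0)
  · have h2 := hlow _ (hG.lop hP) (abs_Lop_sub_le_of_le_one hP hG h0 h1) h
    rw [cosCoeff_lop hP hG.continuous hG.periodic] at h2
    have : √(a ^ 2 + H) ≤ 3 / 2 := by
      rw [Real.sqrt_le_left (by positivity)]; nlinarith
    have : m * cosCoeff P G ≤ 3 * cosCoeff P (profileStep a G) :=
      hstep.trans (mul_le_mul_of_nonneg_right (by linarith) hc0)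
    linarith

/-- Extension of a function on the half period to an even periodic function. -/
noncomputable def triExt (hP : 0 < P) (g : C(Set.Icc (0:ℝ) (P / 2), ℝ)) (x : ℝ) : ℝ :=
  g ⟨tri P x, tri_nonneg P x, tri_le hP x⟩

theorem triExt_apply (hP : 0 < P) (g : C(Set.Icc (0:ℝ) (P / 2), ℝ)) {x : ℝ}
    (hx : x ∈ Set.Icc 0 (P / 2)) : triExt hP g x = g ⟨x, hx⟩ := by
  unfold triExt
  congr 1; exact Subtype.ext (tri_eq hP hx.1 hx.2)

theorem continuous_triExt (hP : 0 < P) (g : C(Set.Icc (0:ℝ) (P / 2), ℝ)) :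
    Continuous (triExt hP g) :=
  g.continuous.comp (Continuous.subtype_mk (continuous_tri P) _)

theorem periodic_triExt (hP : 0 < P) (g : C(Set.Icc (0:ℝ) (P / 2), ℝ)) :
    Function.Periodic (triExt hP g) P := fun x => by simp only [triExt, tri_periodic P x]

theorem triExt_neg (hP : 0 < P) (g : C(Set.Icc (0:ℝ) (P / 2), ℝ)) (x : ℝ) :
    triExt hP g (-x) = triExt hP g x := by simp only [triExt, tri_neg]

theorem isBell_triExt (hP : 0 < P) {g : C(Set.Icc (0:ℝ) (P / 2), ℝ)} (hg : Monotone g) :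
    IsBell P (triExt hP g) where
  continuous := continuous_triExt hP g
  even := triExt_neg hP g
  periodic := periodic_triExt hP g
  mono := fun x hx y hy hxy => by
    rw [triExt_apply hP g hx, triExt_apply hP g hy]; exact hg hxy

theorem abs_triExt_sub_le (hP : 0 < P) (g g' : C(Set.Icc (0:ℝ) (P / 2), ℝ)) (x : ℝ) :
    |triExt hP g x - triExt hP g' x| ≤ dist g g' := by
  rw [← Real.dist_eq]; exact ContinuousMap.dist_apply_le_dist _

theorem bddMeas_triExt (hP : 0 < P) (g : C(Set.Icc (0:ℝ) (P / 2), ℝ)) : BddMeas (triExt hP g) :=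
  bddMeas_of_periodic hP (continuous_triExt hP g) (periodic_triExt hP g)

/-- The Whitham operator acting on profiles over the half period. -/
noncomputable def lopHalf (hP : 0 < P) (g : C(Set.Icc (0:ℝ) (P / 2), ℝ)) :
    C(Set.Icc (0:ℝ) (P / 2), ℝ) where
  toFun x := Lop whithamKernel (triExt hP g) x
  continuous_toFun := (continuous_Lop (bddMeas_triExt hP g)).comp continuous_subtype_val

theorem continuous_lopHalf (hP : 0 < P) : Continuous (lopHalf hP) := by
  refine LipschitzWith.continuous (K := 1) (LipschitzWith.of_dist_le_mul fun g g' => ?_)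
  rw [NNReal.coe_one, one_mul, ContinuousMap.dist_le dist_nonneg]
  intro x
  show |Lop whithamKernel (triExt hP g) x - Lop whithamKernel (triExt hP g') x| ≤ _
  rw [← Lop_sub (bddMeas_triExt hP g) (bddMeas_triExt hP g')]
  exact abs_Lop_le ((bddMeas_triExt hP g).sub (bddMeas_triExt hP g')).1 (abs_triExt_sub_le hP g g') x

/-- The admissible profiles for the fixed point argument. -/
def profileSet (hP : 0 < P) (δ : ℝ) : Set C(Set.Icc (0:ℝ) (P / 2), ℝ) :=
  {g | triExt hP g 0 = 0 ∧ Monotone g ∧ (∀ x, g x ≤ 1) ∧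
    (∀ x y, |g x - g y| ≤ 8 * √√(dist x y)) ∧ δ ≤ cosCoeff P (triExt hP g)}

theorem isClosed_profileSet (hP : 0 < P) (δ : ℝ) : IsClosed (profileSet hP δ) := by
  have hev : ∀ x, Continuous fun g : C(Set.Icc (0:ℝ) (P / 2), ℝ) => g x :=
    fun x => continuous_eval_const x
  have hcos : Continuous fun g => cosCoeff P (triExt hP g) := by
    refine LipschitzWith.continuous (K := ⟨P, hP.le⟩) (LipschitzWith.of_dist_le_mul fun g g' => ?_)
    exact abs_cosCoeff_sub_le hP (continuous_triExt hP g) (continuous_triExt hP g')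
      (abs_triExt_sub_le hP g g')
  have hmono : IsClosed {g : C(Set.Icc (0:ℝ) (P / 2), ℝ) | Monotone g} := by
    have : {g : C(Set.Icc (0:ℝ) (P / 2), ℝ) | Monotone g} = ⋂ x, ⋂ y, ⋂ (_ : x ≤ y),
        {g : C(Set.Icc (0:ℝ) (P / 2), ℝ) | g x ≤ g y} := by
      ext g; simp only [Set.mem_iInter]; exact Iff.rfl
    rw [this]
    exact isClosed_iInter fun x => isClosed_iInter fun y => isClosed_iInter fun _ =>
      isClosed_le (hev x) (hev y)
  simp only [profileSet, Set.ofPred_and, Set.ofPred_forall]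
  refine (isClosed_eq (hev _) continuous_const).inter (hmono.inter (IsClosed.inter ?_ (IsClosed.inter ?_ ?_)))
  · exact isClosed_iInter fun x => isClosed_le (hev x) continuous_const
  · exact isClosed_iInter fun x => isClosed_iInter fun y =>
      isClosed_le ((hev x).sub (hev y)).abs continuous_const
  · exact isClosed_le continuous_const hcos

theorem convex_profileSet (hP : 0 < P) (δ : ℝ) : Convex ℝ (profileSet hP δ) := by
  rintro g ⟨h1, h2, h3, h4, h5⟩ g' ⟨k1, k2, k3, k4, k5⟩ a b ha hb hab
  have hext : triExt hP (a • g + b • g') = fun x => a * triExt hP g x + b * triExt hP g' x := rfl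
  refine ⟨?_, fun x y hxy => ?_, fun x => ?_, fun x y => ?_, ?_⟩
  · rw [hext]; simp only [h1, k1]; ring
  · exact add_le_add (mul_le_mul_of_nonneg_left (h2 hxy) ha) (mul_le_mul_of_nonneg_left (k2 hxy) hb)
  · show a * g x + b * g' x ≤ 1
    nlinarith [h3 x, k3 x]
  · show |a * g x + b * g' x - (a * g y + b * g' y)| ≤ _
    have e1 := abs_le.1 (h4 x y)
    have e2 := abs_le.1 (k4 x y)
    rw [abs_le]
    constructor <;> nlinarith
  · have c0 := continuous_triExt hP g
    have c1 := continuous_triExt hP g'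
    have e : cosCoeff P (triExt hP (a • g + b • g')) =
        a * cosCoeff P (triExt hP g) + b * cosCoeff P (triExt hP g') := by
      rw [hext, cosCoeff_add_mul (by fun_prop) c1]
      have := cosCoeff_add_mul (P := P) (continuous_const (y := (0:ℝ))) c0 a
      rw [cosCoeff_const hP] at this
      simp only [zero_add] at this
      rw [this]
    rw [e]
    have i1 := mul_le_mul_of_nonneg_left h5 ha
    have i2 := mul_le_mul_of_nonneg_left k5 hb
    have i3 : a * δ + b * δ = δ := by rw [← add_mul, hab, one_mul]
    linarith

theorem isCompact_profileSet (hP : 0 < P) (δ : ℝ) : IsCompact (profileSet hP δ) := by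
  refine isCompact_of_modulus (isClosed_profileSet hP δ) (M := 1) (b := fun t => 8 * √√t) ?_ ?_
    fun g hg => hg.2.2.2.1
  · rintro g ⟨h1, h2, h3, -, -⟩ x
    refine ⟨?_, h3 x⟩
    have hz : (0:ℝ) ∈ Set.Icc 0 (P / 2) := ⟨le_rfl, by linarith⟩
    rw [triExt_apply hP g hz] at h1
    have : g ⟨0, hz⟩ ≤ g x := h2 x.2.1
    linarith
  · have : Continuous fun t : ℝ => 8 * √√t := by fun_prop
    simpa using this.tendsto 0

theorem exists_profileSet_nonempty (hP : 0 < P) : ∃ δ₀ > 0, ∀ δ ≤ δ₀, (profileSet hP δ).Nonempty := by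
  set κ := min 1 (2 / P) with hκ
  have hκ0 : 0 < κ := by rw [hκ]; positivity
  have hκ1 : κ ≤ 1 := min_le_left _ _
  have hκP : κ * (P / 2) ≤ 1 := by
    calc κ * (P / 2) ≤ 2 / P * (P / 2) := by gcongr; exact min_le_right _ _
      _ = 1 := by field_simp
  let g : C(Set.Icc (0:ℝ) (P / 2), ℝ) := ⟨fun x => κ * x, by fun_prop⟩
  have hg : triExt hP g = fun x => κ * tri P x := rfl
  have hmono : Monotone g := fun x y hxy => mul_le_mul_of_nonneg_left hxy hκ0.le
  have hbd : ∀ x : Set.Icc (0:ℝ) (P / 2), g x ≤ 1 := fun x =>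
    (mul_le_mul_of_nonneg_left x.2.2 hκ0.le).trans hκP
  have hnn : ∀ x : Set.Icc (0:ℝ) (P / 2), 0 ≤ g x := fun x => mul_nonneg hκ0.le x.2.1
  have hsq : ∀ t s : ℝ, 0 ≤ t → s ≤ t → s ≤ 1 → s ≤ √t := by
    intro t s ht hst hs
    rcases le_or_gt s 0 with h | h
    · exact h.trans (Real.sqrt_nonneg _)
    · exact Real.le_sqrt_of_sq_le (by nlinarith)
  have hm1 : ∀ x y : Set.Icc (0:ℝ) (P / 2), |g x - g y| ≤ |(x:ℝ) - y| := fun x y => by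
    show |κ * x - κ * y| ≤ _
    rw [← mul_sub, abs_mul, abs_of_pos hκ0]
    exact mul_le_of_le_one_left (abs_nonneg _) hκ1
  have hm2 : ∀ x y : Set.Icc (0:ℝ) (P / 2), |g x - g y| ≤ 1 := fun x y => by
    rw [abs_le]; constructor <;> linarith [hbd x, hbd y, hnn x, hnn y]
  obtain ⟨δ₀, hδ₀, hlow⟩ := exists_cosCoeff_lower hP (ε := κ * (P / 2)) (C := 1) (by positivity) one_pos
  have hb := isBell_triExt hP hmono
  refine ⟨δ₀, hδ₀, fun δ hδ => ⟨g, ?_, hmono, hbd, fun x y => ?_, hδ.trans (hlow _ hb (fun x y => ?_) ?_)⟩⟩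
  · rw [hg]; simp [tri]
  · have h1 := hsq _ _ (abs_nonneg _) (hm1 x y) (hm2 x y)
    have h2 := hsq _ _ (Real.sqrt_nonneg _) h1 (hm2 x y)
    have h3 := Real.sqrt_nonneg √|(x:ℝ) - y|
    rw [Subtype.dist_eq, Real.dist_eq]
    linarith
  · rw [one_mul]
    refine hsq _ _ (abs_nonneg _) ?_ (hm2 _ _)
    exact (hm1 _ _).trans (abs_tri_sub_le P x y)
  · rw [hg]; simp only
    rw [tri_eq hP (x := P / 2) (by linarith) le_rfl]; simp [tri]

end Profile

section TruncatedProfile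

variable {P : ℝ}

theorem lop_zero_pos (hP : 0 < P) {G : ℝ → ℝ} (hG : IsBell P G) (h0 : G 0 = 0)
    (hpos : 0 < G (P / 2)) : 0 < Lop whithamKernel G 0 := by
  have hb := hG.bddMeas hP
  rw [Lop_eq_expConv hb]
  refine integral_whithamMeasure_pos (integrable_expConv hb 0) fun η hη => ?_
  have hc := hG.continuous
  refine integral_pos_of_integrable_nonneg_nonzero (x := P / 2) (by fun_prop)
    ((hb.comp_sub 0).integrable_exp_mul hη) (fun y => ?_) ?_
  · exact mul_nonneg (Real.exp_nonneg _) (h0 ▸ hG.zero_le hP _)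
  · rw [zero_sub, hG.even]
    exact (mul_pos (Real.exp_pos _) hpos).ne'

theorem half_pos_of_cosCoeff_pos (hP : 0 < P) {G : ℝ → ℝ} (hG : IsBell P G) (h0 : G 0 = 0)
    (hc : 0 < cosCoeff P G) : 0 < G (P / 2) := by
  refine lt_of_le_of_ne (h0 ▸ hG.zero_le hP _) fun h => ?_
  have : G = fun _ => 0 := by
    ext x
    exact le_antisymm ((hG.le_half hP x).trans_eq h.symm) (h0 ▸ hG.zero_le hP x)
  rw [this, cosCoeff_const hP] at hc
  exact lt_irrefl _ hc

theorem mean_identity (hP : 0 < P) {G : ℝ → ℝ} (hG : IsBell P G) {a : ℝ}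
    (heq : ∀ x, (a + G x) ^ 2 = a ^ 2 + (Lop whithamKernel G x - Lop whithamKernel G 0)) :
    0 ≤ 1 / 4 - Lop whithamKernel G 0 - a + a ^ 2 := by
  have hc := hG.continuous
  have hL := (hG.lop hP).continuous
  have h1 : 0 ≤ ∫ x in (0:ℝ)..P, (a + G x - 1 / 2) ^ 2 :=
    intervalIntegral.integral_nonneg hP.le fun x _ => sq_nonneg _
  have h2 : (fun x => (a + G x - 1 / 2) ^ 2) = fun x =>
      (Lop whithamKernel G x - G x) + (1 / 4 - Lop whithamKernel G 0 - a + a ^ 2) := by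
    ext x
    have := heq x
    nlinarith
  rw [h2, intervalIntegral.integral_add (Continuous.intervalIntegrable (by fun_prop) _ _)
    (Continuous.intervalIntegrable (by fun_prop) _ _), intervalIntegral.integral_sub
    (hL.intervalIntegrable _ _) (hc.intervalIntegrable _ _),
    integral_Lop_periodic hP hc hG.periodic, sub_self, zero_add, intervalIntegral.integral_const,
    sub_zero, smul_eq_mul] at h1
  exact nonneg_of_mul_nonneg_right h1 hP

/-- A solution of the profile equation with crest offset `a` and half speed `s`. -/
structure IsProfile (P a s : ℝ) (G : ℝ → ℝ) : Prop where
  bell : IsBell P G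
  zero : G 0 = 0
  le_one : ∀ x, G x ≤ 1
  half_pos : 0 < G (P / 2)
  a_nonneg : 0 ≤ a
  eq : ∀ x, (a + G x) ^ 2 = a ^ 2 + (Lop whithamKernel G x - Lop whithamKernel G 0)
  s_pos : 0 < s
  s_le : s ≤ 1 / 2
  speed : s * (1 - s) = Lop whithamKernel G 0 + a - a ^ 2

theorem exists_truncated_profile (hP : 0 < P) {lam : ℝ} (hl1 : lam ≤ 1) {A : ℝ}
    (hA0 : 0 ≤ A) (hA : A < kernelSymbol (2 * π / P) / 2) :
    ∃ G s, IsProfile P (min ((1 - lam) * s) A) s G := by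
  obtain ⟨δ₁, hδ₁, hstep⟩ := exists_cosCoeff_profileStep_ge hP hA0 hA
  obtain ⟨δ₂, hδ₂, hne⟩ := exists_profileSet_nonempty hP
  set δ := min δ₁ δ₂ with hδ
  have hδ0 : 0 < δ := lt_min hδ₁ hδ₂
  have hA1 : A ≤ 1 / 2 := by
    have := kernelSymbol_lt_one (ξ := 2 * π / P) (by positivity)
    linarith
  let al : ℝ → ℝ := fun s => min ((1 - lam) * s) A
  have halc : Continuous al := by fun_prop
  have hal0 : ∀ s, 0 ≤ s → 0 ≤ al s := fun s hs => le_min (mul_nonneg (by linarith) hs) hA0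
  have halA : ∀ s, al s ≤ A := fun s => min_le_right _ _
  have hz : (0:ℝ) ∈ Set.Icc 0 (P / 2) := ⟨le_rfl, by linarith⟩
  let z : Set.Icc (0:ℝ) (P / 2) := ⟨0, hz⟩
  have hT := continuous_lopHalf hP
  let Φ₁ : C(Set.Icc (0:ℝ) (P / 2), ℝ) × ℝ → C(Set.Icc (0:ℝ) (P / 2), ℝ) := fun p =>
    ⟨fun x => √(al p.2 ^ 2 + (lopHalf hP p.1 x - lopHalf hP p.1 z)) - al p.2, by fun_prop⟩
  have hΦ₁ : Continuous Φ₁ := by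
    refine ContinuousMap.continuous_of_continuous_uncurry _ ?_
    show Continuous fun q : (C(Set.Icc (0:ℝ) (P / 2), ℝ) × ℝ) × Set.Icc (0:ℝ) (P / 2) =>
      √(al q.1.2 ^ 2 + (lopHalf hP q.1.1 q.2 - lopHalf hP q.1.1 z)) - al q.1.2
    fun_prop
  let X : C(Set.Icc (0:ℝ) (P / 2), ℝ) × ℝ → ℝ := fun p =>
    1 / 4 - lopHalf hP p.1 z - al p.2 + al p.2 ^ 2
  have hX : Continuous X := by fun_prop
  let Φ : C(Set.Icc (0:ℝ) (P / 2), ℝ) × ℝ → C(Set.Icc (0:ℝ) (P / 2), ℝ) × ℝ := fun p =>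
    (Φ₁ p, 1 / 2 - √(X p))
  have hΦ : Continuous Φ := by fun_prop
  have hext : ∀ p, triExt hP (Φ₁ p) = profileStep (al p.2) (triExt hP p.1) := by
    intro p
    ext x
    show √(al p.2 ^ 2 + (Lop whithamKernel (triExt hP p.1) (tri P x) -
      Lop whithamKernel (triExt hP p.1) 0)) - al p.2 = _
    rw [comp_tri (Lop_periodic (periodic_triExt hP p.1)) (Lop_even (triExt_neg hP p.1))]
    rfl
  have hcoe : ∀ g : C(Set.Icc (0:ℝ) (P / 2), ℝ), ∀ x : Set.Icc (0:ℝ) (P / 2),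
      g x = triExt hP g x := fun g x => (triExt_apply hP g x.2).symm
  set S := profileSet hP δ ×ˢ Set.Icc (0:ℝ) (1 / 2) with hS
  have hbell : ∀ g ∈ profileSet hP δ, IsBell P (triExt hP g) ∧ ∀ x, triExt hP g x ≤ 1 :=
    fun g hg => ⟨isBell_triExt hP hg.2.1, fun x => hg.2.2.1 _⟩
  have hnn : ∀ g ∈ profileSet hP δ, 0 ≤ Lop whithamKernel (triExt hP g) 0 := fun g hg =>
    Lop_nonneg (fun x => by have := (hbell g hg).1.zero_le hP x; rwa [hg.1] at this) 0
  have hmaps : Set.MapsTo Φ S S := by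
    rintro ⟨g, s⟩ ⟨hg, hs⟩
    simp only at hg hs
    obtain ⟨hB, hB1⟩ := hbell g hg
    have ha0 := hal0 s hs.1
    have hF := hB.profileStep hP (al s)
    have hextp : triExt hP (Φ₁ (g, s)) = profileStep (al s) (triExt hP g) := hext (g, s)
    refine ⟨⟨?_, fun x y hxy => ?_, fun x => ?_, fun x y => ?_, ?_⟩, ?_, ?_⟩
    · show triExt hP (Φ₁ (g, s)) 0 = 0
      rw [hextp, profileStep_zero ha0]
    · show Φ₁ (g, s) x ≤ Φ₁ (g, s) y
      rw [hcoe, hcoe, hextp]; exact hF.mono x.2 y.2 hxy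
    · show Φ₁ (g, s) x ≤ 1
      rw [hcoe, hextp]; exact profileStep_le_one hP hB hg.1 hB1 ha0 _
    · show |Φ₁ (g, s) x - Φ₁ (g, s) y| ≤ _
      rw [hcoe, hcoe, hextp]; exact abs_profileStep_sub_le hP hB hg.1 hB1 _ _ _
    · show δ ≤ cosCoeff P (triExt hP (Φ₁ (g, s)))
      rw [hextp]
      exact hstep δ (min_le_left _ _) _ hB hg.1 hB1 hg.2.2.2.2 _ ha0 (halA s)
    · show 0 ≤ 1 / 2 - √(X (g, s))
      have : X (g, s) ≤ (1 / 2) ^ 2 := by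
        have h1 := hnn g hg
        have h2 := halA s
        show 1 / 4 - Lop whithamKernel (triExt hP g) 0 - al s + al s ^ 2 ≤ _
        nlinarith
      have := Real.sqrt_le_sqrt this
      rw [Real.sqrt_sq (by norm_num)] at this
      linarith
    · show 1 / 2 - √(X (g, s)) ≤ 1 / 2
      linarith [Real.sqrt_nonneg (X (g, s))]
  have hneS : S.Nonempty := (hne δ (min_le_right _ _)).prod ⟨0, by norm_num⟩
  obtain ⟨⟨g, s⟩, ⟨hg, hs⟩, hfix⟩ := exists_fixedPoint_of_compact_convex
    ((isCompact_profileSet hP δ).prod isCompact_Icc)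
    ((convex_profileSet hP δ).prod (convex_Icc _ _)) hneS hΦ.continuousOn hmaps
  simp only at hg hs
  obtain ⟨hB, hB1⟩ := hbell g hg
  set G := triExt hP g with hGdef
  have hfix1 : Φ₁ (g, s) = g := congrArg Prod.fst hfix
  have hfix2 : 1 / 2 - √(X (g, s)) = s := congrArg Prod.snd hfix
  have ha0 := hal0 s hs.1
  have hGfix : G = profileStep (al s) G := by
    rw [hGdef, ← hext (g, s), hfix1]
  have heq : ∀ x, (al s + G x) ^ 2 = al s ^ 2 + (Lop whithamKernel G x - Lop whithamKernel G 0) := by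
    intro x
    have h1 := hB.lop_sub_nonneg hP x
    have h2 : al s + G x = √(al s ^ 2 + (Lop whithamKernel G x - Lop whithamKernel G 0)) := by
      conv_lhs => rw [hGfix]
      unfold profileStep; ring
    rw [h2, Real.sq_sqrt (by positivity)]
  have hpos := half_pos_of_cosCoeff_pos hP hB hg.1 (hδ0.trans_le hg.2.2.2.2)
  have hL0 := lop_zero_pos hP hB hg.1 hpos
  have hX0 : 0 ≤ X (g, s) := mean_identity hP hB heq
  have hspeed : s * (1 - s) = Lop whithamKernel G 0 + al s - al s ^ 2 := by
    have h1 : (1 / 2 - s) ^ 2 = X (g, s) := by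
      rw [← Real.sq_sqrt hX0]; congr 1; linarith
    have h2 : X (g, s) = 1 / 4 - Lop whithamKernel G 0 - al s + al s ^ 2 := rfl
    rw [h2] at h1
    nlinarith
  refine ⟨G, s, hB, hg.1, hB1, hpos, ha0, heq, ?_, hs.2, hspeed⟩
  refine lt_of_le_of_ne hs.1 fun h => ?_
  rw [← h] at hspeed ha0
  have := halA 0
  nlinarith

theorem IsProfile.cosCoeff_sq {a s : ℝ} {G : ℝ → ℝ} (hP : 0 < P) (h : IsProfile P a s G) :
    cosCoeff P (fun x => G x ^ 2) = (kernelSymbol (2 * π / P) - 2 * a) * cosCoeff P G := by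
  have hc := h.bell.continuous
  have hL := (h.bell.lop hP).continuous
  have e : (fun x => G x ^ 2) = fun x =>
      (Lop whithamKernel G x - Lop whithamKernel G 0) + (-(2 * a)) * G x := by
    ext x
    have := h.eq x
    nlinarith
  rw [e, cosCoeff_add_mul (by fun_prop) hc, cosCoeff_sub_const hP hL,
    cosCoeff_lop hP hc h.bell.periodic]
  ring

theorem IsProfile.nonneg {a s : ℝ} {G : ℝ → ℝ} (hP : 0 < P) (h : IsProfile P a s G) (x : ℝ) :
    0 ≤ G x := h.zero ▸ h.bell.zero_le hP x

theorem IsProfile.isBell_sq {a s : ℝ} {G : ℝ → ℝ} (hP : 0 < P) (h : IsProfile P a s G) :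
    IsBell P (fun x => G x ^ 2) where
  continuous := by have := h.bell.continuous; fun_prop
  even x := by simp only [h.bell.even]
  periodic x := by simp only [h.bell.periodic x]
  mono := fun x hx y hy hxy =>
    pow_le_pow_left₀ (h.nonneg hP x) (h.bell.mono hx hy hxy) 2

theorem IsProfile.abs_sq_sub_le {a s : ℝ} {G : ℝ → ℝ} (hP : 0 < P) (h : IsProfile P a s G)
    (x y : ℝ) : |G x ^ 2 - G y ^ 2| ≤ 64 * √|x - y| := by
  refine le_trans ?_ (abs_Lop_sub_le_of_le_one hP h.bell h.zero h.le_one x y)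
  have hx := h.nonneg hP x
  have hy := h.nonneg hP y
  have ha := h.a_nonneg
  have e1 : G x ^ 2 - G y ^ 2 = (G x - G y) * (G x + G y) := by ring
  have e2 : Lop whithamKernel G x - Lop whithamKernel G y =
      (G x - G y) * (G x + G y + 2 * a) := by
    have := h.eq x
    have := h.eq y
    nlinarith
  rw [e1, e2, abs_mul, abs_mul, abs_of_nonneg (add_nonneg hx hy),
    abs_of_nonneg (show 0 ≤ G x + G y + 2 * a by positivity)]
  exact mul_le_mul_of_nonneg_left (by linarith) (abs_nonneg _)

theorem IsProfile.lop_zero_le {a s : ℝ} {G : ℝ → ℝ} (hP : 0 < P) (h : IsProfile P a s G) :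
    Lop whithamKernel G 0 ≤ G (P / 2) := by
  have := Lop_mono (h.bell.bddMeas hP) (BddMeas.const (G (P / 2))) (h.bell.le_half hP) 0
  rwa [Lop_const] at this

theorem exists_profile (hP : 0 < P) {lam : ℝ} (hl0 : 0 < lam) (hl1 : lam ≤ 1) :
    ∃ G s, IsProfile P ((1 - lam) * s) s G := by
  set m := kernelSymbol (2 * π / P) with hm
  have hm0 : 0 < m := kernelSymbol_pos _
  have hm1 : m < 1 := kernelSymbol_lt_one (by positivity)
  set ε := lam * (m / 4) * ((1 - m) / 2) with hε
  have hε0 : 0 < ε := by rw [hε]; have : 0 < 1 - m := by linarith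
                         positivity
  obtain ⟨δ, hδ, hlow⟩ := exists_cosCoeff_lower hP (ε := ε ^ 2) (C := 64) (by positivity) (by norm_num)
  set A := m / 2 - min (m / 4) (δ / (4 * P)) with hA
  have hmin0 : 0 < min (m / 4) (δ / (4 * P)) := by positivity
  have hA2 : A < m / 2 := by rw [hA]; linarith
  have hA1 : m / 4 ≤ A := by rw [hA]; linarith [min_le_left (m / 4) (δ / (4 * P))]
  obtain ⟨G, s, h⟩ := exists_truncated_profile hP hl1 (A := A) (by linarith) hA2
  rcases le_or_gt ((1 - lam) * s) A with hc | hc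
  · rw [min_eq_left hc] at h
    exact ⟨G, s, h⟩
  exfalso
  rw [min_eq_right hc.le] at h
  have hGε : G (P / 2) < ε := by
    by_contra! hge
    have h1 := hlow _ (h.isBell_sq hP) (h.abs_sq_sub_le hP) (by
      simp only [h.zero]
      have := pow_le_pow_left₀ hε0.le hge 2
      linarith)
    rw [h.cosCoeff_sq hP, ← hm] at h1
    have h2 : cosCoeff P G ≤ P := cosCoeff_le hP h.bell.continuous (h.nonneg hP) h.le_one
    have h3 : m - 2 * A ≤ δ / (2 * P) := by
      have e : δ / (2 * P) = 2 * (δ / (4 * P)) := by field_simp; norm_num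
      rw [e, hA]; linarith [min_le_right (m / 4) (δ / (4 * P))]
    have h4 : (m - 2 * A) * cosCoeff P G ≤ δ / (2 * P) * P :=
      mul_le_mul h3 h2 (cosCoeff_nonneg hP h.bell) (by positivity)
    have h5 : δ / (2 * P) * P = δ / 2 := by field_simp
    linarith
  have h6 : (s - A) * (1 - s - A) = Lop whithamKernel G 0 := by
    have := h.speed
    nlinarith
  have h7 := h.lop_zero_le hP
  have hs := h.s_pos
  have hs2 := h.s_le
  have h8 : lam * (m / 4) ≤ s - A := by
    have : A ≤ s := by nlinarith
    nlinarith
  have h9 : (1 - m) / 2 ≤ 1 - s - A := by linarith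
  have h10 : ε ≤ (s - A) * (1 - s - A) := by
    rw [hε]
    exact mul_le_mul h8 h9 (by linarith) (by nlinarith)
  linarith

end TruncatedProfile

section HolderHalf

theorem exp_symm_sub_le {x y z η : ℝ} (hx : 0 ≤ x) (hxy : x ≤ y) (hz : 4 * y < z) (hη : 0 < η) :
    Real.exp (-(η * (z - y))) + Real.exp (-(η * (z + y))) - Real.exp (-(η * (z - x)))
      - Real.exp (-(η * (z + x))) ≤
      64 * (y - x) * y / z ^ 2 * Real.exp (-(η * (z / 2))) := by
  have hy : 0 ≤ y := hx.trans hxy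
  have hz0 : 0 < z := by linarith
  have e1 : Real.exp (-(η * (z + y))) =
      Real.exp (-(η * (z - y))) * (Real.exp (-(η * (y - x))) * Real.exp (-(η * (y + x)))) := by
    rw [← Real.exp_add, ← Real.exp_add]; congr 1; ring
  have e2 : Real.exp (-(η * (z - x))) =
      Real.exp (-(η * (z - y))) * Real.exp (-(η * (y - x))) := by
    rw [← Real.exp_add]; congr 1; ring
  have e3 : Real.exp (-(η * (z + x))) =
      Real.exp (-(η * (z - y))) * Real.exp (-(η * (y + x))) := by
    rw [← Real.exp_add]; congr 1; ring
  have e4 : Real.exp (-(η * (z / 2))) =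
      Real.exp (-(η * (3 / 4 * z))) * Real.exp (η * z / 4) := by
    rw [← Real.exp_add]; congr 1; ring
  have b1 : Real.exp (-(η * (z - y))) ≤ Real.exp (-(η * (3 / 4 * z))) :=
    Real.exp_le_exp.2 (neg_le_neg (mul_le_mul_of_nonneg_left (by linarith) hη.le))
  have b2 : 1 - Real.exp (-(η * (y - x))) ≤ η * (y - x) := by
    linarith [Real.add_one_le_exp (-(η * (y - x)))]
  have b3 : 1 - Real.exp (-(η * (y + x))) ≤ η * (2 * y) := by
    have := mul_le_mul_of_nonneg_left (show y + x ≤ 2 * y by linarith) hη.le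
    linarith [Real.add_one_le_exp (-(η * (y + x)))]
  have b4 : 0 ≤ 1 - Real.exp (-(η * (y + x))) :=
    sub_nonneg.2 (Real.exp_le_one_iff.2 (neg_nonpos.2 (by positivity)))
  have b5 : η ^ 2 ≤ 32 / z ^ 2 * Real.exp (η * z / 4) := by
    have h := Real.quadratic_le_exp_of_nonneg (show 0 ≤ η * z / 4 by positivity)
    have : (η * z / 4) ^ 2 / 2 ≤ Real.exp (η * z / 4) := by
      have : 0 ≤ η * z / 4 := by positivity
      linarith
    rw [div_mul_eq_mul_div, le_div_iff₀ (by positivity)]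
    nlinarith
  have hyx : 0 ≤ y - x := sub_nonneg.2 hxy
  calc _ = Real.exp (-(η * (z - y))) *
        ((1 - Real.exp (-(η * (y - x)))) * (1 - Real.exp (-(η * (y + x))))) := by
        rw [e1, e2, e3]; ring
    _ ≤ Real.exp (-(η * (3 / 4 * z))) * ((η * (y - x)) * (η * (2 * y))) := by
        gcongr
        exact mul_nonneg (sub_nonneg.2 (Real.exp_le_one_iff.2 (neg_nonpos.2 (by positivity)))) b4
    _ = Real.exp (-(η * (3 / 4 * z))) * (2 * (y - x) * y) * η ^ 2 := by ring
    _ ≤ Real.exp (-(η * (3 / 4 * z))) * (2 * (y - x) * y) *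
        (32 / z ^ 2 * Real.exp (η * z / 4)) := by gcongr
    _ = _ := by rw [e4]; ring

theorem whithamKernel_symm_sub_le {x y z : ℝ} (hx : 0 ≤ x) (hxy : x ≤ y) (hz : 4 * y < z) :
    whithamKernel (y - z) + whithamKernel (y + z) - whithamKernel (x - z) - whithamKernel (x + z)
      ≤ 512 * (y - x) * y / (z ^ 2 * √z) := by
  have hy : 0 ≤ y := hx.trans hxy
  have hz0 : 0 < z := by linarith
  have hyx : 0 ≤ y - x := sub_nonneg.2 hxy
  have hK : ∀ w : ℝ, |w| < z → whithamKernel (w - z) = ∫ η, Real.exp (-(η * (z - w))) ∂whithamMeasure := by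
    intro w hw
    have := abs_lt.1 hw
    rw [whithamKernel_eq (by linarith), abs_sub_comm, abs_of_pos (by linarith)]
  have hK' : ∀ w : ℝ, |w| < z → whithamKernel (w + z) = ∫ η, Real.exp (-(η * (z + w))) ∂whithamMeasure := by
    intro w hw
    have := abs_lt.1 hw
    rw [whithamKernel_eq (by linarith), abs_of_pos (by linarith), add_comm]
  have hi : ∀ w : ℝ, 0 < w → Integrable (fun η => Real.exp (-(η * w))) whithamMeasure :=
    fun w hw => integrable_exp_whithamMeasure hw
  have hxa : |x| < z := by rw [abs_of_nonneg hx]; linarith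
  have hya : |y| < z := by rw [abs_of_nonneg hy]; linarith
  have i1 := hi (z - y) (by linarith)
  have i2 := hi (z + y) (by linarith)
  have i3 := hi (z - x) (by linarith)
  have i4 := hi (z + x) (by linarith)
  have i12 : Integrable (fun η => Real.exp (-(η * (z - y))) + Real.exp (-(η * (z + y))))
    whithamMeasure := i1.add i2
  have i123 : Integrable (fun η => Real.exp (-(η * (z - y))) + Real.exp (-(η * (z + y)))
    - Real.exp (-(η * (z - x)))) whithamMeasure := i12.sub i3
  rw [hK y hya, hK' y hya, hK x hxa, hK' x hxa, ← integral_add i1 i2,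
    ← integral_sub i12 i3, ← integral_sub i123 i4]
  have hz2 : (0:ℝ) < z / 2 := by linarith
  refine (integral_mono_ae (i123.sub i4)
    ((hi (z / 2) hz2).const_mul (64 * (y - x) * y / z ^ 2))
    (ae_whithamMeasure_pos.mono fun η hη => exp_symm_sub_le hx hxy hz hη)).trans ?_
  rw [integral_const_mul]
  have h1 : ∫ η, Real.exp (-(η * (z / 2))) ∂whithamMeasure ≤ 4 / √(z / 2) := by
    have := whithamKernel_le_inv_sqrt hz2
    rwa [whithamKernel_eq hz2.ne', abs_of_pos hz2] at this
  have h2 : 4 / √(z / 2) ≤ 8 / √z := by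
    rw [div_le_div_iff₀ (by positivity) (by positivity)]
    have : √z ≤ √(4 * (z / 2)) := Real.sqrt_le_sqrt (by linarith)
    rw [Real.sqrt_mul (by norm_num), show (4:ℝ) = 2 ^ 2 by norm_num, Real.sqrt_sq (by norm_num)] at this
    linarith
  calc _ ≤ 64 * (y - x) * y / z ^ 2 * (8 / √z) := by
        gcongr
        exact h1.trans h2
    _ = _ := by ring

/-- A function vanishing on `[-4 * y, 4 * y]` and growing like `√|z|` has a Lipschitz convolution. -/
theorem Lop_sub_le_of_zero {f : ℝ → ℝ} (hb : BddMeas f) (heven : ∀ x, f (-x) = f x)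
    (h0 : ∀ x, 0 ≤ f x) {M x y : ℝ} (hM : ∀ z, f z ≤ M * √|z|)
    (hx : 0 ≤ x) (hxy : x ≤ y) (hy : 0 < y) (hz : ∀ z, 0 < z → z ≤ 4 * y → f z = 0) :
    Lop whithamKernel f y - Lop whithamKernel f x ≤ 128 * M * (y - x) := by
  have hI : ∀ w : ℝ, Integrable fun z => whithamKernel (w - z) * f z := fun w => by
    have := ((hb.comp_sub w).integrable_kernel_mul).comp_sub_left w
    simpa using this
  have hI' : ∀ w : ℝ, Integrable fun z => whithamKernel (w + z) * f z := fun w => by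
    have := (hI w).comp_neg
    simpa [heven] using this
  have hL : ∀ w : ℝ, Lop whithamKernel f w = ∫ z in Set.Ioi (0:ℝ),
      (whithamKernel (w - z) + whithamKernel (w + z)) * f z := by
    intro w
    have e1 : ∫ z, whithamKernel (w + z) * f z = Lop whithamKernel f w := by
      rw [← integral_neg_eq_self]
      unfold Lop
      congr 1; ext z
      rw [heven, sub_eq_add_neg]
    have e2 := integral_comp_abs (f := fun z => (whithamKernel (w - z) + whithamKernel (w + z)) * f z)
    have e3 : (fun z : ℝ => (whithamKernel (w - |z|) + whithamKernel (w + |z|)) * f |z|) =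
        fun z => whithamKernel (w - z) * f z + whithamKernel (w + z) * f z := by
      ext z
      rcases abs_cases z with ⟨h, _⟩ | ⟨h, _⟩ <;> rw [h]
      · ring
      · rw [heven, sub_neg_eq_add, ← sub_eq_add_neg]; ring
    rw [e3, integral_add (hI w) (hI' w), e1] at e2
    change Lop whithamKernel f w + _ = _ at e2
    linarith
  have hJ : ∀ w : ℝ, IntegrableOn (fun z => (whithamKernel (w - z) + whithamKernel (w + z)) * f z)
      (Set.Ioi 0) := fun w => by
    have := ((hI w).add (hI' w)).integrableOn (s := Set.Ioi 0)
    refine this.congr_fun (fun z _ => ?_) measurableSet_Ioi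
    simp only [Pi.add_apply]; ring
  rw [hL y, hL x, ← integral_sub (hJ y) (hJ x)]
  have hM0 : 0 ≤ M := by
    have := (h0 1).trans (hM 1)
    simpa using this
  have hb2 : IntegrableOn (fun z : ℝ => 512 * M * (y - x) * y * z ^ (-2 : ℝ)) (Set.Ioi (4 * y)) :=
    (integrableOn_Ioi_rpow_of_lt (by norm_num) (by linarith)).const_mul _
  calc _ ≤ ∫ z in Set.Ioi (0:ℝ),
        (Set.Ioi (4 * y)).indicator (fun z : ℝ => 512 * M * (y - x) * y * z ^ (-2 : ℝ)) z := by
        refine setIntegral_mono_on ((hJ y).sub (hJ x))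
          ((integrable_indicator_iff measurableSet_Ioi).2 hb2).integrableOn measurableSet_Ioi ?_
        intro z hz0
        rw [Set.mem_Ioi] at hz0
        by_cases hzy : z ≤ 4 * y
        · rw [hz z hz0 hzy, Set.indicator_of_notMem (by simpa using hzy)]
          simp
        · push Not at hzy
          rw [Set.indicator_of_mem (by simpa using hzy)]
          have k := whithamKernel_symm_sub_le hx hxy hzy
          have hfz := hM z
          rw [abs_of_pos hz0] at hfz
          have hyx : 0 ≤ y - x := sub_nonneg.2 hxy
          have hs : 0 < √z := Real.sqrt_pos.2 hz0
          calc _ = (whithamKernel (y - z) + whithamKernel (y + z) - whithamKernel (x - z)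
                - whithamKernel (x + z)) * f z := by ring
            _ ≤ 512 * (y - x) * y / (z ^ 2 * √z) * f z := mul_le_mul_of_nonneg_right k (h0 z)
            _ ≤ 512 * (y - x) * y / (z ^ 2 * √z) * (M * √z) := by gcongr
            _ = _ := by
              rw [Real.rpow_neg hz0.le, Real.rpow_two]
              field_simp
    _ = ∫ z in Set.Ioi (4 * y), 512 * M * (y - x) * y * z ^ (-2 : ℝ) := by
        rw [setIntegral_indicator measurableSet_Ioi, Set.inter_eq_self_of_subset_right]
        exact Set.Ioi_subset_Ioi (by linarith)
    _ = 128 * M * (y - x) := by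
        rw [integral_const_mul, integral_Ioi_rpow_of_lt (by norm_num) (by linarith)]
        norm_num
        rw [Real.rpow_neg_one]
        field_simp
        ring

theorem Lop_sub_le_of_le_sqrt {f : ℝ → ℝ} (hb : BddMeas f) (heven : ∀ x, f (-x) = f x)
    (h0 : ∀ x, 0 ≤ f x) {M r x y : ℝ} (hM : ∀ z, f z ≤ M * √(max |z| r))
    (hx : 0 ≤ x) (hxy : x ≤ y) (hy : 0 < y) (hr : r ≤ y) :
    Lop whithamKernel f y - Lop whithamKernel f x ≤ 256 * M * √((y - x) * y) := by
  have hM0 : 0 ≤ M := by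
    have h := (h0 1).trans (hM 1)
    have : 0 < √(max |1| r) := Real.sqrt_pos.2 (by simp)
    exact nonneg_of_mul_nonneg_left h this
  have hyx : 0 ≤ y - x := sub_nonneg.2 hxy
  set m := M * √(4 * y) with hm
  have hm0 : 0 ≤ m := by positivity
  have hb1 : Measurable fun z => min (f z) m := hb.1.min measurable_const
  have hB : ∀ z, |min (f z) m| ≤ m := fun z => by
    rw [abs_of_nonneg (le_min (h0 z) hm0)]; exact min_le_right _ _
  have hb2 : BddMeas fun z => f z - min (f z) m := hb.sub ⟨hb1, m, hB⟩
  have hsm : ∀ z, 0 < z → z ≤ 4 * y → f z - min (f z) m = 0 := fun z hz hzy => by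
    rw [min_eq_left, sub_self]
    refine (hM z).trans ?_
    rw [hm, abs_of_pos hz]
    gcongr
    exact max_le hzy (by linarith)
  have h2 := Lop_sub_le_of_zero hb2 (fun z => by rw [heven]) (fun z => sub_nonneg.2 (min_le_left _ _))
    (M := M) (fun z => ?_) hx hxy hy hsm
  · have h1 := abs_Lop_sub_le hb1 hB y x
    rw [Lop_sub hb ⟨hb1, m, hB⟩, Lop_sub hb ⟨hb1, m, hB⟩] at h2
    rw [abs_of_nonneg hyx] at h1
    have h1' := (le_abs_self _).trans h1
    have e1 : 64 * m * √(y - x) = 128 * (M * √((y - x) * y)) := by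
      rw [hm, Real.sqrt_mul hyx, Real.sqrt_mul (by norm_num), show (4:ℝ) = 2 ^ 2 by norm_num,
        Real.sqrt_sq (by norm_num)]
      ring
    have e2 : M * (y - x) ≤ M * √((y - x) * y) := by
      gcongr
      apply Real.le_sqrt_of_sq_le
      nlinarith
    linarith
  · rcases lt_or_ge (4 * y) |z| with h | h
    · refine (sub_le_self _ (le_min (h0 z) hm0)).trans ((hM z).trans ?_)
      rw [max_eq_left (by linarith)]
    · rcases eq_or_ne z 0 with rfl | hz
      · rw [min_eq_left]
        · simp
        · refine (hM 0).trans ?_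
          rw [hm]; gcongr
          simp only [abs_zero]
          exact max_le (by linarith) (by linarith)
      · have : f z = f |z| := by rcases abs_cases z with ⟨h, _⟩ | ⟨h, _⟩ <;> simp [h, heven]
        rw [this, hsm |z| (abs_pos.2 hz) h]
        positivity

end HolderHalf

section CrestEstimates

variable {P s : ℝ} {G : ℝ → ℝ}

theorem IsProfile.sq_sub_sq {a : ℝ} (h : IsProfile P a s G) (x y : ℝ) :
    (G x - G y) * (G x + G y + 2 * a) = Lop whithamKernel G x - Lop whithamKernel G y := by
  linear_combination h.eq x - h.eq y

theorem IsProfile.le_sqrt_max (hP : 0 < P) (h : IsProfile P 0 s G) {r : ℝ} (hr : 0 < r)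
    (hr' : r ≤ P / 2) (z : ℝ) : G z ≤ 256 * √(max |z| r) := by
  have hb := h.bell.bddMeas hP
  have hpos : ∀ z : ℝ, 0 < √(max |z| r) := fun z => Real.sqrt_pos.2 (lt_max_of_lt_right hr)
  set S : Set ℝ := {M | 0 ≤ M ∧ ∀ z, G z ≤ M * √(max |z| r)} with hS
  have hne : S.Nonempty := by
    refine ⟨1 / √r, by positivity, fun z => (h.le_one z).trans ?_⟩
    rw [div_mul_eq_mul_div, le_div_iff₀ (Real.sqrt_pos.2 hr), one_mul, one_mul]
    exact Real.sqrt_le_sqrt (le_max_right _ _)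
  have hbdd : BddBelow S := ⟨0, fun M hM => hM.1⟩
  set M := sInf S with hMdef
  have hM0 : 0 ≤ M := le_csInf hne fun M hM => hM.1
  have hM : ∀ z, G z ≤ M * √(max |z| r) := fun z => by
    rw [← div_le_iff₀ (hpos z)]
    exact le_csInf hne fun M hM => (div_le_iff₀ (hpos z)).2 (hM.2 z)
  have hmem : √(256 * M) ∈ S := by
    refine ⟨Real.sqrt_nonneg _, fun z => ?_⟩
    set y := max (tri P z) r with hy
    have hy0 : 0 < y := lt_max_of_lt_right hr
    have hyP : y ≤ P / 2 := max_le (tri_le hP z) hr'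
    have h1 : G z ≤ G y := by
      rw [← h.bell.comp_tri z]
      exact h.bell.mono ⟨tri_nonneg P z, tri_le hP z⟩ ⟨hy0.le, hyP⟩ (le_max_left _ _)
    have h2 := Lop_sub_le_of_le_sqrt hb h.bell.even (h.nonneg hP) hM le_rfl hy0.le hy0
      (le_max_right _ _)
    have h3 := h.eq y
    rw [sub_zero, Real.sqrt_mul_self hy0.le] at h2
    have h4 : G y ≤ √(256 * M * y) := Real.le_sqrt_of_sq_le (by nlinarith)
    refine h1.trans (h4.trans ?_)
    rw [Real.sqrt_mul (by positivity)]
    gcongr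
    exact max_le_max (tri_le_abs P z) le_rfl
  have h5 : M ≤ √(256 * M) := csInf_le hbdd hmem
  have h6 : M ≤ 256 := by
    by_contra hc
    push Not at hc
    have := (Real.le_sqrt hM0 (by positivity)).1 h5
    nlinarith
  exact (hM z).trans (by gcongr)

theorem IsProfile.le_sqrt (hP : 0 < P) (h : IsProfile P 0 s G) (z : ℝ) : G z ≤ 256 * √|z| := by
  rcases eq_or_ne z 0 with rfl | hz
  · simp [h.zero]
  · have := h.le_sqrt_max hP (r := min |z| (P / 2)) (lt_min (abs_pos.2 hz) (by linarith))
      (min_le_right _ _) z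
    rwa [max_eq_left (min_le_left _ _)] at this

theorem IsProfile.lt (hP : 0 < P) {a : ℝ} (h : IsProfile P a s G) {x y : ℝ} (hx : 0 ≤ x)
    (hxy : x < y) (hy : y ≤ P / 2) : G x < G y := by
  have h1 := h.bell.lop_lt hP (h.zero.trans_lt h.half_pos) hx hxy hy
  have h2 := h.sq_sub_sq y x
  have := h.nonneg hP x
  have := h.nonneg hP y
  have := h.a_nonneg
  by_contra hc
  push Not at hc
  nlinarith

theorem perExp_sub_lower (hP : 0 < P) {x t η : ℝ} (hx : 0 < x) (hxP : x ≤ P / 4)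
    (ht : x / 2 ≤ t) (ht' : t ≤ x) (hη : 1 / x ≤ η) (hη' : η ≤ 2 / x) :
    Real.exp (-2) * (1 - Real.exp (-2)) / 4 ≤
      perExp P η (x / 4 - t) - perExp P η (x / 4 + t) := by
  have hη0 : 0 < η := lt_of_lt_of_le (by positivity) hη
  have h1 : 1 ≤ η * x := by rwa [div_le_iff₀ hx] at hη
  have h2 : η * x ≤ 2 := by rwa [le_div_iff₀ hx] at hη'
  have hq := one_sub_exp_pos (mul_pos hη0 hP)
  rw [show x / 4 - t = -(t - x / 4) by ring, perExp_neg, perExp_eq hP η (by linarith) (by linarith),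
    perExp_eq hP η (by linarith) (by linarith), ← sub_div, le_div_iff₀ hq]
  have e1 : Real.exp (-(η * (t - x / 4))) = Real.exp (-(η * t)) * Real.exp (η * x / 4) := by
    rw [← Real.exp_add]; congr 1; ring
  have e2 : Real.exp (-(η * (x / 4 + t))) = Real.exp (-(η * t)) * Real.exp (-(η * x / 4)) := by
    rw [← Real.exp_add]; congr 1; ring
  have e3 : Real.exp (-(η * (P - (t - x / 4)))) =
      Real.exp (-(η * t)) * (Real.exp (-(η * (P - 2 * t))) * Real.exp (-(η * x / 4))) := by
    rw [← Real.exp_add, ← Real.exp_add]; congr 1; ring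
  have e4 : Real.exp (-(η * (P - (x / 4 + t)))) =
      Real.exp (-(η * t)) * (Real.exp (-(η * (P - 2 * t))) * Real.exp (η * x / 4)) := by
    rw [← Real.exp_add, ← Real.exp_add]; congr 1; ring
  have b1 : Real.exp (-2) ≤ Real.exp (-(η * t)) := Real.exp_le_exp.2 (by nlinarith)
  have b2 : Real.exp (-(η * (P - 2 * t))) ≤ Real.exp (-2) := Real.exp_le_exp.2 (by nlinarith)
  have b3 : 1 / 4 ≤ Real.exp (η * x / 4) - Real.exp (-(η * x / 4)) := by
    have i1 := Real.add_one_le_exp (η * x / 4)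
    have i2 : Real.exp (-(η * x / 4)) ≤ 1 := Real.exp_le_one_iff.2 (by linarith)
    linarith
  have b4 : (1 - Real.exp (-2)) * (1 - Real.exp (-(η * P))) ≤ 1 - Real.exp (-2) :=
    mul_le_of_le_one_right (by simp) (by simp [Real.exp_nonneg])
  have b5 : 0 ≤ 1 - Real.exp (-2) := by simp
  calc _ = Real.exp (-2) * (1 / 4) * ((1 - Real.exp (-2)) * (1 - Real.exp (-(η * P)))) := by ring
    _ ≤ Real.exp (-2) * (1 / 4) * (1 - Real.exp (-2)) := by gcongr
    _ ≤ Real.exp (-(η * t)) * (Real.exp (η * x / 4) - Real.exp (-(η * x / 4))) *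
        (1 - Real.exp (-(η * (P - 2 * t)))) := by gcongr
    _ = _ := by rw [e1, e2, e3, e4]; ring

/-- The increments of the convolution with a bell dominate `√x` times those of the bell. -/
theorem exists_lop_sub_lower (hP : 0 < P) : ∃ c > 0, ∃ x₀ > 0, x₀ ≤ P / 4 ∧
    ∀ f, IsBell P f → ∀ x, 0 < x → x ≤ x₀ →
      c * √x * (f x - f (x / 2)) ≤ Lop whithamKernel f x - Lop whithamKernel f (x / 2) := by
  obtain ⟨c, hc, T, hT, hν⟩ := exists_whithamMeasure_lower
  set k := Real.exp (-2) * (1 - Real.exp (-2)) / 4 with hk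
  have hk0 : 0 < k := by
    have : Real.exp (-2) < 1 := by simp
    have := Real.exp_pos (-2)
    rw [hk]
    have : 0 < 1 - Real.exp (-2) := by linarith
    positivity
  refine ⟨c * k / 2, by positivity, min (P / 4) (1 / T), by positivity, min_le_left _ _, ?_⟩
  intro f hf x hx hx'
  have hxP : x ≤ P / 4 := hx'.trans (min_le_left _ _)
  have hxT : T ≤ 1 / x := by
    rw [le_div_comm₀ hT hx]; exact hx'.trans (min_le_right _ _)
  have hd : 0 ≤ f x - f (x / 2) :=
    sub_nonneg.2 (hf.mono ⟨by linarith, by linarith⟩ ⟨by linarith, by linarith⟩ (by linarith))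
  have hfc := hf.continuous
  have hpt : ∀ η, 0 < η → (Set.Ioc (1 / x) (2 * (1 / x))).indicator
      (fun _ => k * (f x - f (x / 2)) * (x / 2)) η ≤
      expConv η f (3 * x / 4 + x / 4) - expConv η f (3 * x / 4 - x / 4) := by
    intro η hη
    by_cases hm : η ∈ Set.Ioc (1 / x) (2 * (1 / x))
    · rw [Set.indicator_of_mem hm, expConv_sub_eq hP hfc hf.periodic hη]
      have hci : ∀ u v : ℝ, IntervalIntegrable (fun t => (perExp P η (x / 4 - t) -
          perExp P η (x / 4 + t)) * (f (3 * x / 4 + t) - f (3 * x / 4 - t))) volume u v := by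
        intro u v
        have := continuous_perExp P η
        exact Continuous.intervalIntegrable (by fun_prop) _ _
      calc _ = ∫ t in (x / 2)..x, k * (f x - f (x / 2)) := by
            rw [intervalIntegral.integral_const, smul_eq_mul]; ring
        _ ≤ ∫ t in (x / 2)..x, (perExp P η (x / 4 - t) -
          perExp P η (x / 4 + t)) * (f (3 * x / 4 + t) - f (3 * x / 4 - t)) := by
            refine intervalIntegral.integral_mono_on (by linarith) (by simp) (hci _ _) ?_
            intro t ht
            have a1 := perExp_sub_lower hP hx hxP ht.1 ht.2 hm.1.le (by
              have := hm.2; rwa [mul_one_div] at this)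
            have a2 : f x ≤ f (3 * x / 4 + t) :=
              hf.mono ⟨by linarith, by linarith⟩ ⟨by linarith [ht.1], by linarith [ht.2]⟩
                (by linarith [ht.1])
            have a3 : f (3 * x / 4 - t) ≤ f (x / 2) := by
              have habs : |3 * x / 4 - t| ≤ x / 4 := abs_le.2 ⟨by linarith [ht.2], by linarith [ht.1]⟩
              apply hf.le_of_tri_le hP
              rw [tri_eq hP (by linarith : 0 ≤ x / 2) (by linarith)]
              linarith [tri_le_abs P (3 * x / 4 - t)]
            gcongr
            exact hk0.le.trans a1
        _ ≤ _ := by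
            refine intervalIntegral.integral_mono_interval (by linarith) (by linarith) (by linarith)
              ?_ (hci _ _)
            refine (ae_restrict_iff' measurableSet_Ioc).2 (Eventually.of_forall fun t ht => ?_)
            exact mul_nonneg (perExp_sub_nonneg hP hη (by linarith) (by linarith) ht.1.le ht.2)
              (hf.symm_diff_nonneg hP (by linarith) (by linarith) ht.1.le ht.2)
    · rw [Set.indicator_of_notMem hm]
      exact expConv_mono hP hf hη (by linarith) (by linarith) (by linarith)
  have hL := Lop_sub_eq hP hf (3 * x / 4) (x / 4)
  have hb := hf.bddMeas hP
  have hmono := integral_mono_ae (μ := whithamMeasure)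
    (f := (Set.Ioc (1 / x) (2 * (1 / x))).indicator (fun _ => k * (f x - f (x / 2)) * (x / 2)))
    (g := fun η => expConv η f (3 * x / 4 + x / 4) - expConv η f (3 * x / 4 - x / 4)) ?_
    ((integrable_expConv hb _).sub (integrable_expConv hb _)) (ae_whithamMeasure_pos.mono hpt)
  · rw [← hL, integral_indicator_const _ measurableSet_Ioc, smul_eq_mul,
      show 3 * x / 4 + x / 4 = x by ring, show 3 * x / 4 - x / 4 = x / 2 by ring] at hmono
    refine le_trans ?_ hmono
    have h1 := hν _ hxT
    calc _ = c * √(1 / x) * (k * (f x - f (x / 2)) * (x / 2)) := by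
          rw [Real.sqrt_div zero_le_one, Real.sqrt_one]
          have := Real.mul_self_sqrt hx.le
          have := Real.sqrt_pos.2 hx
          field_simp
          nlinarith
      _ ≤ _ := by gcongr
  · refine (integrable_indicator_iff measurableSet_Ioc).2 (integrableOn_const fun htop => ?_)
    have h1 := hν _ hxT
    rw [measureReal_def, htop, ENNReal.toReal_top] at h1
    have : 0 < c * √(1 / x) := by positivity
    linarith

theorem IsProfile.sqrt_le (hP : 0 < P) (h : IsProfile P 0 s G) :
    ∃ c > 0, ∀ x, 0 ≤ x → x ≤ P / 2 → c * √x ≤ G x := by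
  obtain ⟨c, hc, x₀, hx₀, hx₀P, hlow⟩ := exists_lop_sub_lower hP
  have h1 : ∀ x, 0 ≤ x → x ≤ x₀ → c / 2 * √x ≤ G x := by
    intro x hx hx'
    rcases hx.eq_or_lt with rfl | hx
    · simp [h.zero]
    have h2 := hlow G h.bell x hx hx'
    have h3 := h.lt hP (by linarith : 0 ≤ x / 2) (by linarith : x / 2 < x) (by linarith)
    rw [← h.sq_sub_sq] at h2
    nlinarith
  have hs : 0 < √(P / 2) := Real.sqrt_pos.2 (by linarith)
  have hs0 : 0 < √x₀ := Real.sqrt_pos.2 hx₀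
  refine ⟨min (c / 2) (c / 2 * √x₀ / √(P / 2)), by positivity, fun x hx hx' => ?_⟩
  rcases le_total x x₀ with hle | hle
  · refine le_trans ?_ (h1 x hx hle)
    gcongr
    exact min_le_left _ _
  · calc _ ≤ c / 2 * √x₀ / √(P / 2) * √(P / 2) := by
          gcongr
          exact min_le_right _ _
      _ = c / 2 * √x₀ := by field_simp
      _ ≤ G x₀ := h1 x₀ hx₀.le le_rfl
      _ ≤ G x := h.bell.mono ⟨hx₀.le, by linarith⟩ ⟨hx, hx'⟩ hle

theorem IsProfile.abs_sub_le_sqrt (hP : 0 < P) {a : ℝ} (h : IsProfile P a s G) :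
    ∃ M, ∀ x y, |G x - G y| ≤ M * √|x - y| := by
  rcases h.a_nonneg.eq_or_lt with rfl | ha
  · obtain ⟨c, hc, hlow⟩ := h.sqrt_le hP
    have hb := h.bell.bddMeas hP
    have key : ∀ x y, 0 ≤ x → x ≤ y → y ≤ P / 2 → G y - G x ≤ 65536 / c * √(y - x) := by
      intro x y hx hxy hy
      rcases hxy.eq_or_lt with rfl | hxy
      · simp
      have hy0 : 0 < y := hx.trans_lt hxy
      have h1 := Lop_sub_le_of_le_sqrt hb h.bell.even (h.nonneg hP) (M := 256) (r := 0)
        (fun z => by rw [max_eq_left (abs_nonneg z)]; exact h.le_sqrt hP z) hx hxy.le hy0 hy0.le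
      rw [← h.sq_sub_sq, Real.sqrt_mul (by linarith)] at h1
      have h2 := hlow y hy0.le hy
      have h3 := h.nonneg hP x
      have h4 := (h.lt hP hx hxy hy).le
      have h5 : 0 < √y := Real.sqrt_pos.2 hy0
      have h6 : (G y - G x) * (c * √y) ≤ (G y - G x) * (G y + G x + 2 * 0) := by
        gcongr
        · linarith
      rw [div_mul_eq_mul_div, le_div_iff₀ hc]
      have h7 : (G y - G x) * c * √y ≤ 65536 * √(y - x) * √y := by linarith
      exact le_of_mul_le_mul_right h7 h5
    have key' : ∀ x y, 0 ≤ x → x ≤ P / 2 → 0 ≤ y → y ≤ P / 2 →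
        |G x - G y| ≤ 65536 / c * √|x - y| := by
      intro x y hx hx' hy hy'
      wlog hxy : y ≤ x generalizing x y
      · rw [abs_sub_comm, abs_sub_comm x]
        exact this y x hy hy' hx hx' (by linarith)
      rw [abs_of_nonneg (sub_nonneg.2 hxy), abs_of_nonneg]
      · exact key y x hy hxy hx'
      · exact sub_nonneg.2 (h.bell.mono ⟨hy, hy'⟩ ⟨hx, hx'⟩ hxy)
    refine ⟨65536 / c, fun x y => ?_⟩
    rw [← h.bell.comp_tri x, ← h.bell.comp_tri y]
    refine (key' _ _ (tri_nonneg P x) (tri_le hP x) (tri_nonneg P y) (tri_le hP y)).trans ?_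
    exact mul_le_mul_of_nonneg_left (Real.sqrt_le_sqrt (abs_tri_sub_le P x y)) (by positivity)
  · refine ⟨64 / (2 * a), fun x y => ?_⟩
    have h1 := abs_Lop_sub_le_of_le_one hP h.bell h.zero h.le_one x y
    rw [← h.sq_sub_sq, abs_mul, abs_of_nonneg (a := G x + G y + 2 * a)
      (by linarith [h.nonneg hP x, h.nonneg hP y])] at h1
    rw [div_mul_eq_mul_div, le_div_iff₀ (by linarith)]
    refine le_trans ?_ h1
    gcongr
    linarith [h.nonneg hP x, h.nonneg hP y]

end CrestEstimates

section HolderGain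

theorem differentiableAt_expConv {f : ℝ → ℝ} (hb : BddMeas f) {η : ℝ} (hη : 0 < η) (x : ℝ) :
    DifferentiableAt ℝ (expConv η f) x := by
  obtain ⟨hm, M, hM⟩ := id hb
  have hM0 : 0 ≤ M := (abs_nonneg _).trans (hM 0)
  have hlip : ∀ u v z : ℝ, |Real.exp (-(η * |u - z|)) - Real.exp (-(η * |v - z|))| ≤
      η * |u - v| * (Real.exp (-(η * |u - z|)) + Real.exp (-(η * |v - z|))) := by
    intro u v z
    wlog huv : v ≤ u generalizing u v
    · rw [abs_sub_comm, abs_sub_comm u v, add_comm]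
      exact this v u (by linarith)
    have := abs_exp_neg_abs_sub_le hη (sub_nonneg.2 huv) (v - z)
    rwa [show v - z + (u - v) = u - z by ring, ← abs_of_nonneg (sub_nonneg.2 huv)] at this
  have hnear : ∀ u z : ℝ, u ∈ Metric.ball x 1 →
      Real.exp (-(η * |u - z|)) ≤ Real.exp η * Real.exp (-(η * |x - z|)) := by
    intro u z hu
    rw [← Real.exp_add]
    apply Real.exp_le_exp.2
    have h1 : |x - z| ≤ 1 + |u - z| := by
      have := abs_sub_le x u z
      rw [Metric.mem_ball, Real.dist_eq, abs_sub_comm] at hu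
      linarith
    nlinarith
  have hint : ∀ u : ℝ, Integrable fun z => Real.exp (-(η * |u - z|)) * f z := fun u => by
    have := ((hb.comp_sub u).integrable_exp_mul hη).comp_sub_left u
    simpa using this
  have hcont : Continuous (Function.uncurry fun z u : ℝ => Real.exp (-(η * |u - z|))) := by
    unfold Function.uncurry; fun_prop
  have hder := (measurable_deriv_with_param hcont).comp (measurable_id.prodMk (measurable_const (a := x)))
  have key := (hasDerivAt_integral_of_dominated_loc_of_lip (𝕜 := ℝ) (μ := volume)
    (F := fun u z => Real.exp (-(η * |u - z|)) * f z) (x₀ := x) (s := Metric.ball x 1)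
    (F' := fun z => deriv (fun u : ℝ => Real.exp (-(η * |u - z|))) x * f z)
    (bound := fun z => 2 * η * Real.exp η * M * Real.exp (-(η * |x - z|)))
    (Metric.ball_mem_nhds x one_pos)
    (Eventually.of_forall fun u => (hint u).aestronglyMeasurable) (hint x)
    (hder.mul hm).aestronglyMeasurable ?_ ?_ ?_).2
  · have e : (fun u => ∫ z, Real.exp (-(η * |u - z|)) * f z) = expConv η f := by
      ext u; rw [expConv_eq]
    rw [e] at key
    exact key.differentiableAt
  · refine Eventually.of_forall fun z => LipschitzOnWith.of_dist_le_mul fun u hu v hv => ?_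
    have hB : 0 ≤ 2 * η * Real.exp η * M * Real.exp (-(η * |x - z|)) := by positivity
    rw [Real.dist_eq, Real.dist_eq, ← sub_mul, abs_mul, Real.coe_nnabs, abs_of_nonneg hB]
    calc _ ≤ η * |u - v| * (Real.exp (-(η * |u - z|)) + Real.exp (-(η * |v - z|))) * M := by
          exact mul_le_mul (hlip u v z) (hM z) (abs_nonneg _) (by positivity)
      _ ≤ η * |u - v| * (Real.exp η * Real.exp (-(η * |x - z|)) +
          Real.exp η * Real.exp (-(η * |x - z|))) * M := by
          gcongr
          · exact hnear u z hu
          · exact hnear v z hv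
      _ = _ := by ring
  · have := ((integrable_exp_neg_mul_abs hη).comp_sub_left x).const_mul (2 * η * Real.exp η * M)
    exact this
  · filter_upwards [ae_iff.2 (by simp : volume {z : ℝ | ¬ z ≠ x} = 0)] with z hz
    refine HasDerivAt.mul_const ?_ _
    apply DifferentiableAt.hasDerivAt
    have h1 : DifferentiableAt ℝ (fun u : ℝ => |u - z|) x :=
      (differentiableAt_id.sub_const z).abs (sub_ne_zero.2 hz.symm)
    fun_prop

theorem integrable_rpow_mul_exp_abs {η α : ℝ} (hη : 0 < η) (hα : 0 ≤ α) :
    Integrable (fun z : ℝ => |z| ^ α * Real.exp (-(η * |z|))) ∧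
      ∫ z : ℝ, |z| ^ α * Real.exp (-(η * |z|)) = 2 * (η⁻¹ ^ (α + 1) * Real.Gamma (α + 1)) := by
  have h1 : IntegrableOn (fun z : ℝ => z ^ α * Real.exp (-(η * z))) (Set.Ioi 0) := by
    have := integrableOn_rpow_mul_exp_neg_mul_rpow (s := α) (by linarith) one_pos hη
    simpa using this
  have h2 : Integrable ((Set.Ioi (0:ℝ)).indicator fun z : ℝ => z ^ α * Real.exp (-(η * z))) :=
    (integrable_indicator_iff measurableSet_Ioi).2 h1
  refine ⟨(h2.add h2.comp_neg).congr ?_, ?_⟩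
  · filter_upwards [ae_ne_zero] with z hz
    rcases lt_or_gt_of_ne hz with h | h
    · simp [h, h.le, abs_of_neg h]
    · simp [h, h.le, abs_of_pos h]
  rw [integral_comp_abs (f := fun z => z ^ α * Real.exp (-(η * z)))]
  have := Real.integral_rpow_mul_exp_neg_mul_Ioi (a := α + 1) (by linarith) hη
  simp only [add_sub_cancel_right, one_div] at this
  rw [this]

theorem abs_expConv_sub_le_trivial {f : ℝ → ℝ} (hb : BddMeas f) {M : ℝ} {x y : ℝ}
    (hM : ∀ z, |f (x - z) - f (y - z)| ≤ M) {η : ℝ} (hη : 0 < η) :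
    |expConv η f x - expConv η f y| ≤ M * (2 / η) := by
  have h := abs_expConv_le (f := fun z => f (x - -z) - f (y - - z)) (fun z => hM _) hη 0
  have e : expConv η (fun z => f (x - -z) - f (y - - z)) 0 = expConv η f x - expConv η f y := by
    unfold expConv
    rw [← integral_sub ((hb.comp_sub x).integrable_exp_mul hη) ((hb.comp_sub y).integrable_exp_mul hη)]
    congr 1; ext z; simp; ring
  rwa [e] at h

/-- Convolving a Hölder function with an exponential gives a Lipschitz function. -/
theorem abs_expConv_sub_le_of_holder {f : ℝ → ℝ} (hb : BddMeas f) {M α : ℝ} (hα : 0 ≤ α)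
    (hα1 : α ≤ 1) (hM : ∀ x y, |f x - f y| ≤ M * |x - y| ^ α) {η : ℝ} (hη : 0 < η) (x y : ℝ) :
    |expConv η f x - expConv η f y| ≤ (8 * Real.Gamma (α + 1) + 2) * M * (η ^ (-α) * |x - y|) := by
  wlog hxy : y ≤ x generalizing x y
  · rw [abs_sub_comm, abs_sub_comm x y]
    exact this y x (by linarith)
  obtain ⟨h, rfl⟩ : ∃ h, x = y + h := ⟨x - y, by ring⟩
  have hh : 0 ≤ h := by linarith
  rw [add_sub_cancel_left, abs_of_nonneg hh]
  have hM0 : 0 ≤ M := by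
    have := (abs_nonneg _).trans (hM 1 0)
    simpa using this
  have hG : 0 < Real.Gamma (α + 1) := Real.Gamma_pos_of_pos (by linarith)
  rcases le_total 1 (η * h) with h1 | h1
  · have h2 := abs_expConv_sub_le_trivial hb (x := y + h) (y := y) (M := M * h ^ α) (fun z => by
      have := hM (y + h - z) (y - z)
      rwa [show y + h - z - (y - z) = h by ring, abs_of_nonneg hh] at this) hη
    have hh0 : 0 < h := by
      rcases hh.eq_or_lt with h0 | h0
      · rw [← h0] at h1; norm_num at h1
      · exact h0
    have h3 : h ^ α * η⁻¹ ≤ η ^ (-α) * h := by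
      have e1 : (η * h) ^ α ≤ (η * h) ^ (1:ℝ) := Real.rpow_le_rpow_of_exponent_le h1 hα1
      rw [Real.mul_rpow hη.le hh, Real.rpow_one] at e1
      rw [Real.rpow_neg hη.le, ← div_eq_mul_inv, inv_mul_eq_div,
        div_le_div_iff₀ hη (Real.rpow_pos_of_pos hη _)]
      linarith
    calc _ ≤ M * h ^ α * (2 / η) := h2
      _ = 2 * M * (h ^ α * η⁻¹) := by rw [div_eq_mul_inv]; ring
      _ ≤ (8 * Real.Gamma (α + 1) + 2) * M * (h ^ α * η⁻¹) := by gcongr; linarith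
      _ ≤ _ := by gcongr
  · obtain ⟨i1, i2⟩ := integrable_rpow_mul_exp_abs hη hα
    have e0 : expConv η f (y + h) - expConv η f y =
        ∫ z, (Real.exp (-(η * |z + h|)) - Real.exp (-(η * |z|))) * (f (y - z) - f y) := by
      have j1 := integrable_exp_shift hη h
      have j2 := integrable_exp_neg_mul_abs hη
      have j3 : Integrable fun z => Real.exp (-(η * |z + h|)) * f (y - z) :=
        j1.mul_bdd (c := hb.2.choose) (hb.comp_sub y).1.aestronglyMeasurable
          (Eventually.of_forall fun z => hb.2.choose_spec _)
      have j4 := (hb.comp_sub y).integrable_exp_mul hη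
      have j5 : ∫ z, Real.exp (-(η * |z + h|)) = ∫ z, Real.exp (-(η * |z|)) :=
        integral_add_right_eq_self (fun z => Real.exp (-(η * |z|))) h
      have e : (fun z => (Real.exp (-(η * |z + h|)) - Real.exp (-(η * |z|))) * (f (y - z) - f y)) =
          fun z => (Real.exp (-(η * |z + h|)) * f (y - z) - Real.exp (-(η * |z|)) * f (y - z)) -
            (Real.exp (-(η * |z + h|)) - Real.exp (-(η * |z|))) * f y := by
        ext z; ring
      have j6 : Integrable fun z => Real.exp (-(η * |z + h|)) * f (y - z) -
        Real.exp (-(η * |z|)) * f (y - z) := j3.sub j4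
      have j7 : Integrable fun z => (Real.exp (-(η * |z + h|)) - Real.exp (-(η * |z|))) * f y :=
        (j1.sub j2).mul_const _
      rw [e, integral_sub j6 j7, integral_sub j3 j4,
        integral_mul_const, integral_sub j1 j2, j5, sub_self, zero_mul, sub_zero,
        expConv_shift, expConv]
    have hexp : Real.exp (η * h) ≤ 3 := (Real.exp_le_exp.2 h1).trans Real.exp_one_lt_three.le
    rw [e0, ← Real.norm_eq_abs]
    refine (norm_integral_le_of_norm_le (i1.const_mul (4 * η * h * M))
      (Eventually.of_forall fun z => ?_)).trans ?_
    · rw [norm_mul, Real.norm_eq_abs, Real.norm_eq_abs]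
      have k1 : Real.exp (-(η * |z + h|)) ≤ 3 * Real.exp (-(η * |z|)) := by
        refine le_trans ?_ (mul_le_mul_of_nonneg_right hexp (Real.exp_nonneg _))
        rw [← Real.exp_add]
        apply Real.exp_le_exp.2
        have : |z| ≤ |z + h| + h := by
          have := abs_sub (z + h) h
          rwa [add_sub_cancel_right, abs_of_nonneg hh] at this
        nlinarith
      have k2 := hM (y - z) y
      rw [show y - z - y = -z by ring, abs_neg] at k2
      calc _ ≤ (η * h * (3 * Real.exp (-(η * |z|)) + Real.exp (-(η * |z|)))) * (M * |z| ^ α) := by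
            refine mul_le_mul ((abs_exp_neg_abs_sub_le hη hh z).trans ?_) k2 (abs_nonneg _)
              (by positivity)
            gcongr
        _ = _ := by ring
    · rw [integral_const_mul, i2, Real.inv_rpow hη.le, Real.rpow_add hη, Real.rpow_one,
        Real.rpow_neg hη.le]
      have : 4 * η * h * M * (2 * ((η ^ α * η)⁻¹ * Real.Gamma (α + 1))) =
          8 * Real.Gamma (α + 1) * M * ((η ^ α)⁻¹ * h) := by
        field_simp
        ring
      rw [this]
      gcongr
      linarith

theorem exists_abs_Lop_sub_le_of_holder {f : ℝ → ℝ} (hb : BddMeas f) {M : ℝ}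
    (hM : ∀ x y, |f x - f y| ≤ M * |x - y| ^ (1 / 2 : ℝ)) :
    ∃ C, ∀ x y, |Lop whithamKernel f x - Lop whithamKernel f y| ≤ C * |x - y| ^ (3 / 4 : ℝ) := by
  have hM0 : 0 ≤ M := by
    have := (abs_nonneg _).trans (hM 1 0)
    simpa using this
  set C := 8 * Real.Gamma (1 / 2 + 1) + 2 with hC
  have hC0 : 0 < C := by
    have : 0 < Real.Gamma (1 / 2 + 1) := Real.Gamma_pos_of_pos (by norm_num)
    positivity
  have hpt : ∀ η, 0 < η → ∀ x y, |expConv η f x - expConv η f y| ≤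
      (√(2 * C) * M * |x - y| ^ (3 / 4 : ℝ)) * η ^ (-(3 / 4) : ℝ) := by
    intro η hη x y
    have h1 := abs_expConv_sub_le_of_holder hb (by norm_num) (by norm_num) hM hη x y
    have h2 := abs_expConv_sub_le_trivial hb (x := x) (y := y) (fun z => by
      have := hM (x - z) (y - z)
      rwa [show x - z - (y - z) = x - y by ring] at this) hη
    refine abs_le_of_sq_le_sq ?_ (by positivity)
    have hd := abs_nonneg (x - y)
    have e1 : (|x - y| ^ (3 / 4 : ℝ)) ^ 2 = |x - y| * |x - y| ^ (1 / 2 : ℝ) := by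
      rw [← Real.rpow_natCast, ← Real.rpow_mul hd]
      nth_rewrite 2 [← Real.rpow_one |x - y|]
      rw [← Real.rpow_add_of_nonneg hd (by norm_num) (by norm_num)]
      norm_num
    have e2 : (η ^ (-(3 / 4) : ℝ)) ^ 2 = η ^ (-(1 / 2) : ℝ) / η := by
      rw [← Real.rpow_natCast, ← Real.rpow_mul hη.le, ← Real.rpow_sub_one hη.ne']
      norm_num
    rw [mul_pow, mul_pow, mul_pow, e1, e2, Real.sq_sqrt (by positivity), ← sq_abs, sq]
    calc _ ≤ (C * M * (η ^ (-(1 / 2) : ℝ) * |x - y|)) * (M * |x - y| ^ (1 / 2 : ℝ) * (2 / η)) :=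
          mul_le_mul h1 h2 (abs_nonneg _) (by positivity)
      _ = _ := by ring
  refine ⟨√(2 * C) * M * ∫ η, η ^ (-(3 / 4) : ℝ) ∂whithamMeasure, fun x y => ?_⟩
  rw [Lop_eq_expConv hb, Lop_eq_expConv hb,
    ← integral_sub (integrable_expConv hb _) (integrable_expConv hb _), ← Real.norm_eq_abs]
  refine (norm_integral_le_of_norm_le ((integrable_rpow_whithamMeasure (s := 3 / 4)
    (by norm_num)).const_mul (√(2 * C) * M * |x - y| ^ (3 / 4 : ℝ)))
    (ae_whithamMeasure_pos.mono fun η hη => hpt η hη x y)).trans_eq ?_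
  rw [integral_const_mul]
  ring

theorem exists_hasDerivAt_Lop_of_holder {f : ℝ → ℝ} (hb : BddMeas f) {M : ℝ}
    (hM : ∀ x y, |f x - f y| ≤ M * |x - y| ^ (3 / 4 : ℝ)) :
    ∃ (C : ℝ) (g : ℝ → ℝ), (∀ x, |g x| ≤ C) ∧ ∀ x, HasDerivAt (Lop whithamKernel f) (g x) x := by
  have hM0 : 0 ≤ M := by
    have := (abs_nonneg _).trans (hM 1 0)
    simpa using this
  set C := (8 * Real.Gamma (3 / 4 + 1) + 2) * M with hC
  have hC0 : 0 ≤ C := by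
    have : 0 < Real.Gamma (3 / 4 + 1) := Real.Gamma_pos_of_pos (by norm_num)
    positivity
  have hlip : ∀ η, 0 < η → ∀ x y, |expConv η f x - expConv η f y| ≤
      C * η ^ (-(3 / 4) : ℝ) * |x - y| := fun η hη x y => by
    rw [mul_assoc]
    exact abs_expConv_sub_le_of_holder hb (by norm_num) (by norm_num) hM hη x y
  have hI := (integrable_rpow_whithamMeasure (s := 3 / 4) (by norm_num)).const_mul C
  have hd : ∀ x η, 0 < η → HasDerivAt (expConv η f) (deriv (expConv η f) x) x := fun x η hη =>
    (differentiableAt_expConv hb hη x).hasDerivAt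
  have hmeas : ∀ x, AEStronglyMeasurable (fun η => deriv (expConv η f) x) whithamMeasure := by
    intro x
    refine aestronglyMeasurable_of_tendsto_ae (nhdsWithin (0:ℝ) {0}ᶜ)
      (f := fun t η => t⁻¹ • (expConv η f (x + t) - expConv η f x)) (fun t =>
        (((integrable_expConv hb (x + t)).sub (integrable_expConv hb x)).const_mul
          t⁻¹).aestronglyMeasurable) ?_
    exact ae_whithamMeasure_pos.mono fun η hη => (hd x η hη).tendsto_slope_zero
  refine ⟨∫ η, C * η ^ (-(3 / 4) : ℝ) ∂whithamMeasure,
    fun x => ∫ η, deriv (expConv η f) x ∂whithamMeasure, fun x => ?_, fun x => ?_⟩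
  · rw [← Real.norm_eq_abs]
    refine norm_integral_le_of_norm_le hI (ae_whithamMeasure_pos.mono fun η hη => ?_)
    refine (hd x η hη).le_of_lip' (by positivity) (Eventually.of_forall fun y => ?_)
    exact hlip η hη y x
  · have key := (hasDerivAt_integral_of_dominated_loc_of_lip (𝕜 := ℝ) (μ := whithamMeasure)
      (F := fun u η => expConv η f u) (x₀ := x) (s := Set.univ)
      (F' := fun η => deriv (expConv η f) x)
      (bound := fun η => C * η ^ (-(3 / 4) : ℝ)) univ_mem
      (Eventually.of_forall fun u => (integrable_expConv hb u).aestronglyMeasurable)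
      (integrable_expConv hb x) (hmeas x)
      (ae_whithamMeasure_pos.mono fun η hη => LipschitzOnWith.of_dist_le_mul fun u _ v _ => ?_) hI
      (ae_whithamMeasure_pos.mono fun η hη => hd x η hη)).2
    · have e : (fun u => ∫ η, expConv η f u ∂whithamMeasure) = Lop whithamKernel f := by
        ext u; rw [Lop_eq_expConv hb]
      rwa [e] at key
    · have hB : 0 ≤ C * η ^ (-(3 / 4) : ℝ) := by positivity
      rw [Real.dist_eq, Real.dist_eq, Real.coe_nnabs, abs_of_nonneg hB]
      exact hlip η hη u v

theorem hasDerivAt_Lop {f f' : ℝ → ℝ} (hf : BddMeas f) (hf' : BddMeas f')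
    (hd : ∀ x, HasDerivAt f (f' x) x) (x : ℝ) :
    HasDerivAt (Lop whithamKernel f) (Lop whithamKernel f' x) x := by
  obtain ⟨hm', M, hM⟩ := id hf'
  have hm := hf.1
  have key := (hasDerivAt_integral_of_dominated_loc_of_deriv_le (𝕜 := ℝ) (μ := volume)
    (F := fun u z => whithamKernel z * f (u - z)) (x₀ := x) (s := Set.univ)
    (F' := fun u z => whithamKernel z * f' (u - z))
    (bound := fun z => whithamKernel z * M) univ_mem
    (Eventually.of_forall fun u => (hf.comp_sub u).integrable_kernel_mul.aestronglyMeasurable)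
    (hf.comp_sub x).integrable_kernel_mul (hf'.comp_sub x).integrable_kernel_mul.aestronglyMeasurable
    (Eventually.of_forall fun z u _ => ?_) (integrable_whithamKernel.mul_const M)
    (Eventually.of_forall fun z u _ => ?_)).2
  · have e : (fun u => ∫ z, whithamKernel z * f (u - z)) = Lop whithamKernel f := by
      ext u; rw [Lop_eq]
    rw [e] at key
    rwa [Lop_eq]
  · rw [norm_mul, Real.norm_of_nonneg (whithamKernel_nonneg z)]
    exact mul_le_mul_of_nonneg_left (hM _) (whithamKernel_nonneg z)
  · exact ((hd (u - z)).comp_sub_const u z).const_mul _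

end HolderGain

section SmoothOffSupport

theorem norm_exp_mul_le {η δ x u : ℝ} (hη : 0 < η) (hδ : 0 < δ) (hu : u ≤ x) (b : ℝ) :
    ‖Real.exp (η * u) * (η * b)‖ ≤ δ⁻¹ * ‖Real.exp (η * (x + δ)) * b‖ := by
  have h1 : η * δ ≤ Real.exp (η * δ) := by linarith [Real.add_one_le_exp (η * δ)]
  have h2 : η ≤ δ⁻¹ * Real.exp (η * δ) := by
    rw [inv_mul_eq_div, le_div_iff₀ hδ]; exact h1
  have h3 : η * Real.exp (η * u) ≤ δ⁻¹ * Real.exp (η * (x + δ)) :=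
    calc η * Real.exp (η * u) ≤ (δ⁻¹ * Real.exp (η * δ)) * Real.exp (η * x) := by gcongr
      _ = δ⁻¹ * Real.exp (η * (x + δ)) := by rw [mul_assoc, ← Real.exp_add]; congr 2; ring
  rw [norm_mul, norm_mul, norm_mul, Real.norm_of_nonneg (Real.exp_pos _).le,
    Real.norm_of_nonneg (Real.exp_pos _).le, Real.norm_of_nonneg hη.le]
  calc _ = η * Real.exp (η * u) * ‖b‖ := by ring
    _ ≤ δ⁻¹ * Real.exp (η * (x + δ)) * ‖b‖ := by gcongr
    _ = _ := by ring

theorem integrable_mul_exp_mul {B : ℝ → ℝ} {R : ℝ}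
    (hB : ∀ x < R, Integrable (fun η => Real.exp (η * x) * B η) whithamMeasure) {x : ℝ}
    (hx : x < R) : Integrable (fun η => Real.exp (η * x) * (η * B η)) whithamMeasure := by
  obtain ⟨δ, hδ, hxδ⟩ : ∃ δ, 0 < δ ∧ x + δ < R := ⟨(R - x) / 2, by linarith, by linarith⟩
  refine ((hB _ hxδ).norm.const_mul δ⁻¹).mono' ?_ ?_
  · have e : (fun η => Real.exp (η * x) * (η * B η)) = fun η => η * (Real.exp (η * x) * B η) := by
      ext η; ring
    rw [e]
    exact measurable_id.aestronglyMeasurable.mul (hB x hx).aestronglyMeasurable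
  · filter_upwards [ae_whithamMeasure_pos] with η hη
    exact norm_exp_mul_le hη hδ le_rfl _

theorem hasDerivAt_integral_exp_mul {B : ℝ → ℝ} {R : ℝ}
    (hB : ∀ x < R, Integrable (fun η => Real.exp (η * x) * B η) whithamMeasure) {x : ℝ}
    (hx : x < R) : HasDerivAt (fun x => ∫ η, Real.exp (η * x) * B η ∂whithamMeasure)
      (∫ η, Real.exp (η * x) * (η * B η) ∂whithamMeasure) x := by
  obtain ⟨δ, hδ, hxδ⟩ : ∃ δ, 0 < δ ∧ x + δ + δ < R := ⟨(R - x) / 3, by linarith, by linarith⟩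
  refine (hasDerivAt_integral_of_dominated_loc_of_deriv_le (𝕜 := ℝ) (μ := whithamMeasure)
    (F := fun x η => Real.exp (η * x) * B η) (F' := fun x η => Real.exp (η * x) * (η * B η))
    (s := Metric.ball x δ)
    (bound := fun η => δ⁻¹ * ‖Real.exp (η * (x + δ + δ)) * B η‖) (Metric.ball_mem_nhds x hδ) ?_
    (hB x hx) (integrable_mul_exp_mul hB hx).aestronglyMeasurable ?_
    ((hB _ hxδ).norm.const_mul _) ?_).2
  · filter_upwards [Iio_mem_nhds hx] with u hu using (hB u hu).aestronglyMeasurable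
  · filter_upwards [ae_whithamMeasure_pos] with η hη u hu
    rw [Metric.mem_ball, Real.dist_eq, abs_lt] at hu
    exact norm_exp_mul_le hη hδ (by linarith) _
  · refine Eventually.of_forall fun η u _ => ?_
    have := (((hasDerivAt_id u).const_mul η).exp).mul_const (B η)
    simp only [id] at this
    exact this.congr_deriv (by ring)

theorem contDiffOn_integral_exp_mul {B : ℝ → ℝ} {R : ℝ}
    (hB : ∀ x < R, Integrable (fun η => Real.exp (η * x) * B η) whithamMeasure) (n : ℕ) :
    ContDiffOn ℝ n (fun x => ∫ η, Real.exp (η * x) * B η ∂whithamMeasure) (Set.Iio R) := by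
  induction n generalizing B with
  | zero =>
    exact contDiffOn_zero.2 fun x hx =>
      (hasDerivAt_integral_exp_mul hB hx).continuousAt.continuousWithinAt
  | succ n ih =>
    push_cast
    rw [contDiffOn_succ_iff_deriv_of_isOpen isOpen_Iio]
    refine ⟨fun x hx =>
      (hasDerivAt_integral_exp_mul hB hx).differentiableAt.differentiableWithinAt, by simp, ?_⟩
    exact (ih fun x hx => integrable_mul_exp_mul hB hx).congr fun x hx =>
      (hasDerivAt_integral_exp_mul hB hx).deriv

theorem contDiffAt_Lop_of_eq_zero_Iio {f : ℝ → ℝ} (hf : BddMeas f) {R x : ℝ}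
    (h0 : ∀ y < R, f y = 0) (hx : x < R) : ContDiffAt ℝ (⊤ : ℕ∞) (Lop whithamKernel f) x := by
  have e : ∀ x < R, ∀ η, expConv η f x =
      Real.exp (η * x) * ∫ y, Real.exp (-(η * y)) * f y := by
    intro x hx η
    rw [expConv_eq, ← integral_const_mul]
    congr 1; ext y
    rcases lt_or_ge y R with hy | hy
    · simp [h0 y hy]
    · rw [abs_of_nonpos (by linarith), ← mul_assoc, ← Real.exp_add]
      congr 2; ring
  have hB : ∀ x < R, Integrable
      (fun η => Real.exp (η * x) * ∫ y, Real.exp (-(η * y)) * f y) whithamMeasure := by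
    intro x hx
    simpa only [e x hx] using integrable_expConv hf x
  rw [contDiffAt_infty]
  intro n
  refine ((contDiffOn_integral_exp_mul hB n).contDiffAt (Iio_mem_nhds hx)).congr_of_eventuallyEq ?_
  filter_upwards [Iio_mem_nhds hx] with u hu
  rw [Lop_eq_expConv hf]
  simp only [e u hu]

theorem Lop_comp_neg (f : ℝ → ℝ) (x : ℝ) :
    Lop whithamKernel (fun y => f (-y)) x = Lop whithamKernel f (-x) := by
  simp only [Lop_eq]
  rw [← integral_neg_eq_self (fun y => whithamKernel y * f (-x - y))]
  congr 1; ext y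
  rw [whithamKernel_neg]; congr 2; ring

theorem contDiffAt_Lop_of_eventually_eq_zero {f : ℝ → ℝ} (hf : BddMeas f) {x : ℝ}
    (h0 : ∀ᶠ y in nhds x, f y = 0) : ContDiffAt ℝ (⊤ : ℕ∞) (Lop whithamKernel f) x := by
  obtain ⟨r, hr, h⟩ := Metric.eventually_nhds_iff.1 h0
  have hind : ∀ s : Set ℝ, MeasurableSet s → BddMeas (s.indicator f) := by
    rintro s hs
    refine ⟨hf.1.indicator hs, hf.2.imp fun M hM y => ?_⟩
    exact (norm_indicator_le_norm_self f y).trans (hM y)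
  have h1 := hind (Set.Ici x) measurableSet_Ici
  have h2 := hind (Set.Iio x) measurableSet_Iio
  have e : Lop whithamKernel f = fun u => Lop whithamKernel ((Set.Ici x).indicator f) u +
      Lop whithamKernel (fun y => (Set.Iio x).indicator f (- y)) (-u) := by
    ext u
    rw [Lop_comp_neg, neg_neg, ← Lop_add h1 h2]
    congr 1; ext y
    rcases lt_or_ge y x with hy | hy <;> simp [hy, not_le.2, not_lt.2]
  rw [e]
  refine ContDiffAt.add ?_ (ContDiffAt.comp
    (g := Lop whithamKernel fun y => (Set.Iio x).indicator f (-y)) x ?_ contDiffAt_id.neg)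
  · refine contDiffAt_Lop_of_eq_zero_Iio h1 (R := x + r) (fun y hy => ?_) (by linarith)
    refine Set.indicator_apply_eq_zero.2 fun hxy => h ?_
    rw [Real.dist_eq, abs_of_nonneg (by simpa using hxy)]; linarith
  · refine contDiffAt_Lop_of_eq_zero_Iio (h2.comp measurable_neg) (R := -x + r) (fun y hy => ?_)
      (by simpa using hr)
    refine Set.indicator_apply_eq_zero.2 fun hxy => h ?_
    rw [Set.mem_Iio] at hxy
    rw [Real.dist_eq, abs_of_neg (by linarith)]; linarith

end SmoothOffSupport

section LocalHolder

/-- `f` is `k` times differentiable near `a`, with `k`-th derivative bounded and `α`-Hölder there. -/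
def LocHolder (α : ℝ) : ℕ → (ℝ → ℝ) → ℝ → Prop
  | 0, f, a => ∃ M, ∃ U ∈ nhds a, (∀ x ∈ U, |f x| ≤ M) ∧
      ∀ x ∈ U, ∀ y ∈ U, |f x - f y| ≤ M * |x - y| ^ α
  | k + 1, f, a => (∀ᶠ x in nhds a, DifferentiableAt ℝ f x) ∧ LocHolder α k (deriv f) a

theorem ContDiffAt.deriv_infty {f : ℝ → ℝ} {a : ℝ} (hf : ContDiffAt ℝ (⊤ : ℕ∞) f a) :
    ContDiffAt ℝ (⊤ : ℕ∞) (deriv f) a := by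
  have h := (hf.fderiv_right (m := ((⊤ : ℕ∞) : WithTop ℕ∞)) (by norm_cast)).clm_apply
    (contDiffAt_const (c := (1 : ℝ)))
  simpa only [fderiv_apply_one_eq_deriv] using h

namespace LocHolder

variable {α : ℝ}

theorem of_lipschitzOnWith (hα : 0 ≤ α) (hα1 : α ≤ 1) {f : ℝ → ℝ} {a : ℝ} {K : NNReal} {t : Set ℝ}
    (ht : t ∈ nhds a) (hf : LipschitzOnWith K f t) : LocHolder α 0 f a := by
  refine ⟨|f a| + K, t ∩ Metric.ball a (1 / 2),
    inter_mem ht (Metric.ball_mem_nhds a (by norm_num)), ?_, ?_⟩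
  · rintro x ⟨hx, hxa⟩
    have h := hf.dist_le_mul x hx a (mem_of_mem_nhds ht)
    rw [Metric.mem_ball] at hxa
    have h1 : (K : ℝ) * dist x a ≤ K * 1 :=
      mul_le_mul_of_nonneg_left (by linarith) K.coe_nonneg
    rw [Real.dist_eq] at h
    have := abs_sub_abs_le_abs_sub (f x) (f a)
    linarith
  · rintro x ⟨hx, hxa⟩ y ⟨hy, hya⟩
    have h := hf.dist_le_mul x hx y hy
    rw [Real.dist_eq, Real.dist_eq] at h
    have hxy : |x - y| ≤ 1 := by
      rw [← Real.dist_eq]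
      have := dist_triangle_right x y a
      rw [Metric.mem_ball] at hxa hya
      linarith
    calc |f x - f y| ≤ K * |x - y| := h
      _ ≤ (|f a| + K) * |x - y| ^ α := by
        have h2 := Real.rpow_le_rpow_of_exponent_ge' (abs_nonneg (x - y)) hxy hα hα1
        rw [Real.rpow_one] at h2
        have := abs_nonneg (f a)
        gcongr
        linarith

theorem of_contDiffAt (hα : 0 ≤ α) (hα1 : α ≤ 1) {f : ℝ → ℝ} {a : ℝ}
    (hf : ContDiffAt ℝ (⊤ : ℕ∞) f a) (k : ℕ) : LocHolder α k f a := by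
  induction k generalizing f with
  | zero =>
    obtain ⟨K, t, ht, hK⟩ := (hf.of_le (by norm_cast)).exists_lipschitzOnWith
    exact of_lipschitzOnWith hα hα1 ht hK
  | succ k ih =>
    refine ⟨?_, ih hf.deriv_infty⟩
    have h1 : ContDiffAt ℝ 1 f a := hf.of_le (by norm_cast)
    exact (h1.eventually (by simp)).mono fun x hx => hx.differentiableAt (by norm_num)

theorem congr {k : ℕ} {f g : ℝ → ℝ} {a : ℝ} (hf : LocHolder α k f a) (h : g =ᶠ[nhds a] f) :
    LocHolder α k g a := by
  induction k generalizing f g with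
  | zero =>
    obtain ⟨M, U, hU, h1, h2⟩ := hf
    refine ⟨M, U ∩ {x | g x = f x}, inter_mem hU h, ?_, ?_⟩
    · rintro x ⟨hx, hgx⟩
      rw [hgx]; exact h1 x hx
    · rintro x ⟨hx, hgx⟩ y ⟨hy, hgy⟩
      rw [hgx, hgy]; exact h2 x hx y hy
  | succ k ih =>
    refine ⟨?_, ih hf.2 h.deriv⟩
    filter_upwards [hf.1, h.eventuallyEq_nhds] with x hx hgx using
      hx.congr_of_eventuallyEq hgx

theorem pred (hα : 0 ≤ α) (hα1 : α ≤ 1) {k : ℕ} {f : ℝ → ℝ} {a : ℝ}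
    (hf : LocHolder α (k + 1) f a) : LocHolder α k f a := by
  induction k generalizing f with
  | zero =>
    obtain ⟨hd, M, U, hU, h1, -⟩ := hf
    obtain ⟨r, hr, h⟩ := Metric.eventually_nhds_iff_ball.1 (hd.and hU)
    refine of_lipschitzOnWith hα hα1 (Metric.ball_mem_nhds a hr)
      ((convex_ball a r).lipschitzOnWith_of_nnnorm_deriv_le (C := M.toNNReal)
        (fun x hx => (h x hx).1) fun x hx => ?_)
    rw [← NNReal.coe_le_coe, coe_nnnorm]
    exact (h1 x (h x hx).2).trans (Real.le_coe_toNNReal M)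
  | succ k ih => exact ⟨hf.1, ih hf.2⟩

theorem bounded (hα : 0 ≤ α) (hα1 : α ≤ 1) {k : ℕ} {f : ℝ → ℝ} {a : ℝ}
    (hf : LocHolder α k f a) : ∃ M, ∀ᶠ x in nhds a, |f x| ≤ M := by
  induction k with
  | zero =>
    obtain ⟨M, U, hU, h1, -⟩ := hf
    exact ⟨M, mem_of_superset hU h1⟩
  | succ k ih => exact ih (hf.pred hα hα1)

theorem add {k : ℕ} {f g : ℝ → ℝ} {a : ℝ} (hf : LocHolder α k f a) (hg : LocHolder α k g a) :
    LocHolder α k (fun x => f x + g x) a := by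
  induction k generalizing f g with
  | zero =>
    obtain ⟨M, U, hU, h1, h2⟩ := hf
    obtain ⟨N, V, hV, h3, h4⟩ := hg
    refine ⟨M + N, U ∩ V, inter_mem hU hV, ?_, ?_⟩
    · rintro x ⟨hx, hx'⟩
      exact (abs_add_le _ _).trans (add_le_add (h1 x hx) (h3 x hx'))
    · rintro x ⟨hx, hx'⟩ y ⟨hy, hy'⟩
      rw [add_sub_add_comm, add_mul]
      exact (abs_add_le _ _).trans (add_le_add (h2 x hx y hy) (h4 x hx' y hy'))
  | succ k ih =>
    refine ⟨?_, (ih hf.2 hg.2).congr ?_⟩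
    · filter_upwards [hf.1, hg.1] with x hx hx' using hx.fun_add hx'
    · filter_upwards [hf.1, hg.1] with x hx hx' using deriv_fun_add hx hx'

theorem mul (hα : 0 ≤ α) (hα1 : α ≤ 1) {k : ℕ} {f g : ℝ → ℝ} {a : ℝ} (hf : LocHolder α k f a)
    (hg : LocHolder α k g a) : LocHolder α k (fun x => f x * g x) a := by
  induction k generalizing f g with
  | zero =>
    obtain ⟨M, U, hU, h1, h2⟩ := hf
    obtain ⟨N, V, hV, h3, h4⟩ := hg
    have hM : 0 ≤ M := (abs_nonneg _).trans (h1 a (mem_of_mem_nhds hU))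
    have hN : 0 ≤ N := (abs_nonneg _).trans (h3 a (mem_of_mem_nhds hV))
    refine ⟨2 * (M * N), U ∩ V, inter_mem hU hV, ?_, ?_⟩
    · rintro x ⟨hx, hx'⟩
      rw [abs_mul]
      have := mul_le_mul (h1 x hx) (h3 x hx') (abs_nonneg _) hM
      linarith [mul_nonneg hM hN]
    · rintro x ⟨hx, hx'⟩ y ⟨hy, hy'⟩
      have e : f x * g x - f y * g y = (f x - f y) * g x + f y * (g x - g y) := by ring
      rw [e]
      refine (abs_add_le _ _).trans ?_
      rw [abs_mul, abs_mul]
      have i1 := mul_le_mul (h2 x hx y hy) (h3 x hx') (abs_nonneg _) (by positivity)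
      have i2 := mul_le_mul (h1 y hy) (h4 x hx' y hy') (abs_nonneg _) hM
      linarith
  | succ k ih =>
    refine ⟨?_, ((ih hf.2 (hg.pred hα hα1)).add (ih (hf.pred hα hα1) hg.2)).congr ?_⟩
    · filter_upwards [hf.1, hg.1] with x hx hx' using hx.fun_mul hx'
    · filter_upwards [hf.1, hg.1] with x hx hx' using deriv_fun_mul hx hx'

theorem comp (hα : 0 ≤ α) (hα1 : α ≤ 1) {k : ℕ} {F w : ℝ → ℝ} {a : ℝ} (hw : LocHolder α k w a)
    (hc : ContinuousAt w a) (hF : ContDiffAt ℝ (⊤ : ℕ∞) F (w a)) :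
    LocHolder α k (fun x => F (w x)) a := by
  induction k generalizing F with
  | zero =>
    obtain ⟨K, t, ht, hK⟩ := (hF.of_le (by norm_cast)).exists_lipschitzOnWith
    obtain ⟨M, U, hU, h1, h2⟩ := hw
    obtain ⟨N, V, hV, h3, h4⟩ := of_lipschitzOnWith zero_le_one le_rfl ht hK
    have hM : 0 ≤ M := (abs_nonneg _).trans (h1 a (mem_of_mem_nhds hU))
    have hN : 0 ≤ N := (abs_nonneg _).trans (h3 _ (mem_of_mem_nhds hV))
    refine ⟨N + N * M, U ∩ w ⁻¹' V, inter_mem hU (hc hV), ?_, ?_⟩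
    · rintro x ⟨hx, hx'⟩
      linarith [h3 _ hx', mul_nonneg hN hM]
    · rintro x ⟨hx, hx'⟩ y ⟨hy, hy'⟩
      have i1 := h4 _ hx' _ hy'
      rw [Real.rpow_one] at i1
      have i2 := mul_le_mul_of_nonneg_left (h2 x hx y hy) hN
      have i3 : 0 ≤ N * |x - y| ^ α := by positivity
      linarith
  | succ k ih =>
    refine ⟨?_, ((ih (hw.pred hα hα1) hF.deriv_infty).mul hα hα1 hw.2).congr ?_⟩
    all_goals
      have h1 : ContDiffAt ℝ 1 F (w a) := hF.of_le (by norm_cast)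
      have h2 := hc.eventually (h1.eventually (by simp))
      filter_upwards [hw.1, h2] with x hx hx'
    · exact (hx'.differentiableAt (by norm_num)).comp x hx
    · exact deriv_comp x (hx'.differentiableAt (by norm_num)) hx

theorem contDiffAt {k : ℕ} {f : ℝ → ℝ} {a : ℝ} (hf : LocHolder α (k + 1) f a) :
    ContDiffAt ℝ k f a := by
  induction k generalizing f with
  | zero =>
    exact contDiffAt_zero.2 ⟨_, hf.1, fun x hx => hx.continuousAt.continuousWithinAt⟩
  | succ k ih =>
    push_cast
    rw [contDiffAt_succ_iff_hasFDerivAt]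
    refine ⟨fun x => ContinuousLinearMap.toSpanSingleton ℝ (deriv f x),
      ⟨_, hf.1, fun x hx => hx.hasDerivAt.hasFDerivAt⟩, ?_⟩
    exact (ContinuousLinearMap.toSpanSingletonCLE (𝕜 := ℝ) (E := ℝ)).contDiff.contDiffAt.comp a
      (ih hf.2)

end LocHolder

end LocalHolder

section Bootstrap

theorem ContDiffBump.exists_lipschitzWith {a : ℝ} (χ : ContDiffBump a) :
    ∃ K, LipschitzWith K χ :=
  (χ.contDiff (n := 1)).lipschitzWith_of_hasCompactSupport χ.hasCompactSupport (by norm_num)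

theorem exists_bump_subset {a : ℝ} {U : Set ℝ} (hU : U ∈ nhds a) :
    ∃ χ : ContDiffBump a, tsupport χ ⊆ U := by
  obtain ⟨r, hr, h⟩ := Metric.nhds_basis_closedBall.mem_iff.1 hU
  exact ⟨⟨r / 2, r, by linarith, by linarith⟩, by rwa [ContDiffBump.tsupport_eq]⟩

theorem BddMeas.bump {a : ℝ} (χ : ContDiffBump a) : BddMeas χ :=
  ⟨χ.continuous.measurable, 1, fun x => by rw [abs_of_nonneg χ.nonneg]; exact χ.le_one⟩

theorem LocHolder.Lop_of_bump_mul {α : ℝ} (hα : 0 ≤ α) (hα1 : α ≤ 1) {k : ℕ} {f : ℝ → ℝ} {a : ℝ}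
    (hf : BddMeas f) (χ : ContDiffBump a)
    (h : LocHolder α k (Lop whithamKernel fun x => χ x * f x) a) :
    LocHolder α k (Lop whithamKernel f) a := by
  have h1 := (BddMeas.bump χ).mul hf
  have h2 := hf.sub h1
  have h3 : ContDiffAt ℝ (⊤ : ℕ∞) (Lop whithamKernel fun x => f x - χ x * f x) a := by
    refine contDiffAt_Lop_of_eventually_eq_zero h2 ?_
    filter_upwards [χ.eventuallyEq_one] with x hx
    simp [hx]
  refine (h.add (.of_contDiffAt hα hα1 h3 k)).congr (Eventually.of_forall fun x => ?_)
  simp only [Lop_sub hf h1]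
  ring

theorem LocHolder.exists_bump_mul {α : ℝ} (hα : 0 ≤ α) (hα1 : α ≤ 1) {f : ℝ → ℝ} {a : ℝ}
    (hf : LocHolder α 0 f a) : ∃ (χ : ContDiffBump a) (C : ℝ), ∀ x y,
      |χ x * f x - χ y * f y| ≤ C * |x - y| ^ α := by
  obtain ⟨M, U, hU, h1, h2⟩ := hf
  obtain ⟨χ, hχ⟩ := exists_bump_subset hU
  obtain ⟨K, hK⟩ := χ.exists_lipschitzWith
  have hM : 0 ≤ M := (abs_nonneg _).trans (h1 a (mem_of_mem_nhds hU))
  have hχH : ∀ x y, |χ x - χ y| ≤ (K + 1) * |x - y| ^ α := by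
    intro x y
    have h := hK.dist_le_mul x y
    rw [Real.dist_eq, Real.dist_eq] at h
    rcases le_total |x - y| 1 with hxy | hxy
    · have h3 := Real.rpow_le_rpow_of_exponent_ge' (abs_nonneg (x - y)) hxy hα hα1
      rw [Real.rpow_one] at h3
      have h4 := mul_le_mul_of_nonneg_left h3 K.coe_nonneg
      have : 0 ≤ |x - y| ^ α := by positivity
      linarith
    · have h3 : 1 ≤ |x - y| ^ α := Real.one_le_rpow hxy hα
      have h4 : |χ x - χ y| ≤ 1 := by
        rw [abs_le]
        constructor <;> linarith [χ.nonneg' x, χ.nonneg' y, χ.le_one (x := x), χ.le_one (x := y)]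
      nlinarith [K.coe_nonneg]
  have hzero : ∀ x, x ∉ U → χ x = 0 := fun x hx => image_eq_zero_of_notMem_tsupport fun h => hx (hχ h)
  have key : ∀ x y, x ∈ U → |χ x * f x - χ y * f y| ≤ (M + (K + 1) * M) * |x - y| ^ α := by
    intro x y hx
    have hp : 0 ≤ |x - y| ^ α := by positivity
    have i1 := mul_le_mul (hχH x y) (h1 x hx) (abs_nonneg _) (by positivity)
    rw [← abs_mul] at i1
    by_cases hy : y ∈ U
    · have e : χ x * f x - χ y * f y = (χ x - χ y) * f x + χ y * (f x - f y) := by ring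
      rw [e]
      refine (abs_add_le _ _).trans ?_
      have i2 : |χ y * (f x - f y)| ≤ 1 * (M * |x - y| ^ α) := by
        rw [abs_mul, abs_of_nonneg χ.nonneg]
        exact mul_le_mul χ.le_one (h2 x hx y hy) (abs_nonneg _) zero_le_one
      linarith
    · rw [hzero y hy, sub_zero] at i1
      rw [hzero y hy, zero_mul, sub_zero]
      linarith [mul_nonneg hM hp]
  refine ⟨χ, M + (K + 1) * M, fun x y => ?_⟩
  by_cases hx : x ∈ U
  · exact key x y hx
  by_cases hy : y ∈ U
  · rw [abs_sub_comm, abs_sub_comm x]; exact key y x hy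
  · rw [hzero x hx, hzero y hy]
    simp only [zero_mul, sub_zero, abs_zero]
    positivity

theorem LocHolder.Lop_succ {α β : ℝ} (hα : 0 ≤ α) (hα1 : α ≤ 1) (hβ : 0 ≤ β) (hβ1 : β ≤ 1)
    {j k : ℕ} {a : ℝ}
    (H : ∀ f, BddMeas f → LocHolder α k f a → LocHolder β j (Lop whithamKernel f) a) {f : ℝ → ℝ}
    (hb : BddMeas f) (hf : LocHolder α (k + 1) f a) :
    LocHolder β (j + 1) (Lop whithamKernel f) a := by
  obtain ⟨M, hM⟩ := hf.2.bounded hα hα1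
  obtain ⟨N, hN⟩ := hb.2
  obtain ⟨χ, hχ⟩ := exists_bump_subset (hf.1.and hM)
  obtain ⟨K, hK⟩ := χ.exists_lipschitzWith
  have hdχ : ∀ x, DifferentiableAt ℝ χ x := fun x =>
    (χ.contDiff (n := 1)).differentiable (by norm_num) x
  have hder : ∀ x, DifferentiableAt ℝ (fun x => χ x * f x) x ∧
      |deriv (fun x => χ x * f x) x| ≤ K * N + |M| := by
    intro x
    have hN0 : 0 ≤ N := (abs_nonneg _).trans (hN 0)
    by_cases hx : x ∈ tsupport χ
    · obtain ⟨h1, h2⟩ := hχ hx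
      refine ⟨(hdχ x).fun_mul h1, ?_⟩
      rw [deriv_fun_mul (hdχ x) h1]
      refine (abs_add_le _ _).trans ?_
      rw [abs_mul, abs_mul, abs_of_nonneg (χ.nonneg' x)]
      have i1 : |deriv χ x| ≤ K := norm_deriv_le_of_lipschitz hK
      have i2 := mul_le_mul i1 (hN x) (abs_nonneg _) K.coe_nonneg
      have i3 := mul_le_mul (χ.le_one (x := x)) (h2.trans (le_abs_self M)) (abs_nonneg _) zero_le_one
      linarith
    · have h0 : (fun x => χ x * f x) =ᶠ[nhds x] fun _ => 0 := by
        filter_upwards [notMem_tsupport_iff_eventuallyEq.1 hx] with y hy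
        simp [hy]
      refine ⟨(differentiableAt_const 0).congr_of_eventuallyEq h0, ?_⟩
      rw [h0.deriv_eq, deriv_const, abs_zero]
      positivity
  have hg := (BddMeas.bump χ).mul hb
  have hg' : BddMeas (deriv fun x => χ x * f x) := ⟨measurable_deriv _, _, fun x => (hder x).2⟩
  have hd := hasDerivAt_Lop hg hg' fun x => (hder x).1.hasDerivAt
  refine .Lop_of_bump_mul hβ hβ1 hb χ ⟨Eventually.of_forall fun x => (hd x).differentiableAt, ?_⟩
  refine (H _ hg' ?_).congr (Eventually.of_forall fun x => (hd x).deriv)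
  exact ((of_contDiffAt hα hα1 χ.contDiffAt _).mul hα hα1 hf).2

theorem LocHolder.Lop_half {k : ℕ} {f : ℝ → ℝ} {a : ℝ} (hb : BddMeas f)
    (hf : LocHolder 0 k f a) : LocHolder (1 / 2) k (Lop whithamKernel f) a := by
  induction k generalizing f with
  | zero =>
    obtain ⟨hm, M, hM⟩ := hb
    have hM0 : 0 ≤ M := (abs_nonneg _).trans (hM 0)
    refine ⟨64 * M, Set.univ, univ_mem, fun x _ => ?_, fun x _ y _ => ?_⟩
    · linarith [abs_Lop_le hm hM x]
    · rw [← Real.sqrt_eq_rpow]; exact abs_Lop_sub_le hm hM x y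
  | succ k ih =>
    exact .Lop_succ le_rfl zero_le_one (by norm_num) (by norm_num) (fun f => ih) hb hf

theorem LocHolder.Lop_three_quarters {k : ℕ} {f : ℝ → ℝ} {a : ℝ} (hb : BddMeas f)
    (hf : LocHolder (1 / 2) k f a) : LocHolder (3 / 4) k (Lop whithamKernel f) a := by
  induction k generalizing f with
  | zero =>
    obtain ⟨χ, C, hC⟩ := hf.exists_bump_mul (by norm_num) (by norm_num)
    have hg := (BddMeas.bump χ).mul hb
    refine .Lop_of_bump_mul (by norm_num) (by norm_num) hb χ ?_
    obtain ⟨D, hD⟩ := exists_abs_Lop_sub_le_of_holder hg hC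
    obtain ⟨hm, M, hM⟩ := hg
    refine ⟨max M D, Set.univ, univ_mem, fun x _ => ?_, fun x _ y _ => (hD x y).trans ?_⟩
    · exact (abs_Lop_le hm hM x).trans (le_max_left _ _)
    · gcongr; exact le_max_right _ _
  | succ k ih =>
    exact .Lop_succ (by norm_num) (by norm_num) (by norm_num) (by norm_num) (fun f => ih) hb hf

theorem LocHolder.Lop_one {k : ℕ} {f : ℝ → ℝ} {a : ℝ} (hb : BddMeas f)
    (hf : LocHolder (3 / 4) k f a) : LocHolder 0 (k + 1) (Lop whithamKernel f) a := by
  induction k generalizing f with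
  | zero =>
    obtain ⟨χ, C, hC⟩ := hf.exists_bump_mul (by norm_num) (by norm_num)
    refine .Lop_of_bump_mul le_rfl zero_le_one hb χ ?_
    obtain ⟨D, g, hD, hg⟩ := exists_hasDerivAt_Lop_of_holder ((BddMeas.bump χ).mul hb) hC
    refine ⟨Eventually.of_forall fun x => (hg x).differentiableAt, D + D, Set.univ, univ_mem, ?_, ?_⟩
    · intro x _
      rw [(hg x).deriv]
      linarith [hD x, abs_nonneg (g x)]
    · intro x _ y _
      rw [(hg x).deriv, (hg y).deriv, Real.rpow_zero, mul_one]
      exact (abs_sub _ _).trans (add_le_add (hD x) (hD y))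
  | succ k ih =>
    exact .Lop_succ (by norm_num) (by norm_num) le_rfl zero_le_one (fun f => ih) hb hf

theorem contDiffAt_of_sq_eq_Lop {v : ℝ → ℝ} (hb : BddMeas v) (hc : Continuous v) {c : ℝ}
    (h : ∀ x, v x ^ 2 = Lop whithamKernel v x + c) {a : ℝ} (ha : 0 < v a) :
    ContDiffAt ℝ (⊤ : ℕ∞) v a := by
  have hs : v =ᶠ[nhds a] fun x => √(Lop whithamKernel v x + c) := by
    filter_upwards [hc.continuousAt.eventually (lt_mem_nhds ha)] with x hx
    rw [← h, Real.sqrt_sq hx.le]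
  have step : ∀ {α : ℝ} {k : ℕ}, 0 ≤ α → α ≤ 1 → LocHolder α k (Lop whithamKernel v) a →
      LocHolder α k v a := by
    intro α k hα hα1 hL
    have hw := hL.add (.of_contDiffAt hα hα1 (contDiffAt_const (c := c)) k)
    refine (hw.comp hα hα1 (F := Real.sqrt)
      ((continuous_Lop hb).add continuous_const).continuousAt ?_).congr hs
    refine Real.contDiffAt_sqrt ?_
    rw [← h]; positivity
  have key : ∀ k, LocHolder 0 k v a := by
    intro k
    induction k with
    | zero =>
      obtain ⟨-, M, hM⟩ := hb
      refine ⟨M + M, Set.univ, univ_mem, fun x _ => ?_, fun x _ y _ => ?_⟩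
      · linarith [hM x, abs_nonneg (v x)]
      · rw [Real.rpow_zero, mul_one]
        exact (abs_sub _ _).trans (add_le_add (hM x) (hM y))
    | succ k ih =>
      exact step le_rfl zero_le_one (.Lop_one hb (step (by norm_num) (by norm_num)
        (.Lop_three_quarters hb (step (by norm_num) (by norm_num) (ih.Lop_half hb)))))
  exact contDiffAt_infty.2 fun n => (key (n + 1)).contDiffAt

end Bootstrap

section Existence

variable {P a s : ℝ} {G : ℝ → ℝ}

theorem IsProfile.pos (hP : 0 < P) (h : IsProfile P a s G) {x : ℝ} (hx : ¬ ∃ n : ℤ, x = n * P) :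
    0 < G x := by
  rw [← h.bell.comp_tri x, ← h.zero]
  refine h.lt hP le_rfl ((tri_nonneg P x).lt_of_ne fun h0 => hx ?_) (tri_le hP x)
  obtain ⟨n, hn⟩ := exists_tri_eq P x
  exact ⟨n, sub_eq_zero.1 (abs_eq_zero.1 (hn.symm.trans h0.symm))⟩

theorem IsProfile.contDiffAt (hP : 0 < P) (h : IsProfile P a s G) {x : ℝ} (hx : 0 < a + G x) :
    ContDiffAt ℝ (⊤ : ℕ∞) (fun x => s - (a + G x)) x := by
  have hb := h.bell.bddMeas hP
  refine contDiffAt_const.sub (contDiffAt_of_sq_eq_Lop ((BddMeas.const a).add hb)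
    (continuous_const.add h.bell.continuous) (c := a ^ 2 - a - Lop whithamKernel G 0)
    (fun y => ?_) hx)
  rw [h.eq, Lop_add (BddMeas.const a) hb, Lop_const]
  ring

theorem IsProfile.steady_whitham (hP : 0 < P) (h : IsProfile P a s G) (x : ℝ) :
    -(2 * s) * (s - (a + G x)) + Lop whithamKernel (fun x => s - (a + G x)) x +
      (s - (a + G x)) ^ 2 = 0 := by
  have hb := h.bell.bddMeas hP
  rw [Lop_sub (BddMeas.const s) ((BddMeas.const a).add hb), Lop_add (BddMeas.const a) hb,
    Lop_const, Lop_const]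
  linear_combination h.eq x + h.speed

theorem IsProfile.add_le_one_sub (hP : 0 < P) (h : IsProfile P a s G) (x : ℝ) :
    a + G x ≤ 1 - s := by
  have hb := h.bell.bddMeas hP
  have h1 := Lop_mono hb (BddMeas.const (G (P / 2))) (h.bell.le_half hP) (P / 2)
  rw [Lop_const] at h1
  have h2 : a + G (P / 2) ≤ 1 - s := by
    by_contra! hlt
    nlinarith [h.eq (P / 2), h.speed, h.s_le]
  linarith [h.bell.le_half hP x]

end Existence

theorem existence_of_periodic_waves (P : ℝ) (hP : 0 < P)
    (lam : ℝ) (hlam : lam ∈ Set.Ioc (0:ℝ) 1) :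
    ∃ (φ : ℝ → ℝ) (μ : ℝ), μ ∈ Set.Ioc (0:ℝ) 1 ∧
      Continuous φ ∧
      Function.Periodic φ P ∧
      (∀ x : ℝ, -μ * φ x + Lop whithamKernel φ x + (φ x) ^ 2 = 0) ∧
      (∀ x : ℝ, φ (-x) = φ x) ∧
      StrictMonoOn φ (Set.Ioo (-(P / 2)) 0) ∧
      ContDiffOn ℝ (⊤ : ℕ∞) φ {x : ℝ | ¬ ∃ n : ℤ, x = n * P} ∧
      (lam < 1 → ContDiff ℝ (⊤ : ℕ∞) φ) ∧
      (∃ M : ℝ, ∀ x y : ℝ, |φ x - φ y| ≤ M * |x - y| ^ (1 / 2 : ℝ)) ∧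
      (∀ x : ℝ, μ - 1 ≤ φ x ∧ φ x ≤ φ 0) ∧
      φ 0 = lam * μ / 2 := by
  obtain ⟨G, s, h⟩ := exists_profile hP hlam.1 hlam.2
  have hc := h.bell.continuous
  have hs := h.s_pos
  refine ⟨fun x => s - ((1 - lam) * s + G x), 2 * s, ⟨by linarith, by linarith [h.s_le]⟩,
    by fun_prop, fun x => by simp only [h.bell.periodic x], h.steady_whitham hP,
    fun x => by simp only [h.bell.even x], ?_, ?_, ?_, ?_, fun x => ⟨?_, ?_⟩, ?_⟩
  · rintro x ⟨hx, hx0⟩ y ⟨hy, hy0⟩ hxy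
    have hlt := h.lt hP (x := -y) (y := -x) (by linarith) (by linarith) (by linarith)
    rw [h.bell.even, h.bell.even] at hlt
    simp only
    linarith
  · intro x hx
    refine (h.contDiffAt hP ?_).contDiffWithinAt
    linarith [h.pos hP hx, h.a_nonneg]
  · intro hl
    refine contDiff_iff_contDiffAt.2 fun x => h.contDiffAt hP ?_
    have : 0 < (1 - lam) * s := mul_pos (by linarith) hs
    linarith [h.nonneg hP x]
  · obtain ⟨M, hM⟩ := h.abs_sub_le_sqrt hP
    refine ⟨M, fun x y => ?_⟩
    rw [← Real.sqrt_eq_rpow, abs_sub_comm]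
    simpa using hM x y
  · linarith [h.add_le_one_sub hP x]
  · simp only [h.zero]
    linarith [h.nonneg hP x]
  · simp only [h.zero]
    ring
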